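/- (Sharpened version of Pintz's Lemma 3) Let k be sufficiently large, ℓ ≍ √k, δ > 0 small compared to k^{−3/2}, and let c₁, c₂ be as in Proposition 1 with N^{c₁} ≤ R ≤ N^{1/(2+δ)}(log N)^{−c₂}. Let H ⊂ [1,h] be an admissible k-tuple with h ≪ log R, and let q be a prime with q = R^β where 0 < β ≤ δ. Then Σ_{N < n ≤ 2N, q | P_H(n)} Λ_R(n;H,ℓ)² ≤ (ν_q(H)/(q − ν_q(H)))·(k²β²/3)·Σ_{N < n ≤ 2N} Λ_R(n;H,ℓ)². -/

import Mathlib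

open Finset

/-- The `n`-th prime number (`nthPrime 0 = 2`). -/
noncomputable def nthPrime (n : ℕ) : ℕ := Nat.nth Nat.Prime n

/-- The prime counting function `π(x)` at a real argument: the number of primes `≤ x`. -/
noncomputable def primePi (x : ℝ) : ℕ := Nat.primeCounting ⌊x⌋₊

/-- `P_H(n) = ∏_{h ∈ H} (n + h)`. -/
def tuplePoly (H : Finset ℕ) (n : ℕ) : ℕ := ∏ h ∈ H, (n + h)

/-- `ν_p(H)`: the number of distinct residue classes modulo `p` occupied by `H`. -/
def nuP (p : ℕ) (H : Finset ℕ) : ℕ := (H.image (· % p)).card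

/-- `H` is admissible: for every prime `p`, the elements of `H` miss a residue class mod `p`. -/
def Admissible (H : Finset ℕ) : Prop := ∀ p : ℕ, p.Prime → nuP p H < p

/-- The singular series `𝔖(H) = ∏_p (1 - 1/p)^{-|H|} (1 - ν_p(H)/p)`. -/
noncomputable def singularSeries (H : Finset ℕ) : ℝ :=
  ∏' p : Nat.Primes, ((1 - 1/((p : ℕ) : ℝ)) ^ (-(H.card : ℤ)) * (1 - (nuP p H : ℝ)/((p : ℕ) : ℝ)))

/-- `Λ_R(n; H, ℓ) = (1/(|H|+ℓ)!) ∑_{d ∣ P_H(n), d ≤ R} μ(d) (log (R/d))^{|H|+ℓ}`. -/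
noncomputable def LambdaR (R : ℝ) (n : ℕ) (H : Finset ℕ) (ℓ : ℕ) : ℝ :=
  (1 / (H.card + ℓ).factorial : ℝ) *
    ∑ d ∈ (tuplePoly H n).divisors.filter (fun d : ℕ => (d : ℝ) ≤ R),
      (ArithmeticFunction.moebius d : ℝ) * (Real.log (R / d)) ^ (H.card + ℓ)

/-- `𝒫(x)`: the product of all primes `≤ x`. -/
noncomputable def primorialReal (x : ℝ) : ℕ :=
  ∏ p ∈ (Finset.range (⌊x⌋₊ + 1)).filter Nat.Prime, p

/-- `θ(n) = log n` if `n` is prime, and `0` otherwise. -/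
noncomputable def theta (n : ℕ) : ℝ := if n.Prime then Real.log n else 0

/-- `∑_{p ≤ N, p prime, p ≡ a (mod q)} log p`. -/
noncomputable def primeSumAP (N q a : ℕ) : ℝ :=
  ∑ p ∈ (Finset.range (N+1)).filter (fun p => p.Prime ∧ p % q = a % q), Real.log p

/-- The primes have level of distribution `ϑ`: for every `A > 0` and `ε > 0`,
`∑_{q ≤ N^{ϑ-ε}} max_{(a,q)=1} |∑_{p ≤ N, p ≡ a (q)} log p - N/φ(q)| ≪_{A,ε} N (log N)^{-A}`
(the max over `a` is expressed via an arbitrary coprime choice function `a : ℕ → ℕ`). -/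
def HasLevelOfDistribution (ϑ : ℝ) : Prop :=
  ∀ A : ℝ, 0 < A → ∀ ε : ℝ, 0 < ε → ∃ C : ℝ, 0 < C ∧
    ∀ N : ℕ, 2 ≤ N → ∀ a : ℕ → ℕ, (∀ q : ℕ, Nat.Coprime (a q) q) →
      ∑ q ∈ Finset.Icc 1 ⌊(N : ℝ) ^ (ϑ - ε)⌋₊,
        |primeSumAP N q (a q) - (N : ℝ) / (Nat.totient q)| ≤ C * N / (Real.log N) ^ A

/-- The number of `j` with `N < p_j ≤ 2N` and `p_{j+1} - p_j ≤ h`. -/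
noncomputable def gapCount (N : ℕ) (h : ℝ) : ℕ :=
  ((Finset.range (2*N+1)).filter (fun j =>
    N < nthPrime j ∧ nthPrime j ≤ 2*N ∧ ((nthPrime (j+1) : ℝ) - nthPrime j) ≤ h)).card

/-- The number of `j` with `N < p_j ≤ 2N` and `p_{j+2} - p_j ≤ h`. -/
noncomputable def gapCount2 (N : ℕ) (h : ℝ) : ℕ :=
  ((Finset.range (2*N+1)).filter (fun j =>
    N < nthPrime j ∧ nthPrime j ≤ 2*N ∧ ((nthPrime (j+2) : ℝ) - nthPrime j) ≤ h)).card


section PartZ1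

open Finset

/-- Euler–Maclaurin correction terms for the zeta function. -/
noncomputable def zterm (n : ℕ) (s : ℂ) : ℂ :=
  (n : ℂ) ^ (-s) - ((n : ℂ) ^ (1 - s) - ((n + 1 : ℕ) : ℂ) ^ (1 - s)) / (s - 1)

lemma zterm_bound {n : ℕ} (hn : 1 ≤ n) {s : ℂ} (hs : 0 < s.re) (hs1 : s ≠ 1) :
    ‖zterm n s‖ ≤ ‖s‖ * (n : ℝ) ^ (-s.re - 1) := by
  have hn0 : (0 : ℝ) < n := by exact_mod_cast hn
  have hs1' : (1 - s) ≠ 0 := sub_ne_zero.mpr (Ne.symm hs1)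
  have hs1'' : (s - 1) ≠ 0 := sub_ne_zero.mpr hs1
  have hder : ∀ r : ℂ, ∀ x : ℝ, 0 < x → r ≠ 0 →
      HasDerivAt (fun y : ℝ => (y : ℂ) ^ r) (r * (x : ℂ) ^ (r - 1)) x := by
    intro r x hx hr
    exact hasDerivAt_ofReal_cpow_const hx.ne' hr
  have h1 : ∀ x ∈ Set.Icc (n : ℝ) (n + 1), ‖(x : ℂ) ^ (-s) - (n : ℂ) ^ (-s)‖ ≤
      ‖s‖ * (n : ℝ) ^ (-s.re - 1) := by
    intro x hx
    have := (convex_Icc (n : ℝ) (n + 1)).norm_image_sub_le_of_norm_hasDerivWithin_le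
      (f := fun y : ℝ => (y : ℂ) ^ (-s)) (f' := fun y => (-s) * (y : ℂ) ^ (-s - 1))
      (C := ‖s‖ * (n : ℝ) ^ (-s.re - 1)) (x := (n : ℝ)) (y := x) ?_ ?_ ?_ hx
    · refine this.trans ?_
      have h2 : ‖x - n‖ ≤ 1 := by
        rw [Real.norm_eq_abs, abs_le]; constructor <;> linarith [hx.1, hx.2]
      calc _ ≤ ‖s‖ * (n : ℝ) ^ (-s.re - 1) * 1 := by gcongr
        _ = _ := by ring
    · intro y hy
      exact (hder (-s) y (hn0.trans_le hy.1) (by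
        intro h; simp at h; simp [h] at hs)).hasDerivWithinAt
    · intro y hy
      have hy0 : 0 < y := hn0.trans_le hy.1
      rw [norm_mul, norm_neg, Complex.norm_cpow_eq_rpow_re_of_pos hy0]
      gcongr
      simp only [Complex.sub_re, Complex.neg_re, Complex.one_re]
      exact Real.rpow_le_rpow_of_nonpos hn0 hy.1 (by linarith)
    · exact ⟨le_refl _, by linarith⟩
  have := (convex_Icc (n : ℝ) (n + 1)).norm_image_sub_le_of_norm_hasDerivWithin_le
      (f := fun y : ℝ => (y : ℂ) ^ (1 - s) / (1 - s) - y * (n : ℂ) ^ (-s))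
      (f' := fun y => (y : ℂ) ^ (-s) - (n : ℂ) ^ (-s))
      (C := ‖s‖ * (n : ℝ) ^ (-s.re - 1)) (x := (n : ℝ)) (y := n + 1) ?_ h1
        ⟨le_refl _, by linarith⟩ ⟨by linarith, le_refl _⟩
  · have e : zterm n s = -(((((n : ℝ) + 1 : ℝ) : ℂ) ^ (1 - s) / (1 - s) - ((n : ℝ) + 1 : ℝ) * (n : ℂ) ^ (-s))
       - ((((n : ℝ) : ℂ)) ^ (1 - s) / (1 - s) - (n : ℝ) * (n : ℂ) ^ (-s))) := by
      unfold zterm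
      push_cast
      have : (s - 1) = - (1 - s) := by ring
      rw [this]
      field_simp
      ring
    rw [e, norm_neg]
    refine this.trans ?_
    simp
  · intro y hy
    have hy0 : 0 < y := hn0.trans_le hy.1
    have h3 := (hder (1 - s) y hy0 hs1').div_const (1 - s)
    have h4 : HasDerivAt (fun y : ℝ => (y : ℂ) * (n : ℂ) ^ (-s)) ((n : ℂ) ^ (-s)) y := by
      simpa using (Complex.ofRealCLM.hasDerivAt (x := y)).mul_const ((n : ℂ) ^ (-s))
    refine ((h3.sub h4).congr_deriv ?_).hasDerivWithinAt
    field_simp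
    ring_nf

lemma zterm_diff {n : ℕ} (hn : 1 ≤ n) {s : ℂ} (hs1 : s ≠ 1) :
    DifferentiableAt ℂ (zterm n) s := by
  unfold zterm
  have h0 : (n : ℂ) ≠ 0 := by exact_mod_cast (by omega : n ≠ 0)
  have h1 : ((n + 1 : ℕ) : ℂ) ≠ 0 := by exact_mod_cast (by omega : n + 1 ≠ 0)
  have h2 : s - 1 ≠ 0 := sub_ne_zero.mpr hs1
  refine DifferentiableAt.sub (DifferentiableAt.const_cpow (by fun_prop) (Or.inl h0)) ?_
  refine DifferentiableAt.div (DifferentiableAt.sub (DifferentiableAt.const_cpow (by fun_prop) (Or.inl h0))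
    (DifferentiableAt.const_cpow (by fun_prop) (Or.inl h1))) (by fun_prop) h2

end PartZ1

section PartZ2

open Finset Filter Topology

lemma summable_zterm {X : ℕ} (hX : 1 ≤ X) {s : ℂ} (hs : 0 < s.re) (hs1 : s ≠ 1) :
    Summable (fun n : ℕ => zterm (n + X) s) := by
  have h : Summable (fun n : ℕ => ‖s‖ * (((n + X : ℕ)) : ℝ) ^ (-s.re - 1)) := by
    refine Summable.mul_left _ ?_
    have := Real.summable_nat_rpow.mpr (by linarith : -s.re - 1 < -1)
    exact (summable_nat_add_iff (f := fun n : ℕ => (n : ℝ) ^ (-s.re - 1)) X).mpr this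
  exact Summable.of_norm_bounded h (fun n => zterm_bound (by omega) hs hs1)

lemma zeta_formula_one {X : ℕ} (hX : 1 ≤ X) {s : ℂ} (hs : 1 < s.re) :
    riemannZeta s = ∑ n ∈ range X, (n : ℂ) ^ (-s) + (X : ℂ) ^ (1 - s) / (s - 1) +
      ∑' n : ℕ, zterm (n + X) s := by
  have hs1 : s ≠ 1 := by rintro rfl; simp at hs
  have hsum : Summable (fun n : ℕ => (n : ℂ) ^ (-s)) := by
    have := Complex.summable_one_div_nat_cpow.mpr hs
    simpa [Complex.cpow_neg] using this
  have h0 : riemannZeta s = ∑' n : ℕ, (n : ℂ) ^ (-s) := by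
    rw [zeta_eq_tsum_one_div_nat_cpow hs]; simp [Complex.cpow_neg]
  rw [h0, ← hsum.sum_add_tsum_nat_add X, add_assoc]
  congr 1
  have hz := summable_zterm hX (by linarith : 0 < s.re) hs1
  have hsX : Summable (fun n : ℕ => ((n + X : ℕ) : ℂ) ^ (-s)) :=
    (summable_nat_add_iff (f := fun n : ℕ => (n : ℂ) ^ (-s)) X).mpr hsum
  rw [← sub_eq_iff_eq_add, ← hsX.tsum_sub hz]
  have h2 := (hsX.sub hz).hasSum.tendsto_sum_nat
  refine tendsto_nhds_unique h2 ?_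
  have e : ∀ m : ℕ, ∑ i ∈ range m, (((i + X : ℕ) : ℂ) ^ (-s) - zterm (i + X) s) =
      (X : ℂ) ^ (1 - s) / (s - 1) - ((m + X : ℕ) : ℂ) ^ (1 - s) / (s - 1) := by
    intro m
    have := Finset.sum_range_sub' (fun i : ℕ => ((i + X : ℕ) : ℂ) ^ (1 - s) / (s - 1)) m
    simp only [zero_add] at this
    rw [← this]
    refine Finset.sum_congr rfl fun i _ => ?_
    unfold zterm
    rw [show i + 1 + X = i + X + 1 by ring]
    ring
  simp_rw [e]
  have h3 : Tendsto (fun m : ℕ => ((m + X : ℕ) : ℂ) ^ (1 - s) / (s - 1)) atTop (𝓝 0) := by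
    rw [tendsto_zero_iff_norm_tendsto_zero]
    have h4 : Tendsto (fun m : ℕ => (((m + X : ℕ)) : ℝ) ^ (-(s.re - 1)) / ‖s - 1‖) atTop (𝓝 (0 / ‖s - 1‖)) := by
      refine Tendsto.div_const ?_ _
      exact (tendsto_rpow_neg_atTop (by linarith)).comp
        (tendsto_natCast_atTop_atTop.comp (tendsto_add_atTop_nat X))
    rw [zero_div] at h4
    refine h4.congr fun m => ?_
    rw [norm_div, Complex.norm_natCast_cpow_of_pos (by omega)]
    simp
  simpa using (tendsto_const_nhds (x := (X : ℂ) ^ (1 - s) / (s - 1))).sub h3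

lemma zeta_formula {X : ℕ} (hX : 1 ≤ X) {s : ℂ} (hs : 1/2 < s.re) (hs4 : s.re < 4)
    (ht : 1/2 < s.im) :
    riemannZeta s = ∑ n ∈ range X, (n : ℂ) ^ (-s) + (X : ℂ) ^ (1 - s) / (s - 1) +
      ∑' n : ℕ, zterm (n + X) s := by
  set T : ℝ := s.im + 1 with hT
  set U : Set ℂ := (Set.Ioo (1/2 : ℝ) 4) ×ℂ (Set.Ioo (1/2 : ℝ) T) with hU
  have hUo : IsOpen U := isOpen_Ioo.reProdIm isOpen_Ioo
  have hUc : IsPreconnected U := by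
    have : Convex ℝ U := ((convex_Ioo _ _).linear_preimage Complex.reLm).inter ((convex_Ioo _ _).linear_preimage Complex.imLm)
    exact this.isPreconnected
  have hne : ∀ z ∈ U, z ≠ 1 := by
    rintro z ⟨_, hz⟩ rfl
    simp at hz
    norm_num at hz
  have hA : DifferentiableOn ℂ riemannZeta U := fun z hz =>
    (differentiableAt_riemannZeta (hne z hz)).differentiableWithinAt
  have hB : DifferentiableOn ℂ (fun s : ℂ => ∑ n ∈ range X, (n : ℂ) ^ (-s) +
      (X : ℂ) ^ (1 - s) / (s - 1) + ∑' n : ℕ, zterm (n + X) s) U := by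
    refine DifferentiableOn.add (DifferentiableOn.add ?_ ?_) ?_
    · refine DifferentiableOn.fun_sum fun n _ => ?_
      intro z hz
      rcases Nat.eq_zero_or_pos n with rfl | hn
      · refine (DifferentiableAt.const_cpow (by fun_prop) (Or.inr ?_)).differentiableWithinAt
        intro h
        have := hz.1.1
        have h2 := congrArg Complex.re h
        simp at h2
        norm_num at this
        linarith
      · exact (DifferentiableAt.const_cpow (by fun_prop) (Or.inl (by exact_mod_cast hn.ne'))).differentiableWithinAt
    · intro z hz
      have hX0 : (X : ℂ) ≠ 0 := by exact_mod_cast (by omega : X ≠ 0)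
      have h1 : DifferentiableAt ℂ (fun s : ℂ => (X : ℂ) ^ (1 - s)) z :=
        DifferentiableAt.const_cpow (by fun_prop) (Or.inl hX0)
      have h2 : DifferentiableAt ℂ (fun s : ℂ => s - 1) z := by fun_prop
      exact (h1.div h2 (sub_ne_zero.mpr (hne z hz))).differentiableWithinAt
    · refine Complex.differentiableOn_tsum_of_summable_norm
        (u := fun n : ℕ => (4 + T) * ((n + X : ℕ) : ℝ) ^ (-(3/2) : ℝ)) ?_ ?_ hUo ?_
      · refine Summable.mul_left _ ?_
        have := Real.summable_nat_rpow.mpr (by norm_num : (-(3/2) : ℝ) < -1)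
        exact (summable_nat_add_iff (f := fun n : ℕ => (n : ℝ) ^ (-(3/2) : ℝ)) X).mpr this
      · intro n z hz
        exact (zterm_diff (by omega) (hne z hz)).differentiableWithinAt
      · intro n z hz
        have h1 : 1/2 < z.re := hz.1.1
        have h2 : z.re < 4 := hz.1.2
        have h3 : 1/2 < z.im := hz.2.1
        have h4 : z.im < T := hz.2.2
        refine (zterm_bound (by omega) (by linarith) (hne z hz)).trans ?_
        have h5 : ‖z‖ ≤ 4 + T := by
          refine (Complex.norm_le_abs_re_add_abs_im z).trans ?_
          rw [abs_of_pos (by linarith), abs_of_pos (by linarith)]; linarith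
        gcongr
        · exact_mod_cast (by omega : 1 ≤ n + X)
        · linarith
  have hz0 : (2 + (T + 1/2)/2 * Complex.I) ∈ U := by
    constructor
    · simp; norm_num
    · simp
      constructor <;> linarith
  have := AnalyticOnNhd.eqOn_of_preconnected_of_eventuallyEq (hA.analyticOnNhd hUo)
    (hB.analyticOnNhd hUo) hUc hz0 ?_
  · exact this ⟨⟨hs, hs4⟩, ⟨ht, by simp [hT]⟩⟩
  · have ho : IsOpen {z : ℂ | 1 < z.re} := isOpen_lt continuous_const Complex.continuous_re
    filter_upwards [ho.mem_nhds (by simp : (2 + (T + 1/2)/2 * Complex.I) ∈ {z : ℂ | 1 < z.re})] with z hz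
    exact zeta_formula_one hX hz

end PartZ2

section PartZ3

open Finset Filter Topology

lemma zeta_upper : ∃ C : ℝ, 0 < C ∧ ∀ s : ℂ, 31/32 ≤ s.re → s.re ≤ 3 → 3/4 ≤ s.im →
    ‖riemannZeta s‖ ≤ C * s.im ^ (1/8 : ℝ) := by
  set S : ℝ := ∑' n : ℕ, (n : ℝ) ^ (-(17/16) : ℝ) with hS
  have hSs : Summable (fun n : ℕ => (n : ℝ) ^ (-(17/16) : ℝ)) :=
    Real.summable_nat_rpow.mpr (by norm_num)
  have hS0 : 0 ≤ S := tsum_nonneg fun n => by positivity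
  refine ⟨1000 + 1000 * S, by positivity, fun s h1 h2 h3 => ?_⟩
  set t := s.im with ht
  -- choose X
  set X : ℕ := ⌈t ^ 2⌉₊ + 1 with hX
  have hX1 : 1 ≤ X := by omega
  have ht0 : 0 < t := by linarith
  have hXl : t ^ 2 ≤ X := by
    rw [hX]; push_cast; linarith [Nat.le_ceil (t ^ 2)]
  have hXu : (X : ℝ) ≤ 6 * t ^ 2 := by
    have := Nat.ceil_lt_add_one (by positivity : 0 ≤ t ^ 2)
    rw [hX]; push_cast; nlinarith
  have hX0 : (0 : ℝ) < X := by positivity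
  have hX1' : (1 : ℝ) ≤ X := by exact_mod_cast hX1
  have hs1 : s ≠ 1 := by
    intro h; rw [ht, h] at h3; simp at h3; norm_num at h3
  have ht8 : 1/2 ≤ t ^ (1/8 : ℝ) := by
    calc (1/2 : ℝ) = (1/2) ^ (1 : ℝ) := by simp
      _ ≤ (1/2) ^ (1/8 : ℝ) := Real.rpow_le_rpow_of_exponent_ge (by norm_num) (by norm_num) (by norm_num)
      _ ≤ t ^ (1/8 : ℝ) := by gcongr; linarith
  have hX32 : (X : ℝ) ^ (1/32 : ℝ) ≤ 2 * t ^ (1/16 : ℝ) := by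
    calc (X : ℝ) ^ (1/32 : ℝ) ≤ (6 * t ^ 2) ^ (1/32 : ℝ) := by gcongr
      _ = 6 ^ (1/32 : ℝ) * t ^ (1/16 : ℝ) := by
        rw [Real.mul_rpow (by norm_num) (by positivity), ← Real.rpow_natCast t 2, ← Real.rpow_mul ht0.le]
        norm_num
      _ ≤ 2 * t ^ (1/16 : ℝ) := by
        gcongr
        calc (6 : ℝ) ^ (1/32 : ℝ) ≤ (2 ^ (3 : ℝ)) ^ (1/32 : ℝ) := by gcongr; norm_num
          _ = 2 ^ (3/32 : ℝ) := by rw [← Real.rpow_mul (by norm_num)]; norm_num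
          _ ≤ 2 ^ (1 : ℝ) := Real.rpow_le_rpow_of_exponent_le (by norm_num) (by norm_num)
          _ = 2 := by simp
  have hlogX : 1 + Real.log X ≤ 33 * (X : ℝ) ^ (1/32 : ℝ) := by
    have := Real.log_le_rpow_div hX0.le (by norm_num : (0 : ℝ) < 1/32)
    have h5 : 1 ≤ (X : ℝ) ^ (1/32 : ℝ) := Real.one_le_rpow hX1' (by norm_num)
    have : Real.log X ≤ 32 * (X : ℝ) ^ (1/32 : ℝ) := by
      refine this.trans (le_of_eq ?_); ring
    linarith
  have ht16 : t ^ (1/16 : ℝ) * t ^ (1/16 : ℝ) = t ^ (1/8 : ℝ) := by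
    rw [← Real.rpow_add ht0]; norm_num
  have hX16 : (X : ℝ) ^ (1/32 : ℝ) * (X : ℝ) ^ (1/32 : ℝ) ≤ 4 * t ^ (1/8 : ℝ) := by
    rw [← ht16]
    have : 0 ≤ (X : ℝ) ^ (1/32 : ℝ) := by positivity
    nlinarith [mul_le_mul hX32 hX32 this (by positivity)]
  rw [zeta_formula hX1 (by linarith) (by linarith) (by linarith)]
  have hA : ‖∑ n ∈ range X, (n : ℂ) ^ (-s)‖ ≤ 132 * t ^ (1/8 : ℝ) := by
    have : ‖∑ n ∈ range X, (n : ℂ) ^ (-s)‖ ≤ ∑ n ∈ range X, (X : ℝ) ^ (1/32 : ℝ) * (n : ℝ)⁻¹ := by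
      refine norm_sum_le_of_le _ fun n hn => ?_
      rcases Nat.eq_zero_or_pos n with rfl | hn0
      · rw [Nat.cast_zero, Complex.zero_cpow]
        · simp
        · intro h
          have := congrArg Complex.re h
          simp at this; linarith
      · rw [Complex.norm_natCast_cpow_of_pos hn0]
        have hn0' : (0 : ℝ) < n := by exact_mod_cast hn0
        have hnX : (n : ℝ) ≤ X := by exact_mod_cast (mem_range.mp hn).le
        calc (n : ℝ) ^ ((-s).re) ≤ (n : ℝ) ^ (1/32 + (-1) : ℝ) := by
              apply Real.rpow_le_rpow_of_exponent_le (by exact_mod_cast hn0)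
              simp; linarith
          _ = (n : ℝ) ^ (1/32 : ℝ) * (n : ℝ)⁻¹ := by
              rw [Real.rpow_add hn0', Real.rpow_neg_one]
          _ ≤ _ := by gcongr
    refine this.trans ?_
    rw [← mul_sum]
    have hh : ∑ n ∈ range X, (n : ℝ)⁻¹ ≤ 1 + Real.log X := by
      obtain ⟨Y, hY⟩ : ∃ Y, X = Y + 1 := ⟨⌈t ^ 2⌉₊, rfl⟩
      have h6 := harmonic_le_one_add_log Y
      have h7 : ((harmonic Y : ℚ) : ℝ) = ∑ n ∈ range X, (n : ℝ)⁻¹ := by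
        rw [hY, Finset.sum_range_succ']
        simp [harmonic]
      rw [← h7]
      refine h6.trans ?_
      rcases Nat.eq_zero_or_pos Y with h0 | h0
      · simp [h0, hY]
      · gcongr; omega
    calc (X : ℝ) ^ (1/32 : ℝ) * ∑ n ∈ range X, (n : ℝ)⁻¹
        ≤ (X : ℝ) ^ (1/32 : ℝ) * (33 * (X : ℝ) ^ (1/32 : ℝ)) := by gcongr; linarith
      _ = 33 * ((X : ℝ) ^ (1/32 : ℝ) * (X : ℝ) ^ (1/32 : ℝ)) := by ring
      _ ≤ 33 * (4 * t ^ (1/8 : ℝ)) := by gcongr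
      _ = _ := by ring
  have hB : ‖(X : ℂ) ^ (1 - s) / (s - 1)‖ ≤ 8 * t ^ (1/8 : ℝ) := by
    rw [norm_div, Complex.norm_natCast_cpow_of_pos (by omega)]
    have h5 : t ≤ ‖s - 1‖ := by
      have := Complex.abs_im_le_norm (s - 1)
      simp at this
      exact (le_abs_self _).trans this
    have h6 : (X : ℝ) ^ ((1 - s).re) ≤ (X : ℝ) ^ (1/32 : ℝ) := by
      apply Real.rpow_le_rpow_of_exponent_le hX1'
      simp; linarith
    have h8 : (X : ℝ) ^ (1/32 : ℝ) ≤ 4 * t ^ (1/8 : ℝ) := by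
      have h5 : 1 ≤ (X : ℝ) ^ (1/32 : ℝ) := Real.one_le_rpow hX1' (by norm_num)
      nlinarith
    rw [div_le_iff₀ (by linarith)]
    nlinarith
  have hC : ‖∑' n : ℕ, zterm (n + X) s‖ ≤ 100 * S * t ^ (1/8 : ℝ) + 0 := by
    have hsn : ‖s‖ ≤ 5 * t := by
      refine (Complex.norm_le_abs_re_add_abs_im s).trans ?_
      rw [abs_of_pos (by linarith), abs_of_pos (by linarith)]; linarith
    have key : ∀ n : ℕ, ‖zterm (n + X) s‖ ≤ 50 * t ^ (1/8 : ℝ) * ((n + X : ℕ) : ℝ) ^ (-(17/16) : ℝ) := by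
      intro n
      refine (zterm_bound (by omega) (by linarith) hs1).trans ?_
      set m : ℝ := ((n + X : ℕ) : ℝ) with hm
      have hmX : (X : ℝ) ≤ m := by rw [hm]; push_cast; linarith [(Nat.cast_nonneg n : (0 : ℝ) ≤ n)]
      have hm1 : 1 ≤ m := by linarith
      have : m ^ (-s.re - 1) ≤ m ^ (-(17/16) : ℝ) * m ^ (-(1/2) : ℝ) := by
        rw [← Real.rpow_add (by linarith)]
        apply Real.rpow_le_rpow_of_exponent_le hm1
        linarith
      have h7 : m ^ (-(1/2) : ℝ) ≤ 1 / t := by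
        calc m ^ (-(1/2) : ℝ) ≤ (t ^ 2) ^ (-(1/2) : ℝ) :=
              Real.rpow_le_rpow_of_nonpos (by positivity) (by linarith) (by norm_num)
          _ = 1 / t := by
            rw [← Real.rpow_natCast t 2, ← Real.rpow_mul ht0.le]
            norm_num [Real.rpow_neg_one]
      have h9 : 0 ≤ m ^ (-(17/16) : ℝ) := by positivity
      calc ‖s‖ * m ^ (-s.re - 1) ≤ (5 * t) * (m ^ (-(17/16) : ℝ) * (1 / t)) := by
            gcongr
            exact this.trans (by gcongr)
        _ = 5 * m ^ (-(17/16) : ℝ) := by field_simp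
        _ ≤ _ := by nlinarith
    have hsX : Summable (fun n : ℕ => ((n + X : ℕ) : ℝ) ^ (-(17/16) : ℝ)) :=
      (summable_nat_add_iff (f := fun n : ℕ => (n : ℝ) ^ (-(17/16) : ℝ)) X).mpr hSs
    have h10 := tsum_of_norm_bounded (hsX.mul_left (50 * t ^ (1/8 : ℝ))).hasSum key
    refine h10.trans ?_
    rw [tsum_mul_left]
    have h11 : ∑' n : ℕ, ((n + X : ℕ) : ℝ) ^ (-(17/16) : ℝ) ≤ S := by
      rw [hS, ← hSs.sum_add_tsum_nat_add X]
      have : 0 ≤ ∑ n ∈ range X, (n : ℝ) ^ (-(17/16) : ℝ) := Finset.sum_nonneg fun n _ => by positivity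
      linarith
    have : 0 ≤ t ^ (1/8 : ℝ) := by linarith
    nlinarith [mul_le_mul_of_nonneg_left h11 this, mul_nonneg hS0 this]
  have h12 := norm_add₃_le (a := ∑ n ∈ range X, (n : ℂ) ^ (-s)) (b := (X : ℂ) ^ (1 - s) / (s - 1))
    (c := ∑' n : ℕ, zterm (n + X) s)
  have : 0 ≤ S * t ^ (1/8 : ℝ) := by positivity
  nlinarith

end PartZ3

section PartZ4

open Finset Filter Topology

lemma zeta_deriv_upper : ∃ C : ℝ, 0 < C ∧ ∀ s : ℂ, 1 ≤ s.re → s.re ≤ 2 → 1 ≤ s.im →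
    ‖deriv riemannZeta s‖ ≤ C * s.im ^ (1/8 : ℝ) := by
  obtain ⟨C, hC, h⟩ := zeta_upper
  refine ⟨64 * C, by positivity, fun s h1 h2 h3 => ?_⟩
  have hd : DiffContOnCl ℂ riemannZeta (Metric.ball s (1/32)) := by
    apply DifferentiableOn.diffContOnCl
    intro z hz
    rw [closure_ball _ (by norm_num)] at hz
    refine (differentiableAt_riemannZeta ?_).differentiableWithinAt
    rintro rfl
    have h4 := Complex.abs_im_le_norm (1 - s)
    rw [Metric.mem_closedBall, dist_eq_norm] at hz
    simp at h4
    linarith [le_abs_self s.im]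
  have := Complex.norm_deriv_le_of_forall_mem_sphere_norm_le (C := 2 * C * s.im ^ (1/8 : ℝ))
    (by norm_num : (0 : ℝ) < 1/32) hd ?_
  · refine this.trans (le_of_eq ?_); ring
  · intro z hz
    rw [Metric.mem_sphere, dist_eq_norm] at hz
    have h4 := Complex.abs_im_le_norm (z - s)
    have h5 := Complex.abs_re_le_norm (z - s)
    rw [hz, Complex.sub_im, abs_le] at h4
    rw [hz, Complex.sub_re, abs_le] at h5
    refine (h z (by linarith) (by linarith) (by linarith)).trans ?_
    have : z.im ^ (1/8 : ℝ) ≤ 2 * s.im ^ (1/8 : ℝ) := by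
      calc z.im ^ (1/8 : ℝ) ≤ (2 * s.im) ^ (1/8 : ℝ) := by
            apply Real.rpow_le_rpow (by linarith) (by linarith) (by norm_num)
        _ = 2 ^ (1/8 : ℝ) * s.im ^ (1/8 : ℝ) := Real.mul_rpow (by norm_num) (by linarith)
        _ ≤ 2 * s.im ^ (1/8 : ℝ) := by
          gcongr
          calc (2 : ℝ) ^ (1/8 : ℝ) ≤ 2 ^ (1 : ℝ) :=
                Real.rpow_le_rpow_of_exponent_le (by norm_num) (by norm_num)
            _ = 2 := by simp
    nlinarith

lemma zeta_real_upper : ∃ C : ℝ, 0 < C ∧ ∀ x : ℝ, 0 < x → x ≤ 1 →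
    ‖riemannZeta (1 + x)‖ ≤ C / x := by
  have hc : ContinuousOn (fun x : ℝ => riemannZeta₁ (1 + x)) (Set.Icc 0 1) := by
    have := differentiable_riemannZeta₁.continuous
    fun_prop
  obtain ⟨C, hC⟩ := isCompact_Icc.exists_bound_of_continuousOn hc
  refine ⟨|C| + 1, by positivity, fun x h0 h1 => ?_⟩
  have hx : (x : ℂ) ≠ 0 := by exact_mod_cast h0.ne'
  rw [riemannZeta_eq_inv_sub_mul (by simpa using hx)]
  have := hC x ⟨h0.le, h1⟩
  rw [norm_mul, add_sub_cancel_left, norm_inv, Complex.norm_real, Real.norm_of_nonneg h0.le,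
    div_eq_inv_mul]
  gcongr
  linarith [le_abs_self C]

lemma zeta_341 {x : ℝ} (hx : 0 < x) (y : ℝ) :
    1 ≤ ‖riemannZeta (1 + x)‖ ^ 3 * ‖riemannZeta (1 + x + Complex.I * y)‖ ^ 4 *
      ‖riemannZeta (1 + x + 2 * Complex.I * y)‖ := by
  have := DirichletCharacter.norm_LFunction_product_ge_one (1 : DirichletCharacter ℂ 1) hx y
  simpa [DirichletCharacter.LFunctionTrivChar, DirichletCharacter.LFunction_modOne_eq, norm_mul, norm_pow] using this

lemma zeta_lower_pos : ∃ c : ℝ, 0 < c ∧ ∀ σ t : ℝ, 0 < σ → σ ≤ 1 → 1 ≤ t →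
    c * t ^ (-(1/2) : ℝ) ≤ ‖riemannZeta (1 + σ + Complex.I * t)‖ := by
  obtain ⟨C, hC, hu⟩ := zeta_upper
  obtain ⟨D, hD, hd⟩ := zeta_deriv_upper
  obtain ⟨B, hB, hb⟩ := zeta_real_upper
  set c₂ : ℝ := (1 / (B ^ 3 * (2 * C))) ^ (1/4 : ℝ) with hc₂
  have hc₂p : 0 < c₂ := by positivity
  have hc₂4 : c₂ ^ 4 = 1 / (B ^ 3 * (2 * C)) := by
    rw [hc₂, ← Real.rpow_natCast, ← Real.rpow_mul (by positivity)]; norm_num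
  set y : ℝ := min 1 (c₂ / (2 * D)) with hy
  have hy0 : 0 < y := by positivity
  have hy1 : y ≤ 1 := min_le_left _ _
  have hyD : D * y ≤ c₂ / 2 := by
    have : y ≤ c₂ / (2 * D) := min_le_right _ _
    rw [le_div_iff₀ (by positivity)] at this
    linarith
  -- fourth power bound
  have hfour : ∀ x t : ℝ, 0 < x → x ≤ 1 → 1 ≤ t →
      c₂ ^ 4 * x ^ 3 * t ^ (-(1/8) : ℝ) ≤ ‖riemannZeta (1 + x + Complex.I * t)‖ ^ 4 := by
    intro x t hx0 hx1 ht
    have h1 := zeta_341 hx0 t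
    have h2 := hb x hx0 hx1
    have h3 := hu (1 + x + 2 * Complex.I * t) (by simp; linarith) (by simp; linarith) (by simp; linarith)
    have h3' : ‖riemannZeta (1 + x + 2 * Complex.I * t)‖ ≤ 2 * C * t ^ (1/8 : ℝ) := by
      refine h3.trans ?_
      have e : (1 + x + 2 * Complex.I * t : ℂ).im = 2 * t := by simp
      rw [e, Real.mul_rpow (by norm_num) (by linarith)]
      have : (2 : ℝ) ^ (1/8 : ℝ) ≤ 2 := by
        calc (2 : ℝ) ^ (1/8 : ℝ) ≤ 2 ^ (1 : ℝ) :=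
                Real.rpow_le_rpow_of_exponent_le (by norm_num) (by norm_num)
            _ = 2 := by simp
      have h5 : 0 ≤ t ^ (1/8 : ℝ) := by positivity
      calc C * (2 ^ (1/8 : ℝ) * t ^ (1/8 : ℝ)) ≤ C * (2 * t ^ (1/8 : ℝ)) := by gcongr
        _ = _ := by ring
    set Z := ‖riemannZeta (1 + x + Complex.I * t)‖ ^ 4 with hZ
    have hZ0 : 0 ≤ Z := by positivity
    have h4 : 1 ≤ (B / x) ^ 3 * Z * (2 * C * t ^ (1/8 : ℝ)) := by
      refine h1.trans ?_
      gcongr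
    rw [hc₂4, Real.rpow_neg (by linarith)]
    have ht8 : 0 < t ^ (1/8 : ℝ) := by positivity
    have e : (B / x) ^ 3 * Z * (2 * C * t ^ (1/8 : ℝ)) = Z * (B ^ 3 * (2 * C) * t ^ (1/8 : ℝ) / x ^ 3) := by
      field_simp
    rw [e] at h4
    have e2 : 1 / (B ^ 3 * (2 * C)) * x ^ 3 * (t ^ (1/8 : ℝ))⁻¹ = 1 / (B ^ 3 * (2 * C) * t ^ (1/8 : ℝ) / x ^ 3) := by
      field_simp
    rw [e2, div_le_iff₀ (by positivity)]
    exact h4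
  have hbig : ∀ x t : ℝ, y ^ 4 * t ^ (-(5/8) : ℝ) ≤ x → x ≤ 1 → 1 ≤ t →
      c₂ * y ^ 3 * t ^ (-(1/2) : ℝ) ≤ ‖riemannZeta (1 + x + Complex.I * t)‖ := by
    intro x t hx0 hx1 ht
    have hp : 0 < y ^ 4 * t ^ (-(5/8) : ℝ) := by positivity
    have h := hfour x t (hp.trans_le hx0) hx1 ht
    refine le_of_pow_le_pow_left₀ (n := 4) (by norm_num) (by positivity) (le_trans ?_ h)
    have e : (c₂ * y ^ 3 * t ^ (-(1/2) : ℝ)) ^ 4 = c₂ ^ 4 * (y ^ 4 * t ^ (-(5/8) : ℝ)) ^ 3 * t ^ (-(1/8) : ℝ) := by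
      have e1 : (t ^ (-(1/2) : ℝ)) ^ 4 = t ^ (-2 : ℝ) := by
        rw [← Real.rpow_natCast, ← Real.rpow_mul (by linarith)]; norm_num
      have e2 : (t ^ (-(5/8) : ℝ)) ^ 3 * t ^ (-(1/8) : ℝ) = t ^ (-2 : ℝ) := by
        rw [← Real.rpow_natCast, ← Real.rpow_mul (by linarith), ← Real.rpow_add (by linarith)]; norm_num
      rw [mul_pow, mul_pow, e1, mul_pow, ← e2]; ring
    rw [e]
    gcongr
  refine ⟨c₂ * y ^ 3 / 2, by positivity, fun σ t h0 h1 ht => ?_⟩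
  set x₀ : ℝ := y ^ 4 * t ^ (-(5/8) : ℝ) with hx₀
  have ht2 : 0 < t ^ (-(1/2) : ℝ) := by positivity
  rcases le_total x₀ σ with hle | hle
  · refine le_trans ?_ (hbig σ t hle h1 ht)
    have : 0 ≤ c₂ * y ^ 3 * t ^ (-(1/2) : ℝ) := by positivity
    linarith
  · have hx01 : x₀ ≤ 1 := by
      have : t ^ (-(5/8) : ℝ) ≤ 1 := Real.rpow_le_one_of_one_le_of_nonpos ht (by norm_num)
      have h4 : y ^ 4 ≤ 1 := pow_le_one₀ hy0.le hy1
      rw [hx₀]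
      exact mul_le_one₀ h4 (by positivity) this
    have hb0 := hbig x₀ t le_rfl hx01 ht
    have hmv := (convex_Icc σ x₀).norm_image_sub_le_of_norm_hasDerivWithin_le
      (f := fun u : ℝ => riemannZeta (1 + u + Complex.I * t))
      (f' := fun u : ℝ => deriv riemannZeta (1 + u + Complex.I * t))
      (C := D * t ^ (1/8 : ℝ)) (x := σ) (y := x₀) ?_ ?_ ⟨le_rfl, hle⟩ ⟨hle, le_rfl⟩
    · rw [Real.norm_of_nonneg (by linarith)] at hmv
      have h6 : ‖riemannZeta (1 + x₀ + Complex.I * t)‖ - ‖riemannZeta (1 + σ + Complex.I * t)‖ ≤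
          D * t ^ (1/8 : ℝ) * (x₀ - σ) := (norm_sub_norm_le _ _).trans hmv
      have h7 : D * t ^ (1/8 : ℝ) * (x₀ - σ) ≤ c₂ * y ^ 3 / 2 * t ^ (-(1/2) : ℝ) := by
        have e1 : t ^ (1/8 : ℝ) * t ^ (-(5/8) : ℝ) = t ^ (-(1/2) : ℝ) := by
          rw [← Real.rpow_add (by linarith)]; norm_num
        calc D * t ^ (1/8 : ℝ) * (x₀ - σ) ≤ D * t ^ (1/8 : ℝ) * x₀ := by gcongr; linarith
          _ = (D * y) * y ^ 3 * t ^ (-(1/2) : ℝ) := by rw [hx₀, ← e1]; ring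
          _ ≤ (c₂ / 2) * y ^ 3 * t ^ (-(1/2) : ℝ) := by gcongr
          _ = _ := by ring
      linarith
    · intro u hu'
      have hne : (1 + u + Complex.I * t : ℂ) ≠ 1 := by
        intro h
        have := congrArg Complex.im h
        simp at this; linarith
      have h8 := (differentiableAt_riemannZeta hne).hasDerivAt
      have h9 : HasDerivAt (fun u : ℝ => (1 + u + Complex.I * t : ℂ)) 1 u := by
        have := (Complex.ofRealCLM.hasDerivAt (x := u))
        simpa using (this.const_add (1 : ℂ)).add_const (Complex.I * t)
      have := h8.comp_of_eq (h := fun u : ℝ => (1 + u + Complex.I * t : ℂ)) u h9 rfl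
      simpa [Function.comp_def] using this.hasDerivWithinAt
    · intro u hu'
      have := hd (1 + u + Complex.I * t) (by simp; linarith [hu'.1]) (by simp; linarith [hu'.2]) (by simpa using ht)
      simpa using this

theorem zeta_lower : ∃ c : ℝ, 0 < c ∧ ∀ s : ℂ, 0 < s.re → s.re ≤ 1 →
    c * (1 + |s.im|) ^ (1/2 : ℝ) ≤ ‖s * riemannZeta (1 + s)‖ := by
  obtain ⟨c, hc, h⟩ := zeta_lower_pos
  -- compact part
  set K : Set ℂ := (Set.Icc (0 : ℝ) 1) ×ℂ (Set.Icc (-1 : ℝ) 1) with hK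
  have hKc : IsCompact K := isCompact_Icc.reProdIm isCompact_Icc
  have hcont : ContinuousOn (fun s : ℂ => ‖riemannZeta₁ (1 + s)‖) K := by
    have := differentiable_riemannZeta₁.continuous
    fun_prop
  have hKne : K.Nonempty := ⟨0, by simp [hK, Complex.mem_reProdIm]⟩
  obtain ⟨z, hz, hmin⟩ := hKc.exists_isMinOn hKne hcont
  set m : ℝ := ‖riemannZeta₁ (1 + z)‖ with hm
  have hm0 : 0 < m := by
    rw [hm, norm_pos_iff]
    by_cases hz0 : z = 0
    · simp [hz0]
    · have h1 := riemannZeta_ne_zero_of_one_le_re (s := 1 + z) (by simpa using hz.1.1)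
      rw [riemannZeta_eq_inv_sub_mul (by simpa using hz0)] at h1
      exact (mul_ne_zero_iff.mp h1).2
  refine ⟨min (m / 2) (c / 2), by positivity, fun s h0 h1 => ?_⟩
  have hs0 : s ≠ 0 := by rintro rfl; simp at h0
  have hpos : 0 < (1 + |s.im|) ^ (1/2 : ℝ) := by positivity
  rcases le_total |s.im| 1 with hle | hle
  · have h2 : s * riemannZeta (1 + s) = riemannZeta₁ (1 + s) := by
      rw [riemannZeta_eq_inv_sub_mul (by simpa using hs0), add_sub_cancel_left]
      field_simp
    rw [h2]
    have h3 : m ≤ ‖riemannZeta₁ (1 + s)‖ := hmin ⟨⟨h0.le, h1⟩, abs_le.mp hle⟩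
    have h4 : (1 + |s.im|) ^ (1/2 : ℝ) ≤ 2 := by
      calc (1 + |s.im|) ^ (1/2 : ℝ) ≤ 2 ^ (1/2 : ℝ) := by gcongr; linarith
        _ ≤ 2 ^ (1 : ℝ) := Real.rpow_le_rpow_of_exponent_le (by norm_num) (by norm_num)
        _ = 2 := by simp
    have h5 := min_le_left (m / 2) (c / 2)
    nlinarith
  · have h2 : c * |s.im| ^ (-(1/2) : ℝ) ≤ ‖riemannZeta (1 + s)‖ := by
      rcases le_total 0 s.im with hp | hp
      · rw [abs_of_nonneg hp] at hle ⊢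
        have := h s.re s.im h0 h1 hle
        have e : (1 + s.re + Complex.I * s.im : ℂ) = 1 + s := by
          rw [add_assoc, mul_comm, Complex.re_add_im]
        rwa [e] at this
      · rw [abs_of_nonpos hp] at hle ⊢
        have := h s.re (-s.im) h0 h1 hle
        have e : (1 + s.re + Complex.I * ((-s.im : ℝ) : ℂ) : ℂ) = (starRingEnd ℂ) (1 + s) := by
          apply Complex.ext <;> simp
        rw [e, riemannZeta_conj, Complex.norm_conj] at this
        exact this
    have h3 : |s.im| ≤ ‖s‖ := Complex.abs_im_le_norm s
    rw [norm_mul]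
    have h4 : |s.im| * |s.im| ^ (-(1/2) : ℝ) = |s.im| ^ (1/2 : ℝ) := by
      rw [← Real.rpow_one_add' (by positivity) (by norm_num)]; norm_num
    have h5 : (1 + |s.im|) ^ (1/2 : ℝ) ≤ 2 * |s.im| ^ (1/2 : ℝ) := by
      calc (1 + |s.im|) ^ (1/2 : ℝ) ≤ (2 * |s.im|) ^ (1/2 : ℝ) := by gcongr; linarith
        _ = 2 ^ (1/2 : ℝ) * |s.im| ^ (1/2 : ℝ) := Real.mul_rpow (by norm_num) (by positivity)
        _ ≤ 2 * |s.im| ^ (1/2 : ℝ) := by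
          gcongr
          calc (2 : ℝ) ^ (1/2 : ℝ) ≤ 2 ^ (1 : ℝ) := Real.rpow_le_rpow_of_exponent_le (by norm_num) (by norm_num)
            _ = 2 := by simp
    calc min (m / 2) (c / 2) * (1 + |s.im|) ^ (1/2 : ℝ) ≤ (c / 2) * (2 * |s.im| ^ (1/2 : ℝ)) := by
          gcongr; exact min_le_right _ _
      _ = |s.im| * (c * |s.im| ^ (-(1/2) : ℝ)) := by rw [← h4]; ring
      _ ≤ _ := by gcongr

end PartZ4

section PartM1

open Finset Filter Topology


lemma mertens_nat (N : ℕ) (hN : 1 ≤ N) :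
    |∑ n ∈ Ioc 0 N, ArithmeticFunction.vonMangoldt n / n - Real.log N| ≤ 7 := by
  have hN0 : (0:ℝ) < N := by exact_mod_cast hN
  have h1 : ∑ n ∈ Ioc 0 N, Real.log n = ∑ n ∈ Ioc 0 N, ArithmeticFunction.vonMangoldt n * ((N / n : ℕ) : ℝ) := by
    have := ArithmeticFunction.sum_Ioc_mul_zeta_eq_sum ArithmeticFunction.vonMangoldt N
    rw [ArithmeticFunction.vonMangoldt_mul_zeta] at this
    simpa [ArithmeticFunction.log_apply] using this
  have h2 : ∑ n ∈ Ioc 0 N, Real.log n = Real.log (N.factorial) := by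
    clear h1 hN hN0
    induction N with
    | zero => simp
    | succ m ih =>
      rw [← Order.succ_eq_add_one, ← Finset.insert_Ioc_right_eq_Ioc_succ (Nat.zero_le m), Finset.sum_insert (by simp), ih, Order.succ_eq_add_one,
        Nat.factorial_succ, Nat.cast_mul, Real.log_mul (by positivity) (by positivity)]
  have h3 := Stirling.le_log_factorial_stirling (n := N) (by omega)
  have h4 : Real.log N.factorial ≤ N * Real.log N := by
    rw [← Real.log_pow]
    apply Real.log_le_log (by positivity)
    exact_mod_cast Nat.factorial_le_pow N
  have hlogN : 0 ≤ Real.log N := Real.log_nonneg (by exact_mod_cast hN)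
  have h5 : 0 ≤ Real.log (2 * Real.pi) := Real.log_nonneg (by linarith [Real.pi_gt_three])
  have h6 : ∑ n ∈ Ioc 0 N, ArithmeticFunction.vonMangoldt n ≤ (Real.log 4 + 4) * N := by
    have := Chebyshev.psi_le_const_mul_self (x := N) hN0.le
    simpa [Chebyshev.psi] using this
  have hlog4 : Real.log 4 < 2 := by
    rw [show (4:ℝ) = 2^2 by norm_num, Real.log_pow]
    have := Real.log_two_lt_d9
    push_cast; linarith
  have h7 : ∀ n ∈ Ioc 0 N, ArithmeticFunction.vonMangoldt n * ((N / n : ℕ) : ℝ) ≤ N * (ArithmeticFunction.vonMangoldt n / n) := by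
    intro n hn
    have hn0 : (0:ℝ) < n := by exact_mod_cast (mem_Ioc.1 hn).1
    have : ((N / n : ℕ) : ℝ) ≤ N / n := Nat.cast_div_le
    have h0 : 0 ≤ ArithmeticFunction.vonMangoldt n := ArithmeticFunction.vonMangoldt_nonneg
    calc ArithmeticFunction.vonMangoldt n * ((N / n : ℕ) : ℝ) ≤ ArithmeticFunction.vonMangoldt n * (N / n) := by gcongr
      _ = _ := by ring
  have h8 : ∀ n ∈ Ioc 0 N, N * (ArithmeticFunction.vonMangoldt n / n) ≤ ArithmeticFunction.vonMangoldt n * ((N / n : ℕ) : ℝ) + ArithmeticFunction.vonMangoldt n := by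
    intro n hn
    have hn0 : (0:ℝ) < n := by exact_mod_cast (mem_Ioc.1 hn).1
    have : (N / n : ℝ) ≤ ((N / n : ℕ) : ℝ) + 1 := by
      rw [div_le_iff₀ hn0]
      have := Nat.lt_mul_div_succ N (mem_Ioc.1 hn).1
      have h' : (N : ℝ) < n * ((N / n : ℕ) + 1) := by exact_mod_cast this
      linarith
    have h0 : 0 ≤ ArithmeticFunction.vonMangoldt n := ArithmeticFunction.vonMangoldt_nonneg
    calc N * (ArithmeticFunction.vonMangoldt n / n) = ArithmeticFunction.vonMangoldt n * (N / n) := by ring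
      _ ≤ ArithmeticFunction.vonMangoldt n * (((N / n : ℕ) : ℝ) + 1) := by gcongr
      _ = _ := by ring
  have h9 := sum_le_sum h7
  have h10 := sum_le_sum h8
  rw [← mul_sum, ← h1, h2] at h9
  rw [← mul_sum, sum_add_distrib, ← h1, h2] at h10
  rw [abs_le]
  constructor
  · have : N * (Real.log N - 1) ≤ N * ∑ n ∈ Ioc 0 N, ArithmeticFunction.vonMangoldt n / n := by linarith
    have := le_of_mul_le_mul_left this hN0
    linarith
  · have : N * ∑ n ∈ Ioc 0 N, ArithmeticFunction.vonMangoldt n / n ≤ N * (Real.log N + 6) := by nlinarith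
    have := le_of_mul_le_mul_left this hN0
    linarith

lemma mertens_exp (τ : ℝ) (hτ : 0 ≤ τ) :
    |∑ n ∈ Ioc 0 ⌊Real.exp τ⌋₊, ArithmeticFunction.vonMangoldt n / n - τ| ≤ 8 := by
  have h1 : 1 ≤ Real.exp τ := Real.one_le_exp hτ
  have h2 : 1 ≤ ⌊Real.exp τ⌋₊ := (Nat.one_le_floor_iff _).2 h1
  have h2' : (1:ℝ) ≤ ⌊Real.exp τ⌋₊ := by exact_mod_cast h2
  have h3 := mertens_nat _ h2
  have h4 : Real.log ⌊Real.exp τ⌋₊ ≤ τ := by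
    rw [Real.log_le_iff_le_exp (by linarith)]
    exact Nat.floor_le (by positivity)
  have h5 : τ ≤ Real.log ⌊Real.exp τ⌋₊ + 1 := by
    have h6 := Nat.lt_floor_add_one (Real.exp τ)
    have h7 : Real.exp τ ≤ 2 * ⌊Real.exp τ⌋₊ := by linarith
    have h8 := Real.log_le_log (by positivity) h7
    rw [Real.log_exp, Real.log_mul (by norm_num) (by positivity)] at h8
    have := Real.log_two_lt_d9
    linarith
  rw [abs_le] at h3 ⊢
  constructor <;> linarith [h3.1, h3.2]

end PartM1

section PartS1

open Finset Filter Topology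

noncomputable def SS (a : ℕ → ℝ) (j : ℕ) (v : ℝ) : ℝ :=
  ∑ m ∈ Ioc 0 ⌊Real.exp v⌋₊, a m * ((v - Real.log m) ^ j / j.factorial)

noncomputable def Fp (j : ℕ) (v : ℝ) : ℝ := if 0 ≤ v then v ^ j / j.factorial else 0

lemma mem_floor_exp {m : ℕ} {v : ℝ} : m ∈ Ioc 0 ⌊Real.exp v⌋₊ ↔ 0 < m ∧ Real.log m ≤ v := by
  rw [mem_Ioc]
  refine and_congr_right fun hm => ?_
  have hm' : (0:ℝ) < m := by exact_mod_cast hm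
  rw [Nat.le_floor_iff (Real.exp_nonneg v), Real.log_le_iff_le_exp hm']

lemma SS_eq (a : ℕ → ℝ) (j : ℕ) {v : ℝ} {X : ℕ} (hX : ⌊Real.exp v⌋₊ ≤ X) :
    SS a j v = ∑ m ∈ Ioc 0 X, a m * Fp j (v - Real.log m) := by
  have h : Ioc 0 ⌊Real.exp v⌋₊ = (Ioc 0 X).filter (fun m : ℕ => Real.log m ≤ v) := by
    ext m
    rw [mem_filter, mem_floor_exp, mem_Ioc]
    constructor
    · rintro ⟨h1, h2⟩
      have := (mem_floor_exp.2 ⟨h1, h2⟩)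
      exact ⟨⟨h1, (mem_Ioc.1 this).2.trans hX⟩, h2⟩
    · rintro ⟨⟨h1, _⟩, h2⟩; exact ⟨h1, h2⟩
  rw [SS, h, sum_filter]
  refine sum_congr rfl fun m _ => ?_
  unfold Fp
  by_cases h : Real.log m ≤ v
  · rw [if_pos h, if_pos (by linarith)]
  · rw [if_neg h, if_neg (by linarith)]; simp

lemma SS_neg (a : ℕ → ℝ) (j : ℕ) {v : ℝ} (hv : v < 0) : SS a j v = 0 := by
  unfold SS
  rw [Nat.floor_eq_zero.2 (by rw [← Real.exp_zero]; exact Real.exp_lt_exp.2 hv)]; simp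

lemma SS_zero (a : ℕ → ℝ) {j : ℕ} (hj : 1 ≤ j) : SS a j 0 = 0 := by
  unfold SS
  have : j ≠ 0 := by omega
  simp [this]

lemma SS_nonpos (a : ℕ → ℝ) {j : ℕ} (hj : 1 ≤ j) {v : ℝ} (hv : v ≤ 0) : SS a j v = 0 := by
  rcases hv.lt_or_eq with h | h
  · exact SS_neg a j h
  · rw [h]; exact SS_zero a hj

lemma SS_mul (a : ℕ → ℝ) (j : ℕ) (v : ℝ) :
    v * SS a j v = (j + 1) * SS a (j + 1) v + SS (fun n => a n * Real.log n) j v := by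
  unfold SS
  rw [mul_sum, mul_sum, ← sum_add_distrib]
  refine sum_congr rfl fun m _ => ?_
  rw [Nat.factorial_succ]
  have h1 : (j.factorial : ℝ) ≠ 0 := by positivity
  have h2 : (j + 1 : ℝ) ≠ 0 := by positivity
  push_cast
  field_simp
  ring

lemma SS_mono {a b : ℕ → ℝ} (h : ∀ n, 0 < n → a n ≤ b n) (j : ℕ) (v : ℝ) : SS a j v ≤ SS b j v := by
  unfold SS
  refine sum_le_sum fun m hm => ?_
  have hm' := mem_floor_exp.1 hm
  refine mul_le_mul_of_nonneg_right (h m hm'.1) ?_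
  have : 0 ≤ v - Real.log m := by linarith [hm'.2]
  positivity

lemma SS_congr {a b : ℕ → ℝ} (h : ∀ n, 0 < n → a n = b n) (j : ℕ) (v : ℝ) : SS a j v = SS b j v := by
  unfold SS
  refine sum_congr rfl fun m hm => ?_
  rw [h m (mem_floor_exp.1 hm).1]

lemma SS_nonneg {a : ℕ → ℝ} (h : ∀ n, 0 < n → 0 ≤ a n) (j : ℕ) (v : ℝ) : 0 ≤ SS a j v := by
  have := SS_mono h j v
  simpa [SS] using this

lemma SS_const_mul (c : ℝ) (a : ℕ → ℝ) (j : ℕ) (v : ℝ) :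
    SS (fun n => c * a n) j v = c * SS a j v := by
  unfold SS
  rw [mul_sum]; exact sum_congr rfl fun _ _ => by ring

lemma SS_add (a b : ℕ → ℝ) (j : ℕ) (v : ℝ) :
    SS (fun n => a n + b n) j v = SS a j v + SS b j v := by
  unfold SS
  rw [← sum_add_distrib]; exact sum_congr rfl fun _ _ => by ring

lemma SS_neg_fun (a : ℕ → ℝ) (j : ℕ) (v : ℝ) :
    SS (fun n => - a n) j v = - SS a j v := by
  unfold SS
  rw [← sum_neg_distrib]; exact sum_congr rfl fun _ _ => by ring

lemma Fp_hasDerivAt {j : ℕ} (hj : 1 ≤ j) (v : ℝ) : HasDerivAt (Fp (j + 1)) (Fp j v) v := by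
  have key : ∀ w : ℝ, HasDerivAt (fun x : ℝ => x ^ (j+1) / (j+1).factorial) (w ^ j / j.factorial) w := by
    intro w
    have := (hasDerivAt_pow (j+1) w).div_const ((j+1).factorial : ℝ)
    have h3 : ((j + 1 : ℕ) : ℝ) * w ^ (j + 1 - 1) / ((j + 1).factorial : ℝ) = w ^ j / j.factorial := by
      rw [Nat.factorial_succ, Nat.add_sub_cancel]; push_cast
      have h1 : (j.factorial : ℝ) ≠ 0 := by positivity
      have h2 : (j + 1 : ℝ) ≠ 0 := by positivity
      field_simp
    rw [h3] at this
    exact this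
  rcases lt_trichotomy v 0 with h | h | h
  · have : Fp j v = 0 := if_neg (by linarith)
    rw [this]
    refine (hasDerivAt_const v (0:ℝ)).congr_of_eventuallyEq ?_
    filter_upwards [eventually_lt_nhds h] with x hx
    exact if_neg (by linarith)
  · subst h
    have h0 : Fp j 0 = 0 := by
      unfold Fp; have : j ≠ 0 := by omega
      simp [this]
    rw [h0]
    have hj' : j ≠ 0 := by omega
    have hk := key 0
    simp only [zero_pow hj', zero_div] at hk
    rw [hasDerivAt_iff_isLittleO] at hk ⊢
    refine Asymptotics.IsBigO.trans_isLittleO ?_ hk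
    refine Asymptotics.IsBigO.of_bound 1 (Eventually.of_forall fun x => ?_)
    unfold Fp
    by_cases hx : 0 ≤ x
    · simp [hx]
    · simp [hx]; positivity
  · have : Fp j v = v ^ j / j.factorial := if_pos h.le
    rw [this]
    refine (key v).congr_of_eventuallyEq ?_
    filter_upwards [eventually_gt_nhds h] with x hx
    exact if_pos hx.le

lemma SS_hasDerivAt (a : ℕ → ℝ) {j : ℕ} (hj : 1 ≤ j) (v : ℝ) :
    HasDerivAt (SS a (j + 1)) (SS a j v) v := by
  have hX : ∀ w ≤ v + 1, ⌊Real.exp w⌋₊ ≤ ⌊Real.exp (v+1)⌋₊ := fun w hw =>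
    Nat.floor_le_floor (Real.exp_le_exp.2 hw)
  rw [SS_eq a j (hX v (by linarith))]
  have : HasDerivAt (fun w => ∑ m ∈ Ioc 0 ⌊Real.exp (v+1)⌋₊, a m * Fp (j+1) (w - Real.log m))
      (∑ m ∈ Ioc 0 ⌊Real.exp (v+1)⌋₊, a m * Fp j (v - Real.log m)) v := by
    refine HasDerivAt.fun_sum fun m _ => ?_
    refine HasDerivAt.const_mul _ ?_
    have := (Fp_hasDerivAt hj (v - Real.log m)).comp_sub_const v (Real.log m)
    simpa using this
  refine this.congr_of_eventuallyEq ?_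
  filter_upwards [eventually_lt_nhds (show v < v + 1 by linarith)] with w hw
  exact SS_eq a (j+1) (hX w hw.le)

lemma Fp_continuous {j : ℕ} (hj : 1 ≤ j) : Continuous (Fp j) := by
  have : Fp j = fun v : ℝ => (max v 0) ^ j / (j.factorial : ℝ) := by
    ext v
    unfold Fp
    by_cases h : 0 ≤ v
    · rw [if_pos h, max_eq_left h]
    · rw [if_neg h, max_eq_right (by linarith), zero_pow (by omega), zero_div]
  rw [this]; fun_prop

lemma SS_continuous (a : ℕ → ℝ) {j : ℕ} (hj : 1 ≤ j) : Continuous (SS a j) := by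
  rw [continuous_iff_continuousAt]
  intro v
  have hX : ∀ w ≤ v + 1, ⌊Real.exp w⌋₊ ≤ ⌊Real.exp (v+1)⌋₊ := fun w hw =>
    Nat.floor_le_floor (Real.exp_le_exp.2 hw)
  have h1 : Continuous (fun w => ∑ m ∈ Ioc 0 ⌊Real.exp (v+1)⌋₊, a m * Fp j (w - Real.log m)) := by
    have := Fp_continuous hj
    fun_prop
  refine h1.continuousAt.congr ?_
  filter_upwards [eventually_lt_nhds (show v < v + 1 by linarith)] with w hw
  exact (SS_eq a j (hX w hw.le)).symm

lemma SS_integral (a : ℕ → ℝ) {j : ℕ} (hj : 1 ≤ j) (u v : ℝ) :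
    ∫ w in u..v, SS a j w = SS a (j+1) v - SS a (j+1) u :=
  intervalIntegral.integral_eq_sub_of_hasDerivAt (fun x _ => SS_hasDerivAt a hj x)
    ((SS_continuous a hj).intervalIntegrable _ _)

def dconv (a b : ℕ → ℝ) (n : ℕ) : ℝ := ∑ x ∈ n.divisorsAntidiagonal, a x.1 * b x.2

lemma SS_dconv (a b : ℕ → ℝ) (j : ℕ) (v : ℝ) :
    SS (dconv a b) j v = ∑ n ∈ Ioc 0 ⌊Real.exp v⌋₊, b n * SS a j (v - Real.log n) := by
  set X := ⌊Real.exp v⌋₊ with hX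
  have hSS : ∀ n ∈ Ioc 0 X, SS a j (v - Real.log n) =
      ∑ m ∈ Ioc 0 X, a m * Fp j (v - Real.log n - Real.log m) := by
    intro n hn
    apply SS_eq
    rw [hX]
    apply Nat.floor_le_floor
    apply Real.exp_le_exp.2
    have : 0 ≤ Real.log n := Real.log_natCast_nonneg n
    linarith
  rw [sum_congr rfl (fun n hn => by rw [hSS n hn]), SS_eq (dconv a b) j le_rfl, ← hX]
  simp_rw [mul_sum]
  calc ∑ n ∈ Ioc 0 X, dconv a b n * Fp j (v - Real.log n)
      = ∑ n ∈ Ioc 0 X, ∑ x ∈ Ioc 0 X ×ˢ Ioc 0 X, if x.1 * x.2 = n then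
          a x.1 * b x.2 * Fp j (v - Real.log n) else 0 := by
        refine sum_congr rfl fun n hn ↦ ?_
        rw [mem_Ioc] at hn
        rw [dconv, Nat.divisorsAntidiagonal_eq_prod_filter_of_le hn.1.ne' hn.2, sum_mul, sum_filter]
    _ = ∑ x ∈ Ioc 0 X ×ˢ Ioc 0 X, if x.1 * x.2 ∈ Ioc 0 X then
          a x.1 * b x.2 * Fp j (v - Real.log (x.1 * x.2 : ℕ)) else 0 := by
        rw [sum_comm]
        refine sum_congr rfl fun x _ => ?_
        rw [sum_ite_eq (Ioc 0 X) (x.1 * x.2) (fun n => a x.1 * b x.2 * Fp j (v - Real.log n))]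
    _ = ∑ x ∈ Ioc 0 X ×ˢ Ioc 0 X, b x.2 * (a x.1 * Fp j (v - Real.log x.2 - Real.log x.1)) := by
        refine sum_congr rfl fun x hx => ?_
        rw [mem_product, mem_Ioc, mem_Ioc] at hx
        have h1 : (x.1 : ℝ) ≠ 0 := by have := hx.1.1; positivity
        have h2 : (x.2 : ℝ) ≠ 0 := by have := hx.2.1; positivity
        have h3 : v - Real.log (x.1 * x.2 : ℕ) = v - Real.log x.2 - Real.log x.1 := by
          push_cast; rw [Real.log_mul h1 h2]; ring
        split_ifs with h
        · rw [h3]; ring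
        · rw [hX, mem_floor_exp] at h
          have h4 : ¬ 0 ≤ v - Real.log x.2 - Real.log x.1 := by
            intro h5; apply h
            refine ⟨Nat.mul_pos hx.1.1 hx.2.1, ?_⟩
            rw [← h3] at h5; linarith
          rw [Fp, if_neg h4]; ring
    _ = _ := by rw [sum_product, sum_comm]

lemma SS_dconv_integral (a b : ℕ → ℝ) {j : ℕ} (hj : 1 ≤ j) {v : ℝ} (hv : 0 ≤ v) :
    IntervalIntegrable (fun w => SS b 0 (v - w) * SS a j w) MeasureTheory.volume 0 v ∧
    SS (dconv a b) (j+1) v = ∫ w in (0:ℝ)..v, SS b 0 (v - w) * SS a j w := by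
  set X := ⌊Real.exp v⌋₊ with hX
  have h1 : ∀ w ∈ Set.Ioc 0 v, SS b 0 (v - w) * SS a j w =
      ∑ n ∈ Ioc 0 X, b n * (Set.Iic (v - Real.log n)).indicator (SS a j) w := by
    intro w hw
    rw [SS_eq b 0 (X := X), sum_mul]
    · refine sum_congr rfl fun n _ => ?_
      simp only [Set.indicator_apply, Set.mem_Iic]
      unfold Fp
      by_cases h : w ≤ v - Real.log n
      · rw [if_pos (by linarith), if_pos h]; simp
      · rw [if_neg (by linarith), if_neg h]; simp
    · rw [hX]; exact Nat.floor_le_floor (Real.exp_le_exp.2 (by linarith [hw.1]))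
  have hinteg : ∀ n, IntervalIntegrable (fun w => b n * (Set.Iic (v - Real.log n)).indicator (SS a j) w)
      MeasureTheory.volume 0 v := by
    intro n
    rw [intervalIntegrable_iff]
    apply MeasureTheory.Integrable.const_mul
    apply MeasureTheory.Integrable.indicator _ measurableSet_Iic
    exact ((SS_continuous a hj).intervalIntegrable 0 v).def'
  have hint2 : IntervalIntegrable (fun w => ∑ n ∈ Ioc 0 X, b n * (Set.Iic (v - Real.log n)).indicator (SS a j) w)
      MeasureTheory.volume 0 v := by
    have := IntervalIntegrable.sum (μ := MeasureTheory.volume) (a := 0) (b := v) (Ioc 0 X) (f := fun n => fun w => b n * (Set.Iic (v - Real.log n)).indicator (SS a j) w)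
      (fun n _ => hinteg n)
    refine this.congr ?_
    intro w _
    simp
  constructor
  · refine hint2.congr ?_
    intro w hw
    rw [Set.uIoc_of_le hv] at hw
    exact (h1 w hw).symm
  · rw [SS_dconv, ← hX]
    have h2 : ∫ w in (0:ℝ)..v, SS b 0 (v - w) * SS a j w =
        ∫ w in (0:ℝ)..v, ∑ n ∈ Ioc 0 X, b n * (Set.Iic (v - Real.log n)).indicator (SS a j) w := by
      apply intervalIntegral.integral_congr_ae
      refine Eventually.of_forall fun w hw => ?_
      rw [Set.uIoc_of_le hv] at hw
      exact h1 w hw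
    rw [h2, intervalIntegral.integral_finsetSum (fun n _ => hinteg n)]
    refine sum_congr rfl fun n hn => ?_
    rw [intervalIntegral.integral_const_mul]
    congr 1
    rw [hX, mem_floor_exp] at hn
    have h0 : 0 ≤ Real.log n := Real.log_natCast_nonneg n
    have h3 : Set.Ioc 0 v ∩ Set.Iic (v - Real.log n) = Set.Ioc 0 (v - Real.log n) := by
      ext w; simp only [Set.mem_inter_iff, Set.mem_Ioc, Set.mem_Iic]
      constructor
      · rintro ⟨⟨h, _⟩, h'⟩; exact ⟨h, h'⟩
      · rintro ⟨h, h'⟩; exact ⟨⟨h, by linarith⟩, h'⟩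
    have h4 := SS_integral a hj 0 (v - Real.log n)
    rw [SS_zero a (by omega), sub_zero] at h4
    rw [← h4, intervalIntegral.integral_of_le hv, intervalIntegral.integral_of_le (by linarith [hn.2]),
      MeasureTheory.setIntegral_indicator measurableSet_Iic, h3]

lemma SS_lin_integral (a : ℕ → ℝ) {j : ℕ} (hj : 1 ≤ j) (v : ℝ) :
    ∫ w in (0:ℝ)..v, (v - w) * SS a j w = SS a (j+2) v := by
  have hd : ∀ w ∈ Set.uIcc 0 v, HasDerivAt (fun w => (v - w) * SS a (j+1) w + SS a (j+2) w)
      ((v - w) * SS a j w) w := by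
    intro w _
    have h1 := (((hasDerivAt_id w).const_sub v).mul (SS_hasDerivAt a hj w)).add
      (SS_hasDerivAt a (j := j+1) (by omega) w)
    have h2 : (v - w) * SS a j w = -1 * SS a (j+1) w + (v - id w) * SS a j w + SS a (j+1) w := by
      simp
    rw [h2]
    exact h1
  have hc := SS_continuous a hj
  rw [intervalIntegral.integral_eq_sub_of_hasDerivAt hd (Continuous.intervalIntegrable (by fun_prop) _ _)]
  rw [SS_zero a (by omega), SS_zero a (by omega)]
  simp

/-- two-sided convolution estimate -/
lemma SS_dconv_bound (a b : ℕ → ℝ) {j i : ℕ} (hj : 1 ≤ j) {v k E B : ℝ} (hv : 0 ≤ v) (hE : 0 ≤ E)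
    (hb : ∀ τ, 0 ≤ τ → τ ≤ v → |SS b 0 τ - k * τ| ≤ E)
    (ha : ∀ w, 0 ≤ w → w ≤ v → |SS a j w| ≤ B * w ^ i) :
    |SS (dconv a b) (j+1) v - k * SS a (j+2) v| ≤ E * B * v ^ (i+1) := by
  obtain ⟨hi, he⟩ := SS_dconv_integral a b hj hv
  have hc := SS_continuous a hj
  rw [he, ← SS_lin_integral a hj v, ← intervalIntegral.integral_const_mul,
    ← intervalIntegral.integral_sub hi (Continuous.intervalIntegrable (by fun_prop) _ _)]
  have : ∀ w ∈ Set.uIoc 0 v, ‖SS b 0 (v - w) * SS a j w - k * ((v - w) * SS a j w)‖ ≤ E * (B * v ^ i) := by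
    intro w hw
    rw [Set.uIoc_of_le hv] at hw
    have h1 := hb (v - w) (by linarith [hw.2]) (by linarith [hw.1])
    have h2 := ha w hw.1.le hw.2
    rw [show SS b 0 (v - w) * SS a j w - k * ((v - w) * SS a j w)
      = (SS b 0 (v - w) - k * (v - w)) * SS a j w by ring, norm_mul]
    have hB : 0 ≤ B := by
      have := (abs_nonneg _).trans h2
      have hp : 0 < w ^ i := pow_pos hw.1 i
      by_contra hB; push Not at hB
      nlinarith
    have h3 : B * w ^ i ≤ B * v ^ i := by
      have := hw.1.le; have := hw.2; gcongr
    exact mul_le_mul h1 (h2.trans h3) (norm_nonneg _) hE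
  have := intervalIntegral.norm_integral_le_of_norm_le_const this
  rw [sub_zero, abs_of_nonneg hv] at this
  calc _ ≤ _ := this
    _ = _ := by ring

/-- one-sided convolution estimate -/
lemma SS_dconv_upper (a b : ℕ → ℝ) {j : ℕ} (hj : 1 ≤ j) {v k C : ℝ} (hv : 0 ≤ v)
    (ha0 : ∀ n, 0 < n → 0 ≤ a n)
    (hb : ∀ τ, 0 ≤ τ → τ ≤ v → SS b 0 τ ≤ k * τ + C) :
    SS (dconv a b) (j+1) v ≤ k * SS a (j+2) v + C * SS a (j+1) v := by
  obtain ⟨hi, he⟩ := SS_dconv_integral a b hj hv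
  have hc := SS_continuous a hj
  have h4 := SS_integral a hj 0 v
  rw [SS_zero a (by omega), sub_zero] at h4
  rw [he, ← SS_lin_integral a hj v, ← h4, ← intervalIntegral.integral_const_mul,
    ← intervalIntegral.integral_const_mul, ← intervalIntegral.integral_add
    (Continuous.intervalIntegrable (by fun_prop) _ _) (Continuous.intervalIntegrable (by fun_prop) _ _)]
  apply intervalIntegral.integral_mono_on hv hi (Continuous.intervalIntegrable (by fun_prop) _ _)
  intro w hw
  have h1 := hb (v - w) (by linarith [hw.2]) (by linarith [hw.1])
  have h2 := SS_nonneg ha0 j w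
  nlinarith

end PartS1

section PartF1

open Finset Filter Topology


structure NuOK (k : ℕ) (y : ℝ) (ν : ℕ → ℕ) : Prop where
  one_le : ∀ p : ℕ, p.Prime → 1 ≤ ν p
  le_k : ∀ p : ℕ, p.Prime → ν p ≤ k
  lt : ∀ p : ℕ, p.Prime → ν p < p
  eq_k : ∀ p : ℕ, p.Prime → y < p → ν p = k

/-- local density -/
noncomputable def fl (ν : ℕ → ℕ) (p : ℕ) : ℝ := (ν p : ℝ) / p

noncomputable def cmf (ν : ℕ → ℕ) (n : ℕ) : ℝ := n.factorization.prod fun p a => (fl ν p) ^ a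

lemma cmf_one (ν : ℕ → ℕ) : cmf ν 1 = 1 := by simp [cmf]

lemma cmf_mul (ν : ℕ → ℕ) {m n : ℕ} (hm : m ≠ 0) (hn : n ≠ 0) :
    cmf ν (m * n) = cmf ν m * cmf ν n := by
  unfold cmf
  rw [Nat.factorization_mul hm hn]
  exact Finsupp.prod_add_index' (fun _ => pow_zero _) (fun _ _ _ => pow_add _ _ _)

lemma cmf_prime_pow (ν : ℕ → ℕ) {p : ℕ} (hp : p.Prime) (i : ℕ) : cmf ν (p ^ i) = fl ν p ^ i := by
  unfold cmf
  rw [hp.factorization_pow, Finsupp.prod_single_index (by simp)]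

lemma cmf_prime (ν : ℕ → ℕ) {p : ℕ} (hp : p.Prime) : cmf ν p = fl ν p := by
  have := cmf_prime_pow ν hp 1
  simpa using this

lemma cmf_sqf (ν : ℕ → ℕ) {n : ℕ} (hn : Squarefree n) : cmf ν n = ∏ p ∈ n.primeFactors, fl ν p := by
  unfold cmf Finsupp.prod
  rw [Nat.support_factorization]
  refine prod_congr rfl fun p hp => ?_
  have h1 := (Nat.squarefree_iff_factorization_le_one hn.ne_zero).1 hn p
  have h2 : 1 ≤ n.factorization p :=
    (Nat.prime_of_mem_primeFactors hp).factorization_pos_of_dvd hn.ne_zero (Nat.dvd_of_mem_primeFactors hp)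
  simp [le_antisymm h1 h2]

section
variable {k : ℕ} {y : ℝ} {ν : ℕ → ℕ}

lemma NuOK.fl_pos (h : NuOK k y ν) {p : ℕ} (hp : p.Prime) : 0 < fl ν p := by
  have := h.one_le p hp
  have := hp.pos
  unfold fl; positivity

lemma NuOK.fl_lt_one (h : NuOK k y ν) {p : ℕ} (hp : p.Prime) : fl ν p < 1 := by
  have h1 := h.lt p hp
  have h0 : (0:ℝ) < p := by exact_mod_cast hp.pos
  unfold fl; rw [div_lt_one h0]; exact_mod_cast h1

lemma NuOK.fl_le (h : NuOK k y ν) {p : ℕ} (hp : p.Prime) : fl ν p ≤ k / p := by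
  unfold fl
  have := h.le_k p hp
  gcongr

lemma NuOK.one_sub_ge (h : NuOK k y ν) {p : ℕ} (hp : p.Prime) : 1 / (p:ℝ) ≤ 1 - fl ν p := by
  have h0 : (0:ℝ) < p := by exact_mod_cast hp.pos
  have h1 : (ν p : ℝ) + 1 ≤ p := by exact_mod_cast h.lt p hp
  unfold fl
  rw [div_le_iff₀ h0, sub_mul, div_mul_cancel₀ _ h0.ne']
  linarith

lemma NuOK.one_le_k (h : NuOK k y ν) : 1 ≤ k :=
  (h.one_le 2 Nat.prime_two).trans (h.le_k 2 Nat.prime_two)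

lemma NuOK.inv_one_sub_le (h : NuOK k y ν) {p : ℕ} (hp : p.Prime) : 1 / (1 - fl ν p) ≤ 2 * k := by
  have h0 : (0:ℝ) < p := by exact_mod_cast hp.pos
  have hk : (1:ℝ) ≤ k := by exact_mod_cast h.one_le_k
  have hs : 0 < 1 - fl ν p := by linarith [h.fl_lt_one hp]
  rw [div_le_iff₀ hs]
  rcases le_or_gt (p:ℝ) (2 * k) with h1 | h1
  · have h2 := h.one_sub_ge hp
    rw [div_le_iff₀ h0] at h2
    nlinarith
  · have h2 : fl ν p ≤ 1/2 := by
      refine (h.fl_le hp).trans ?_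
      rw [div_le_iff₀ h0]; linarith
    nlinarith

/-- `g(p) = f/(1-f)` -/
noncomputable def gl (ν : ℕ → ℕ) (p : ℕ) : ℝ := fl ν p / (1 - fl ν p)

lemma NuOK.gl_pos (h : NuOK k y ν) {p : ℕ} (hp : p.Prime) : 0 < gl ν p :=
  div_pos (h.fl_pos hp) (by linarith [h.fl_lt_one hp])

lemma NuOK.gl_le (h : NuOK k y ν) {p : ℕ} (hp : p.Prime) : gl ν p ≤ 2 * k ^ 2 / p := by
  have h0 : (0:ℝ) < p := by exact_mod_cast hp.pos
  have h1 := h.inv_one_sub_le hp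
  have h2 := h.fl_le hp
  have h3 := (h.fl_pos hp).le
  have h4 : 0 < 1 - fl ν p := by linarith [h.fl_lt_one hp]
  calc gl ν p = fl ν p * (1 / (1 - fl ν p)) := by unfold gl; ring
    _ ≤ k / p * (2 * k) := by gcongr
    _ = _ := by ring

lemma NuOK.gl_eq (h : NuOK k y ν) {p : ℕ} (hp : p.Prime) :
    gl ν p = fl ν p + fl ν p ^ 2 / (1 - fl ν p) := by
  have hs : 1 - fl ν p ≠ 0 := by linarith [h.fl_lt_one hp]
  unfold gl; field_simp; ring

lemma NuOK.fsq_le (h : NuOK k y ν) {p : ℕ} (hp : p.Prime) :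
    fl ν p ^ 2 / (1 - fl ν p) ≤ 2 * k ^ 3 / p ^ 2 := by
  have h0 : (0:ℝ) < p := by exact_mod_cast hp.pos
  have h1 := h.inv_one_sub_le hp
  have h2 := h.fl_le hp
  have h3 := (h.fl_pos hp).le
  have h4 : 0 < 1 - fl ν p := by linarith [h.fl_lt_one hp]
  have h5 : fl ν p ^ 2 / (1 - fl ν p) = fl ν p ^ 2 * (1 / (1 - fl ν p)) := by ring
  rw [h5]
  calc fl ν p ^ 2 * (1 / (1 - fl ν p)) ≤ ((k:ℝ) / p) ^ 2 * (2 * k) := by gcongr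
    _ = 2 * (k:ℝ) ^ 3 / (p:ℝ) ^ 2 := by field_simp

lemma NuOK.cmf_pos (h : NuOK k y ν) (n : ℕ) : 0 < cmf ν n := by
  unfold cmf
  exact prod_pos fun p hp => pow_pos (h.fl_pos (Nat.prime_of_mem_primeFactors hp)) _

end

/-- sums of `log p / p^2` -/
lemma sum_log_sq : ∃ C : ℝ, 0 < C ∧ ∀ s : Finset ℕ, ∑ p ∈ s, Real.log p / (p:ℝ) ^ 2 ≤ C := by
  have hs : Summable (fun n : ℕ => 2 * (1 / (n : ℝ) ^ (3/2 : ℝ))) :=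
    (Real.summable_one_div_nat_rpow.2 (by norm_num)).mul_left 2
  have hle : ∀ n : ℕ, Real.log n / (n:ℝ) ^ 2 ≤ 2 * (1 / (n : ℝ) ^ (3/2 : ℝ)) := by
    intro n
    rcases Nat.eq_zero_or_pos n with h | h
    · subst h; simp
    have h0 : (0:ℝ) < n := by exact_mod_cast h
    have h1 := Real.log_le_rpow_div h0.le (show (0:ℝ) < 1/2 by norm_num)
    have h2 : (n:ℝ)^2 = (n:ℝ) ^ (1/2 : ℝ) * (n:ℝ) ^ (3/2 : ℝ) := by
      rw [← Real.rpow_add h0]; norm_num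
    rw [h2, div_le_iff₀ (by positivity)]
    have : 2 * (1 / (n:ℝ) ^ (3/2 : ℝ)) * ((n:ℝ) ^ (1/2 : ℝ) * (n:ℝ) ^ (3/2 : ℝ)) = 2 * (n:ℝ) ^ (1/2 : ℝ) := by
      field_simp
    rw [this]; linarith
  refine ⟨∑' n : ℕ, 2 * (1 / (n : ℝ) ^ (3/2 : ℝ)) + 1, ?_, fun s => ?_⟩
  · have : 0 ≤ ∑' n : ℕ, 2 * (1 / (n : ℝ) ^ (3/2 : ℝ)) := tsum_nonneg fun n => by positivity
    linarith
  · have := hs.sum_le_tsum s (fun n _ => by positivity)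
    linarith [sum_le_sum fun n (_ : n ∈ s) => hle n]

lemma sum_prime_log_div_le {τ : ℝ} (hτ : 0 ≤ τ) :
    ∑ p ∈ (Ioc 0 ⌊Real.exp τ⌋₊).filter Nat.Prime, Real.log p / p ≤ τ + 8 := by
  have h1 := (abs_le.1 (mertens_exp τ hτ)).2
  have h2 : ∑ p ∈ (Ioc 0 ⌊Real.exp τ⌋₊).filter Nat.Prime, Real.log p / p
      ≤ ∑ n ∈ Ioc 0 ⌊Real.exp τ⌋₊, ArithmeticFunction.vonMangoldt n / n := by
    rw [sum_filter]
    refine sum_le_sum fun n _ => ?_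
    split_ifs with h
    · rw [ArithmeticFunction.vonMangoldt_apply_prime h]
    · have : 0 ≤ ArithmeticFunction.vonMangoldt n := ArithmeticFunction.vonMangoldt_nonneg
      positivity
  linarith

lemma sum_vonMangoldt_le (w : ℕ → ℝ) (hw : ∀ n, 0 ≤ w n) (X : ℕ) :
    ∑ n ∈ Ioc 0 X, ArithmeticFunction.vonMangoldt n * w n ≤
      ∑ p ∈ (Ioc 0 X).filter Nat.Prime, Real.log p * ∑ i ∈ Icc 1 X, w (p ^ i) := by
  rcases Nat.eq_zero_or_pos X with h0 | hX
  · subst h0; simp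
  have hX0 : (1:ℝ) ≤ X := by exact_mod_cast hX
  have hN : ⌊Real.log X / Real.log 2⌋₊ ≤ X := by
    apply Nat.floor_le_of_le
    rw [div_le_iff₀ (Real.log_pos (by norm_num)), ← Real.log_pow]
    apply Real.log_le_log (by linarith)
    exact_mod_cast Nat.lt_two_pow_self.le
  have h1 := Chebyshev.sum_PrimePow_eq_sum_sum' (fun n => Real.log n.minFac * w n) (x := X) (by linarith) hN
  rw [Nat.floor_natCast, sum_filter] at h1
  have h2 : ∑ n ∈ Ioc 0 X, ArithmeticFunction.vonMangoldt n * w n = ∑ n ∈ Ioc 0 X, if IsPrimePow n then Real.log n.minFac * w n else 0 := by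
    refine sum_congr rfl fun n _ => ?_
    rw [ArithmeticFunction.vonMangoldt_apply]
    split_ifs <;> simp
  rw [h2, h1]
  simp_rw [mul_sum]
  rw [sum_comm]
  refine (sum_le_sum (g := fun i => ∑ p ∈ (Ioc 0 X).filter Nat.Prime, Real.log p * w (p ^ i)) fun i hi => ?_).trans (le_of_eq sum_comm.symm) |>.trans (le_of_eq sum_comm)
  have hi1 := (mem_Icc.1 hi).1
  have h3 : ∀ p ∈ (Ioc 0 ⌊(X:ℝ) ^ ((1:ℝ)/i)⌋₊).filter Nat.Prime, Real.log ((p^i).minFac) * w (p^i) = Real.log p * w (p ^ i) := by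
    intro p hp
    rw [Nat.Prime.pow_minFac (mem_filter.1 hp).2 (by omega)]
  rw [sum_congr rfl h3]
  apply sum_le_sum_of_subset_of_nonneg
  · apply filter_subset_filter
    apply Ioc_subset_Ioc le_rfl
    apply Nat.floor_le_of_le
    calc (X:ℝ) ^ ((1:ℝ)/i) ≤ (X:ℝ) ^ (1:ℝ) := by
          apply Real.rpow_le_rpow_of_exponent_le hX0
          rw [div_le_one (by positivity)]; exact_mod_cast hi1
      _ = X := Real.rpow_one _
  · intro p _ _
    have := hw (p ^ i)
    have := Real.log_natCast_nonneg p
    positivity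

lemma geom_tail {x : ℝ} (h0 : 0 ≤ x) (h1 : x < 1) (X : ℕ) :
    ∑ i ∈ Ioc 1 X, x ^ i ≤ x ^ 2 / (1 - x) := by
  have hs := summable_geometric_of_lt_one h0 h1
  have h2 : ∑ i ∈ Ioc 1 X, x ^ i = x ^ 2 * ∑ i ∈ Ioc 1 X, x ^ (i - 2) := by
    rw [mul_sum]
    refine sum_congr rfl fun i hi => ?_
    rw [mem_Ioc] at hi
    rw [← pow_add]; congr 1; omega
  have h3 : ∑ i ∈ Ioc 1 X, x ^ (i - 2) ≤ (1 - x)⁻¹ := by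
    rw [← tsum_geometric_of_lt_one h0 h1]
    have h4 : ∑ i ∈ Ioc 1 X, x ^ (i - 2) = ∑ i ∈ (Ioc 1 X).image (· - 2), x ^ i := by
      rw [sum_image]
      intro a ha b hb hab
      simp only [coe_Ioc, Set.mem_Ioc] at ha hb
      simp only at hab
      omega
    rw [h4]
    exact hs.sum_le_tsum _ (fun i _ => by positivity)
  rw [h2, div_eq_mul_inv]
  gcongr

lemma psi_f_bound (k : ℕ) : ∃ C : ℝ, 0 < C ∧ ∀ (y : ℝ) (ν : ℕ → ℕ), 1 ≤ y → NuOK k y ν →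
    ∀ τ, 0 ≤ τ → |SS (fun n => ArithmeticFunction.vonMangoldt n * cmf ν n) 0 τ - k * τ| ≤ C + k * Real.log y := by
  obtain ⟨C, hC, hsum⟩ := sum_log_sq
  refine ⟨16 * k + (2 * k ^ 3 + 2 * k) * C + 1, by positivity, fun y ν hy hν τ hτ => ?_⟩
  set X := ⌊Real.exp τ⌋₊ with hX
  have h1 : SS (fun n => ArithmeticFunction.vonMangoldt n * cmf ν n) 0 τ = ∑ n ∈ Ioc 0 X, ArithmeticFunction.vonMangoldt n * cmf ν n := by
    simp [SS, ← hX]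
  have h2 : |SS (fun n => ArithmeticFunction.vonMangoldt n * cmf ν n) 0 τ - k * ∑ n ∈ Ioc 0 X, ArithmeticFunction.vonMangoldt n / n|
      ≤ ∑ n ∈ Ioc 0 X, ArithmeticFunction.vonMangoldt n * |cmf ν n - k / n| := by
    rw [h1, mul_sum, ← sum_sub_distrib]
    refine (abs_sum_le_sum_abs _ _).trans (sum_le_sum fun n _ => ?_)
    have h0 : 0 ≤ ArithmeticFunction.vonMangoldt n := ArithmeticFunction.vonMangoldt_nonneg
    rw [show ArithmeticFunction.vonMangoldt n * cmf ν n - k * (ArithmeticFunction.vonMangoldt n / n) = ArithmeticFunction.vonMangoldt n * (cmf ν n - k / n) by ring, abs_mul, abs_of_nonneg h0]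
  have h3 := sum_vonMangoldt_le (fun n => |cmf ν n - k / n|) (fun n => abs_nonneg _) X
  have h4 : ∀ p ∈ (Ioc 0 X).filter Nat.Prime, Real.log p * ∑ i ∈ Icc 1 X, |cmf ν (p ^ i) - k / (p ^ i : ℕ)|
      ≤ (if (p:ℝ) ≤ y then k * (Real.log p / p) else 0) + (2 * k ^ 3 + 2 * k) * (Real.log p / (p:ℝ)^2) := by
    intro p hp
    rw [mem_filter, mem_Ioc] at hp
    have hpp := hp.2
    have hp0 : (0:ℝ) < p := by exact_mod_cast hpp.pos
    have hp2 : (2:ℝ) ≤ p := by exact_mod_cast hpp.two_le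
    have hlog := Real.log_natCast_nonneg p
    have hf0 := hν.fl_pos hpp
    have hf1 := hν.fl_lt_one hpp
    have hX1 : 1 ≤ X := by omega
    rw [← add_sum_Ioc_eq_sum_Icc hX1]
    have e1 : |cmf ν (p ^ 1) - k / (p ^ 1 : ℕ)| ≤ if (p:ℝ) ≤ y then (k / p : ℝ) else 0 := by
      rw [pow_one, cmf_prime ν hpp]
      split_ifs with hpy
      · rw [abs_le]; constructor
        · linarith
        · have := hν.fl_le hpp
          have : (0:ℝ) ≤ k / p := by positivity
          linarith
      · rw [fl, hν.eq_k p hpp (by linarith)]; simp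
    have e2 : ∑ i ∈ Ioc 1 X, |cmf ν (p ^ i) - k / (p ^ i : ℕ)| ≤ (2 * k ^ 3 + 2 * k) / (p:ℝ)^2 := by
      calc ∑ i ∈ Ioc 1 X, |cmf ν (p ^ i) - k / (p ^ i : ℕ)|
          ≤ ∑ i ∈ Ioc 1 X, (fl ν p ^ i + k * (1/(p:ℝ)) ^ i) := by
            refine sum_le_sum fun i _ => ?_
            rw [cmf_prime_pow ν hpp]
            push_cast
            have a1 : (k / (p:ℝ)^i) = k * (1/(p:ℝ)) ^ i := by rw [one_div, inv_pow]; rfl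
            rw [a1, abs_le]
            have a2 : 0 ≤ fl ν p ^ i := by positivity
            have a3 : 0 ≤ k * (1/(p:ℝ)) ^ i := by positivity
            constructor <;> linarith
        _ ≤ fl ν p ^ 2 / (1 - fl ν p) + k * ((1/(p:ℝ)) ^ 2 / (1 - 1/(p:ℝ))) := by
            rw [sum_add_distrib, ← mul_sum]
            have hp1 : 1/(p:ℝ) < 1 := by rw [div_lt_one hp0]; linarith
            have := geom_tail hf0.le hf1 X
            have := geom_tail (x := 1/(p:ℝ)) (by positivity) hp1 X
            gcongr
        _ ≤ 2 * k ^ 3 / p ^ 2 + k * (2 / (p:ℝ)^2) := by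
            have a1 := hν.fsq_le hpp
            have a2 : (1/(p:ℝ)) ^ 2 / (1 - 1/(p:ℝ)) ≤ 2 / (p:ℝ)^2 := by
              have : 1/(p:ℝ) ≤ 1/2 := by gcongr
              rw [div_le_iff₀ (by linarith)]
              have : 0 < 1/(p:ℝ)^2 := by positivity
              calc (1/(p:ℝ))^2 = 2 / (p:ℝ)^2 * (1/2) := by ring
                _ ≤ _ := by gcongr; linarith
            gcongr
        _ = _ := by ring
    calc _ ≤ Real.log p * ((if (p:ℝ) ≤ y then (k / p : ℝ) else 0) + (2 * k ^ 3 + 2 * k) / (p:ℝ)^2) := by gcongr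
      _ = _ := by split_ifs <;> ring
  have h5 := sum_le_sum h4
  rw [sum_add_distrib, ← mul_sum] at h5
  have h6 : ∑ p ∈ (Ioc 0 X).filter Nat.Prime, (if (p:ℝ) ≤ y then k * (Real.log p / p) else 0)
      ≤ k * (Real.log y + 8) := by
    have hy0 : 0 < y := by linarith
    have := sum_prime_log_div_le (Real.log_nonneg hy)
    rw [Real.exp_log hy0] at this
    calc _ = ∑ p ∈ ((Ioc 0 X).filter Nat.Prime).filter (fun p : ℕ => (p:ℝ) ≤ y), k * (Real.log p / p) := by
            rw [sum_filter (fun p : ℕ => (p:ℝ) ≤ y)]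
      _ ≤ ∑ p ∈ (Ioc 0 ⌊y⌋₊).filter Nat.Prime, k * (Real.log p / p) := by
          apply sum_le_sum_of_subset_of_nonneg
          · intro p hp
            simp only [mem_filter, mem_Ioc] at hp ⊢
            exact ⟨⟨hp.1.1.1, Nat.le_floor hp.2⟩, hp.1.2⟩
          · intro p _ _
            have := Real.log_natCast_nonneg p
            positivity
      _ ≤ _ := by rw [← mul_sum]; gcongr
  have h7 := hsum ((Ioc 0 X).filter Nat.Prime)
  have h8 := mertens_exp τ hτ
  rw [← hX] at h8
  have h9 : |k * ∑ n ∈ Ioc 0 X, ArithmeticFunction.vonMangoldt n / n - k * τ| ≤ k * 8 := by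
    rw [← mul_sub, abs_mul, abs_of_nonneg (by positivity : (0:ℝ) ≤ k)]
    gcongr
  have h10 := abs_sub_le (SS (fun n => ArithmeticFunction.vonMangoldt n * cmf ν n) 0 τ) (k * ∑ n ∈ Ioc 0 X, ArithmeticFunction.vonMangoldt n / n) (k * τ)
  have h11 : (2 * (k:ℝ) ^ 3 + 2 * k) * ∑ p ∈ (Ioc 0 X).filter Nat.Prime, Real.log p / (p:ℝ)^2 ≤ (2 * k ^ 3 + 2 * k) * C := by
    gcongr
  linarith

lemma sum_g_bound (k : ℕ) : ∃ C : ℝ, 0 < C ∧ ∀ (y : ℝ) (ν : ℕ → ℕ), NuOK k y ν →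
    ∀ τ, 0 ≤ τ → SS (fun n => if n.Prime then gl ν n * Real.log n else 0) 0 τ ≤ k * τ + C := by
  obtain ⟨C, hC, hsum⟩ := sum_log_sq
  refine ⟨8 * k + 2 * k ^ 3 * C + 1, by positivity, fun y ν hν τ hτ => ?_⟩
  have h1 := sum_prime_log_div_le hτ
  have h2 := hsum ((Ioc 0 ⌊Real.exp τ⌋₊).filter Nat.Prime)
  have h3 : SS (fun n => if n.Prime then gl ν n * Real.log n else 0) 0 τ
      = ∑ p ∈ (Ioc 0 ⌊Real.exp τ⌋₊).filter Nat.Prime, gl ν p * Real.log p := by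
    rw [sum_filter]; simp [SS]
  rw [h3]
  calc ∑ p ∈ (Ioc 0 ⌊Real.exp τ⌋₊).filter Nat.Prime, gl ν p * Real.log p
      ≤ ∑ p ∈ (Ioc 0 ⌊Real.exp τ⌋₊).filter Nat.Prime, (k * (Real.log p / p) + 2 * k ^ 3 * (Real.log p / (p:ℝ)^2)) := by
        refine sum_le_sum fun p hp => ?_
        have hpp := (mem_filter.1 hp).2
        rw [hν.gl_eq hpp]
        have := hν.fl_le hpp
        have := hν.fsq_le hpp
        have := Real.log_natCast_nonneg p
        calc _ ≤ (k / p + 2 * k ^ 3 / p ^ 2) * Real.log p := by gcongr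
          _ = _ := by ring
    _ ≤ k * (τ + 8) + 2 * k ^ 3 * C := by
        rw [sum_add_distrib, ← mul_sum, ← mul_sum]
        gcongr
    _ ≤ _ := by linarith

lemma sum_g_dvd_bound {k : ℕ} {y : ℝ} {ν : ℕ → ℕ} (hν : NuOK k y ν) {t : ℕ} (ht : t ≠ 0) {Y : ℝ} (hY : 1 ≤ Y) :
    ∑ p ∈ t.primeFactors, gl ν p * Real.log p ≤ 2 * k ^ 2 * (Real.log Y + 8 + Real.log t / Y) := by
  have hY0 : 0 < Y := by linarith
  have h1 : ∑ p ∈ t.primeFactors, Real.log p ≤ Real.log t := by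
    have := Real.log_le_log (by exact_mod_cast Finset.prod_pos fun p hp => (Nat.prime_of_mem_primeFactors hp).pos)
      (by exact_mod_cast Nat.le_of_dvd (Nat.pos_of_ne_zero ht) (Nat.prod_primeFactors_dvd t) :
      ((∏ p ∈ t.primeFactors, p : ℕ) : ℝ) ≤ t)
    push_cast at this
    rwa [Real.log_prod] at this
    intro p hp; exact_mod_cast (Nat.prime_of_mem_primeFactors hp).ne_zero
  have h2 := sum_prime_log_div_le (Real.log_nonneg hY)
  rw [Real.exp_log hY0] at h2
  have h3 : ∑ p ∈ t.primeFactors, Real.log p / p ≤ Real.log Y + 8 + Real.log t / Y := by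
    rw [← sum_filter_add_sum_filter_not t.primeFactors (fun p : ℕ => (p:ℝ) ≤ Y)]
    apply add_le_add
    · refine le_trans ?_ h2
      apply sum_le_sum_of_subset_of_nonneg
      · intro p hp
        simp only [mem_filter, mem_Ioc] at hp ⊢
        have := Nat.prime_of_mem_primeFactors hp.1
        exact ⟨⟨this.pos, Nat.le_floor hp.2⟩, this⟩
      · intro p _ _
        have := Real.log_natCast_nonneg p
        positivity
    · calc ∑ p ∈ t.primeFactors.filter (fun p : ℕ => ¬ (p:ℝ) ≤ Y), Real.log p / p
          ≤ ∑ p ∈ t.primeFactors.filter (fun p : ℕ => ¬ (p:ℝ) ≤ Y), Real.log p / Y := by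
            refine sum_le_sum fun p hp => ?_
            have := Real.log_natCast_nonneg p
            have := (mem_filter.1 hp).2
            gcongr; linarith
        _ ≤ ∑ p ∈ t.primeFactors, Real.log p / Y := by
            apply sum_le_sum_of_subset_of_nonneg (filter_subset _ _)
            intro p _ _
            have := Real.log_natCast_nonneg p
            positivity
        _ ≤ _ := by rw [← sum_div]; gcongr
  calc ∑ p ∈ t.primeFactors, gl ν p * Real.log p ≤ ∑ p ∈ t.primeFactors, 2 * k ^ 2 * (Real.log p / p) := by
        refine sum_le_sum fun p hp => ?_
        have hpp := Nat.prime_of_mem_primeFactors hp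
        have := Real.log_natCast_nonneg p
        have := hν.gl_le hpp
        calc _ ≤ 2 * k ^ 2 / p * Real.log p := by gcongr
          _ = _ := by ring
    _ ≤ _ := by rw [← mul_sum]; gcongr

end PartF1

section PartP1

open Finset Filter Topology MeasureTheory
open scoped FourierTransform

/-- the vertical line point -/
noncomputable def spt (σ ξ : ℝ) : ℂ := σ + 2 * Real.pi * ξ * Complex.I

lemma spt_re (σ ξ : ℝ) : (spt σ ξ).re = σ := by simp [spt]
lemma spt_im (σ ξ : ℝ) : (spt σ ξ).im = 2 * Real.pi * ξ := by simp [spt]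
lemma spt_ne {σ : ℝ} (h : 0 < σ) (ξ : ℝ) : spt σ ξ ≠ 0 := by
  intro h0; have := congrArg Complex.re h0; rw [spt_re] at this; simp at this; linarith

lemma spt_continuous (σ : ℝ) : Continuous (spt σ) := by unfold spt; fun_prop

lemma spt_normSq (σ ξ : ℝ) : ‖spt σ ξ‖ ^ 2 = σ ^ 2 + (2 * Real.pi * ξ) ^ 2 := by
  rw [← Complex.normSq_eq_norm_sq, Complex.normSq_apply, spt_re, spt_im]; ring

lemma inv_sq_integrable {σ : ℝ} (hσ : 0 < σ) :
    Integrable (fun ξ : ℝ => 1 / (σ ^ 2 + ξ ^ 2)) ∧ ∫ ξ : ℝ, 1 / (σ ^ 2 + ξ ^ 2) = Real.pi / σ := by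
  have h1 : (fun ξ : ℝ => 1 / (σ ^ 2 + ξ ^ 2)) = fun ξ => σ⁻¹ ^ 2 * (1 + (ξ / σ) ^ 2)⁻¹ := by
    ext ξ
    have : 0 < σ ^ 2 + ξ ^ 2 := by positivity
    field_simp
  rw [h1]
  constructor
  · apply Integrable.const_mul
    exact (integrable_inv_one_add_sq).comp_div hσ.ne'
  · rw [integral_const_mul, Measure.integral_comp_div (fun x : ℝ => (1 + x ^ 2)⁻¹) σ, integral_univ_inv_one_add_sq,
      abs_of_pos hσ, smul_eq_mul]
    field_simp

lemma spt_sq_ge (σ ξ : ℝ) : σ ^ 2 + ξ ^ 2 ≤ ‖spt σ ξ‖ ^ 2 := by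
  rw [spt_normSq]
  have : 1 ≤ 2 * Real.pi := by linarith [Real.pi_gt_three]
  have h : (ξ)^2 * 1 ≤ ξ^2 * (2 * Real.pi)^2 := by
    gcongr; nlinarith
  nlinarith

lemma spt_inv_integrable {σ : ℝ} (hσ : 0 < σ) {k : ℕ} (hk : 2 ≤ k) :
    Integrable (fun ξ : ℝ => 1 / ‖spt σ ξ‖ ^ k) := by
  have h0 := (inv_sq_integrable hσ).1.const_mul (1 / σ ^ (k - 2))
  have hpos : ∀ ξ, 0 < ‖spt σ ξ‖ := fun ξ => norm_pos_iff.2 (spt_ne hσ ξ)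
  refine h0.mono' ?_ ?_
  · apply Continuous.aestronglyMeasurable
    have := spt_continuous σ
    exact continuous_const.div (by fun_prop) (fun ξ => (pow_pos (hpos ξ) k).ne')
  · refine Eventually.of_forall fun ξ => ?_
    rw [Real.norm_of_nonneg (by have := hpos ξ; positivity)]
    have h1 : σ ≤ ‖spt σ ξ‖ := by
      have := Complex.re_le_norm (spt σ ξ); rwa [spt_re] at this
    have h2 := spt_sq_ge σ ξ
    calc 1 / ‖spt σ ξ‖ ^ k = 1 / ‖spt σ ξ‖ ^ (k - 2) * (1 / ‖spt σ ξ‖ ^ 2) := by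
          rw [one_div_mul_one_div, ← pow_add]
          congr 2; omega
      _ ≤ _ := by
          have := hpos ξ
          gcongr

lemma pow_exp_integrable {σ : ℝ} (hσ : 0 < σ) (k : ℕ) :
    IntegrableOn (fun v : ℝ => v ^ k / k.factorial * Real.exp (-σ * v)) (Set.Ioi 0) := by
  apply integrable_of_isBigO_exp_neg (b := σ/2) (by linarith)
  · fun_prop
  · have h1 := (isLittleO_pow_exp_pos_mul_atTop k (b := σ/2) (by linarith)).isBigO
    have h2 : (fun x : ℝ => x ^ k / k.factorial * Real.exp (-σ * x)) = fun x => (1 / k.factorial : ℝ) * (x ^ k * Real.exp (-σ * x)) := by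
      ext x; ring
    rw [h2]
    apply Asymptotics.IsBigO.const_mul_left
    have h3 := h1.mul (Asymptotics.isBigO_refl (fun x : ℝ => Real.exp (-σ * x)) atTop)
    refine h3.congr_right fun x => ?_
    rw [← Real.exp_add]; congr 1; ring

lemma norm_powexp (s : ℂ) (k : ℕ) {v : ℝ} (hv : 0 ≤ v) :
    ‖(v : ℂ) ^ k / k.factorial * Complex.exp (-s * v)‖ = v ^ k / k.factorial * Real.exp (-s.re * v) := by
  rw [norm_mul, norm_div, norm_pow, Complex.norm_exp, Complex.norm_real, Real.norm_of_nonneg hv]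
  simp

lemma powexp_integrable {s : ℂ} (hs : 0 < s.re) (k : ℕ) :
    IntegrableOn (fun v : ℝ => (v : ℂ) ^ k / k.factorial * Complex.exp (-s * v)) (Set.Ioi 0) := by
  refine Integrable.mono' (pow_exp_integrable hs k) ?_ ?_
  · apply Continuous.aestronglyMeasurable; fun_prop
  · refine (ae_restrict_iff' measurableSet_Ioi).2 (Eventually.of_forall fun v hv => ?_)
    rw [norm_powexp s k (le_of_lt hv)]

lemma powexp_integral {s : ℂ} (hs : 0 < s.re) (k : ℕ) :
    ∫ v : ℝ in Set.Ioi 0, (v : ℂ) ^ k / k.factorial * Complex.exp (-s * v) = 1 / s ^ (k + 1) := by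
  have hs0 : s ≠ 0 := by rintro rfl; simp at hs
  induction k with
  | zero =>
    have := integral_exp_mul_complex_Ioi (a := -s) (by simpa using hs) 0
    simp only [pow_zero, Nat.factorial_zero, Nat.cast_one, div_one, one_mul, this]
    simp
  | succ k ih =>
    have hder : ∀ v ∈ Set.Ici (0:ℝ), HasDerivAt (fun v : ℝ => (v : ℂ) ^ (k+1) / (k+1).factorial * Complex.exp (-s * v))
        ((v : ℂ) ^ k / k.factorial * Complex.exp (-s * v) - s * ((v : ℂ) ^ (k+1) / (k+1).factorial * Complex.exp (-s * v))) v := by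
      intro v _
      have h1 : HasDerivAt (fun z : ℂ => z ^ (k+1) / (k+1).factorial * Complex.exp (-s * z))
          ((v : ℂ) ^ k / k.factorial * Complex.exp (-s * v) - s * ((v : ℂ) ^ (k+1) / (k+1).factorial * Complex.exp (-s * v))) (v:ℂ) := by
        have ha := (hasDerivAt_pow (k+1) (v:ℂ)).div_const ((k+1).factorial : ℂ)
        have hb := ((hasDerivAt_id (v:ℂ)).const_mul (-s)).cexp
        have hc := ha.mul hb
        refine hc.congr_deriv ?_
        have e2 : ((k+1).factorial : ℂ) = (k+1) * k.factorial := by rw [Nat.factorial_succ]; push_cast; ring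
        have e1 : (k.factorial : ℂ) ≠ 0 := by exact_mod_cast k.factorial_ne_zero
        have e3 : (k + 1 : ℂ) ≠ 0 := by exact_mod_cast k.succ_ne_zero
        simp only [id, e2]
        push_cast
        field_simp
        ring
      exact h1.comp_ofReal
    have hinteg := (powexp_integrable hs k).sub ((powexp_integrable hs (k+1)).const_mul s)
    have htend : Tendsto (fun v : ℝ => (v : ℂ) ^ (k+1) / (k+1).factorial * Complex.exp (-s * v)) atTop (𝓝 0) := by
      rw [tendsto_zero_iff_norm_tendsto_zero]
      have h1 := (isLittleO_pow_exp_pos_mul_atTop (k+1) (b := s.re) hs).tendsto_div_nhds_zero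
      have h2 := h1.div_const ((k+1).factorial : ℝ)
      rw [zero_div] at h2
      refine h2.congr' ?_
      filter_upwards [eventually_ge_atTop 0] with v hv
      rw [norm_powexp s _ hv, neg_mul, Real.exp_neg]
      field_simp
    have := integral_Ioi_of_hasDerivAt_of_tendsto' hder hinteg htend
    rw [integral_sub (powexp_integrable hs k) ((powexp_integrable hs (k+1)).const_mul s), integral_const_mul, ih] at this
    simp at this
    have h3 : s * ∫ v : ℝ in Set.Ioi 0, (v : ℂ) ^ (k+1) / (k+1).factorial * Complex.exp (-s * v) = (s ^ (k+1))⁻¹ := by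
      simp only [neg_mul]
      linear_combination -this
    rw [eq_div_iff (pow_ne_zero _ hs0), pow_succ, mul_comm (s ^ (k+1)) s, ← mul_assoc, mul_comm _ s, h3]
    exact inv_mul_cancel₀ (pow_ne_zero _ hs0)

lemma perron {σ : ℝ} (hσ : 0 < σ) {k : ℕ} (hk : 1 ≤ k) (v : ℝ) :
    (Fp k v : ℂ) = ∫ ξ : ℝ, Complex.exp (spt σ ξ * v) / (spt σ ξ) ^ (k+1) := by
  set g : ℝ → ℂ := fun v => (Fp k v * Real.exp (-σ * v) : ℝ) with hg
  have hgc : Continuous g := by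
    have := Fp_continuous hk
    rw [hg]; fun_prop
  have hind : g = Set.indicator (Set.Ioi 0) (fun v => (v ^ k / k.factorial * Real.exp (-σ * v) : ℝ) : ℝ → ℂ) := by
    ext v
    rw [Set.indicator_apply]
    simp only [Set.mem_Ioi, hg, Fp]
    rcases lt_trichotomy v 0 with h | h | h
    · rw [if_neg (by linarith), if_neg (by linarith)]; simp
    · subst h; simp; omega
    · rw [if_pos h.le, if_pos h]
  have hgi : Integrable g := by
    rw [hind, integrable_indicator_iff measurableSet_Ioi]
    exact (pow_exp_integrable hσ k).ofReal
  have hF : 𝓕 g = fun ξ => 1 / (spt σ ξ) ^ (k+1) := by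
    ext ξ
    rw [Real.fourier_real_eq_integral_exp_smul, hind]
    have h1 : (fun v : ℝ => Complex.exp ((↑(-2 * Real.pi * v * ξ) : ℂ) * Complex.I) •
        Set.indicator (Set.Ioi 0) (fun v => (v ^ k / k.factorial * Real.exp (-σ * v) : ℝ) : ℝ → ℂ) v)
        = Set.indicator (Set.Ioi 0) (fun v : ℝ => (v : ℂ) ^ k / k.factorial * Complex.exp (-spt σ ξ * v)) := by
      ext v
      rw [Set.indicator_apply, Set.indicator_apply]
      split_ifs with h
      · have : Complex.exp (-spt σ ξ * v) = Complex.exp ((↑(-2 * Real.pi * v * ξ) : ℂ) * Complex.I) * Complex.exp (-σ * v) := by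
          rw [← Complex.exp_add]; congr 1; unfold spt; push_cast; ring
        rw [this]; push_cast; rw [smul_eq_mul]; ring
      · simp
    rw [h1, integral_indicator measurableSet_Ioi, powexp_integral (by rw [spt_re]; exact hσ)]
  have hFi : Integrable (𝓕 g) := by
    rw [hF]
    have := spt_inv_integrable hσ (k := k+1) (by omega)
    refine this.mono' ?_ ?_
    · apply Continuous.aestronglyMeasurable
      have := spt_continuous σ
      exact continuous_const.div (by fun_prop) (fun ξ => pow_ne_zero _ (spt_ne hσ ξ))
    · exact Eventually.of_forall fun ξ => by simp
  have hinv := congrFun (hgc.fourierInv_fourier_eq hgi hFi) v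
  rw [Real.fourierInv_eq', hF] at hinv
  have h2 : (Fp k v : ℂ) = Complex.exp (σ * v) * g v := by
    rw [hg]; push_cast
    rw [mul_left_comm, ← Complex.exp_add]
    simp
  rw [h2, ← hinv, ← integral_const_mul]
  congr 1
  ext ξ
  rw [smul_eq_mul, ← mul_assoc, ← Complex.exp_add, mul_one_div]
  congr 2
  unfold spt
  simp
  ring

end PartP1

section PartP2

open Finset Filter Topology MeasureTheory

/-- `μ(n) f(n)` -/
noncomputable def muf (ν : ℕ → ℕ) (n : ℕ) : ℝ := (ArithmeticFunction.moebius n : ℝ) * cmf ν n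

lemma pow_one_sub_bound {z : ℂ} (hz : ‖z‖ ≤ 1) (k : ℕ) :
    ‖(1 - z) ^ k - 1 + k * z‖ ≤ 4 ^ k * ‖z‖ ^ 2 := by
  induction k with
  | zero => simp
  | succ k ih =>
    have h1 : (1 - z) ^ (k+1) - 1 + (k+1 : ℕ) * z = (1 - z) * ((1 - z) ^ k - 1 + k * z) + k * z ^ 2 := by
      push_cast; ring
    rw [h1]
    have h2 : ‖1 - z‖ ≤ 2 := (norm_sub_le _ _).trans (by simp; linarith)
    have h3 : (k:ℝ) ≤ 2 * 4 ^ k := by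
      have h4 : (k : ℝ) < 2 ^ k := by exact_mod_cast k.lt_two_pow_self
      have h5 : (2:ℝ) ^ k ≤ 4 ^ k := by gcongr; norm_num
      have : (0:ℝ) < 4 ^ k := by positivity
      linarith
    calc _ ≤ ‖1 - z‖ * ‖(1 - z) ^ k - 1 + k * z‖ + k * ‖z‖ ^ 2 := by
          refine (norm_add_le _ _).trans ?_
          rw [norm_mul, norm_mul, norm_pow]; simp
      _ ≤ 2 * (4 ^ k * ‖z‖ ^ 2) + 2 * 4 ^ k * ‖z‖ ^ 2 := by gcongr
      _ = _ := by ring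

lemma one_sub_nu_bound {z : ℂ} {p : ℝ} (hp : 2 ≤ p) (hz : ‖z‖ ≤ 1 / p) {k n : ℕ} (hn : n ≤ k) :
    ‖1 - n * z‖ ≤ ‖1 - z‖ ^ k * (1 + (2 ^ k * (k - n) / p + 8 ^ k / p ^ 2)) := by
  have hp0 : 0 < p := by linarith
  have hz1 : ‖z‖ ≤ 1 / 2 := hz.trans (by gcongr)
  have h1 : 1 / 2 ≤ ‖1 - z‖ := by
    have := norm_sub_norm_le (1:ℂ) z
    simp at this; linarith
  have h2 : 1 ≤ ‖1 - z‖ ^ k * 2 ^ k := by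
    rw [← mul_pow]; exact one_le_pow₀ (by linarith)
  have hkn : (0:ℝ) ≤ k - n := by rw [sub_nonneg]; exact_mod_cast hn
  have h3 := pow_one_sub_bound (hz1.trans (by norm_num)) k
  have h4 : 1 - n * z = (1 - z) ^ k - ((1 - z) ^ k - 1 + k * z) + ((k - n : ℝ) : ℂ) * z := by
    push_cast; ring
  have h5 : ‖1 - n * z‖ ≤ ‖1 - z‖ ^ k + 4 ^ k * ‖z‖ ^ 2 + (k - n) * ‖z‖ := by
    rw [h4]
    refine (norm_add_le _ _).trans ?_
    rw [norm_mul, Complex.norm_real, Real.norm_of_nonneg hkn]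
    gcongr
    refine (norm_sub_le _ _).trans ?_
    rw [norm_pow]; gcongr
  have h6 : 4 ^ k * ‖z‖ ^ 2 ≤ ‖1 - z‖ ^ k * (8 ^ k / p ^ 2) := by
    calc 4 ^ k * ‖z‖ ^ 2 ≤ 4 ^ k * (1 / p) ^ 2 * 1 := by rw [mul_one]; gcongr
      _ ≤ 4 ^ k * (1 / p) ^ 2 * (‖1 - z‖ ^ k * 2 ^ k) := by gcongr
      _ = _ := by rw [show (8:ℝ) = 4 * 2 by norm_num, mul_pow]; ring
  have h7 : (k - n) * ‖z‖ ≤ ‖1 - z‖ ^ k * (2 ^ k * (k - n) / p) := by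
    calc (k - n) * ‖z‖ ≤ (k - n) * (1 / p) * 1 := by rw [mul_one]; gcongr
      _ ≤ (k - n) * (1 / p) * (‖1 - z‖ ^ k * 2 ^ k) := by
          apply mul_le_mul_of_nonneg_left h2; positivity
      _ = _ := by ring
  linarith

lemma sum_inv_prime_le (ε : ℝ) (hε : 0 < ε) : ∃ C : ℝ, 0 < C ∧ ∀ y : ℝ, 1 ≤ y →
    ∑ p ∈ (Ioc 0 ⌊y⌋₊).filter Nat.Prime, 1 / (p:ℝ) ≤ ε * Real.log y + C := by
  refine ⟨ε * 8 + (⌈Real.exp (1/ε)⌉₊ + 1), by positivity, fun y hy => ?_⟩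
  have h1 := sum_prime_log_div_le (Real.log_nonneg hy)
  rw [Real.exp_log (by linarith)] at h1
  have h2 : ∀ p ∈ (Ioc 0 ⌊y⌋₊).filter Nat.Prime, 1 / (p:ℝ) ≤ ε * (Real.log p / p) + if p ∈ range (⌈Real.exp (1/ε)⌉₊ + 1) then 1 else 0 := by
    intro p hp
    have hpp := (mem_filter.1 hp).2
    have hp0 : (0:ℝ) < p := by exact_mod_cast hpp.pos
    have hp1 : (1:ℝ) ≤ p := by exact_mod_cast hpp.one_le
    have hl := Real.log_nonneg hp1
    split_ifs with h
    · have : 1 / (p:ℝ) ≤ 1 := by rw [div_le_one hp0]; exact hp1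
      have : 0 ≤ ε * (Real.log p / p) := by positivity
      linarith
    · simp only [mem_range, not_lt] at h
      have h3 : Real.exp (1/ε) ≤ p := (Nat.le_ceil _).trans (by exact_mod_cast (by omega : ⌈Real.exp (1/ε)⌉₊ ≤ p))
      have h4 : 1/ε ≤ Real.log p := (Real.le_log_iff_exp_le hp0).2 h3
      rw [add_zero, ← mul_div_assoc]
      gcongr
      rw [div_le_iff₀ hε] at h4; linarith
  calc _ ≤ _ := sum_le_sum h2
    _ ≤ ε * (Real.log y + 8) + (⌈Real.exp (1/ε)⌉₊ + 1) := by
        rw [sum_add_distrib, ← mul_sum]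
        gcongr
        rw [sum_ite_mem]
        simp only [sum_const, nsmul_eq_mul, mul_one]
        have := card_le_card (inter_subset_right (s₁ := (Ioc 0 ⌊y⌋₊).filter Nat.Prime) (s₂ := range (⌈Real.exp (1/ε)⌉₊ + 1)))
        rw [card_range] at this
        exact_mod_cast this
    _ = _ := by ring

lemma sum_inv_sq_le : ∃ C : ℝ, 0 < C ∧ ∀ s : Finset ℕ, ∑ p ∈ s, 1 / (p:ℝ) ^ 2 ≤ C := by
  have hs : Summable (fun n : ℕ => 1 / (n : ℝ) ^ 2) := Real.summable_one_div_nat_pow.2 (by norm_num)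
  refine ⟨∑' n : ℕ, 1 / (n : ℝ) ^ 2 + 1, ?_, fun s => ?_⟩
  · have : 0 ≤ ∑' n : ℕ, 1 / (n : ℝ) ^ 2 := tsum_nonneg (fun n => by positivity)
    linarith
  · have := hs.sum_le_tsum s (fun n _ => by positivity)
    linarith

/-- the extra Euler factor -/
lemma extra_factor (k : ℕ) : ∃ C : ℝ, 0 < C ∧ ∀ (y : ℝ) (ν : ℕ → ℕ), 1 ≤ y → NuOK k y ν → ∀ X : ℕ,
    ∏ p ∈ Nat.primesBelow X, (1 + (2 ^ k * (k - ν p) / (p:ℝ) + 8 ^ k / (p:ℝ) ^ 2)) ≤ C * y ^ (1/8 : ℝ) := by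
  obtain ⟨C1, hC1, h1⟩ := sum_inv_prime_le (1 / (8 * ((k+1) * 2 ^ k))) (by positivity)
  obtain ⟨C2, hC2, h2⟩ := sum_inv_sq_le
  refine ⟨Real.exp ((k+1) * 2 ^ k * C1 + 8 ^ k * C2), Real.exp_pos _, fun y ν hy hν X => ?_⟩
  have hy0 : 0 < y := by linarith
  calc _ ≤ ∏ p ∈ Nat.primesBelow X, Real.exp (2 ^ k * (k - ν p) / (p:ℝ) + 8 ^ k / (p:ℝ) ^ 2) := by
        apply Finset.prod_le_prod
        · intro p hp
          have : (0:ℝ) ≤ k - ν p := by rw [sub_nonneg]; exact_mod_cast hν.le_k p (Nat.prime_of_mem_primesBelow hp)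
          positivity
        · intro p hp
          have := Real.add_one_le_exp (2 ^ k * (k - ν p) / (p:ℝ) + 8 ^ k / (p:ℝ) ^ 2)
          linarith
    _ = Real.exp (∑ p ∈ Nat.primesBelow X, 2 ^ k * (k - ν p) / (p:ℝ) + 8 ^ k * ∑ p ∈ Nat.primesBelow X, 1 / (p:ℝ) ^ 2) := by
        rw [← Real.exp_sum, sum_add_distrib, mul_sum]; simp [div_eq_mul_inv]
    _ ≤ Real.exp ((k+1) * 2 ^ k * ((1 / (8 * ((k+1) * 2 ^ k))) * Real.log y + C1) + 8 ^ k * C2) := by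
        apply Real.exp_le_exp.2
        gcongr
        · calc _ = ∑ p ∈ (Nat.primesBelow X).filter (fun p : ℕ => (p:ℝ) ≤ y), 2 ^ k * (k - ν p) / (p:ℝ) := by
                symm; apply sum_filter_of_ne
                intro p hp hne
                by_contra hc
                rw [hν.eq_k p (Nat.prime_of_mem_primesBelow hp) (not_le.1 hc)] at hne
                simp at hne
            _ ≤ ∑ p ∈ (Nat.primesBelow X).filter (fun p : ℕ => (p:ℝ) ≤ y), (k+1) * 2 ^ k * (1 / (p:ℝ)) := by
                apply sum_le_sum; intro p hp
                have : (0:ℝ) ≤ ν p := by positivity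
                rw [mul_one_div, mul_comm ((k:ℝ)+1)]
                gcongr; linarith
            _ ≤ (k+1) * 2 ^ k * ∑ p ∈ (Ioc 0 ⌊y⌋₊).filter Nat.Prime, 1 / (p:ℝ) := by
                rw [← mul_sum]; gcongr
                intro p hp
                simp only [mem_filter, mem_Ioc] at hp ⊢
                have hpp := Nat.prime_of_mem_primesBelow hp.1
                exact ⟨⟨hpp.pos, Nat.le_floor hp.2⟩, hpp⟩
            _ ≤ _ := by gcongr; exact h1 y hy
        · exact h2 _
    _ = _ := by
        rw [Real.rpow_def_of_pos hy0, ← Real.exp_add]; congr 1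
        field_simp
        ring

/-- finite Euler product -/
noncomputable def ZX (ν : ℕ → ℕ) (X : ℕ) (s : ℂ) : ℂ :=
  ∏ p ∈ Nat.primesBelow X, (1 - ν p * (p : ℂ) ^ (-(1 + s)))

lemma prime_cpow_norm {p : ℕ} (hp : p.Prime) {s : ℂ} : ‖(p : ℂ) ^ (-(1 + s))‖ = (p:ℝ) ^ (-(1 + s.re)) := by
  rw [Complex.norm_natCast_cpow_of_pos hp.pos]; simp

lemma ZX_bound {k : ℕ} : ∃ C : ℝ, 0 < C ∧ ∀ (y : ℝ) (ν : ℕ → ℕ), 1 ≤ y → NuOK k y ν → ∀ X : ℕ, ∀ s : ℂ, 0 < s.re →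
    ‖ZX ν X s‖ ≤ C * y ^ (1/8 : ℝ) * ‖∏ p ∈ Nat.primesBelow X, (1 - (p : ℂ) ^ (-(1 + s)))‖ ^ k := by
  obtain ⟨C, hC, h⟩ := extra_factor k
  refine ⟨C, hC, fun y ν hy hν X s hs => ?_⟩
  refine le_trans ?_ (mul_le_mul_of_nonneg_right (h y ν hy hν X) (by positivity))
  rw [ZX, norm_prod, norm_prod, ← prod_pow, ← prod_mul_distrib]
  apply Finset.prod_le_prod (fun p _ => norm_nonneg _)
  intro p hp
  have hpp := Nat.prime_of_mem_primesBelow hp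
  have hp2 : (2:ℝ) ≤ p := by exact_mod_cast hpp.two_le
  rw [mul_comm (1 + _)]
  refine one_sub_nu_bound hp2 ?_ (hν.le_k p hpp)
  rw [prime_cpow_norm hpp, one_div, ← Real.rpow_neg_one]
  exact Real.rpow_le_rpow_of_exponent_le (by linarith) (by linarith)

lemma euler_partial_bound {σ : ℝ} (hσ : 0 < σ) : ∃ D : ℝ, 0 < D ∧ ∀ (X : ℕ) (s : ℂ), s.re = σ →
    ‖∏ p ∈ Nat.primesBelow X, (1 - (p : ℂ) ^ (-(1 + s)))‖ ≤ D := by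
  have hs : Summable (fun n : ℕ => (n : ℝ) ^ (-(1 + σ))) := Real.summable_nat_rpow.2 (by linarith)
  refine ⟨Real.exp (∑' n : ℕ, (n : ℝ) ^ (-(1 + σ))), Real.exp_pos _, fun X s h => ?_⟩
  rw [norm_prod]
  calc _ ≤ ∏ p ∈ Nat.primesBelow X, Real.exp ((p : ℝ) ^ (-(1 + σ))) := by
        apply Finset.prod_le_prod (fun p _ => norm_nonneg _)
        intro p hp
        have hpp := Nat.prime_of_mem_primesBelow hp
        refine (norm_sub_le _ _).trans ?_
        rw [prime_cpow_norm hpp, h, norm_one]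
        have := Real.add_one_le_exp ((p : ℝ) ^ (-(1 + σ)))
        linarith
    _ ≤ _ := by
        rw [← Real.exp_sum]
        apply Real.exp_le_exp.2
        exact hs.sum_le_tsum _ (fun n _ => by positivity)

lemma euler_partial_tendsto {s : ℂ} (hs : 0 < s.re) :
    Tendsto (fun X : ℕ => ‖∏ p ∈ Nat.primesBelow X, (1 - (p : ℂ) ^ (-(1 + s)))‖) atTop
      (𝓝 (1 / ‖riemannZeta (1 + s)‖)) := by
  have h1 : 1 < (1 + s).re := by simp; exact hs
  have h := riemannZeta_eulerProduct h1
  have h2 := (h.inv₀ (riemannZeta_ne_zero_of_one_lt_re h1)).norm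
  rw [norm_inv, ← one_div] at h2
  refine h2.congr fun X => ?_
  rw [← prod_inv_distrib]; simp

end PartP2

section PartP3

open Finset Filter Topology MeasureTheory

/-- twisted f as arithmetic function -/
noncomputable def tw (ν : ℕ → ℕ) (s : ℂ) : ArithmeticFunction ℂ :=
  ⟨fun n => if n = 0 then 0 else (cmf ν n : ℂ) * (n : ℂ) ^ (-s), by simp⟩

lemma tw_apply (ν : ℕ → ℕ) (s : ℂ) {n : ℕ} (hn : n ≠ 0) : tw ν s n = (cmf ν n : ℂ) * (n : ℂ) ^ (-s) := by
  simp [tw, hn]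

lemma tw_mult (ν : ℕ → ℕ) (s : ℂ) : (tw ν s).IsMultiplicative := by
  rw [ArithmeticFunction.IsMultiplicative.iff_ne_zero]
  constructor
  · rw [tw_apply ν s one_ne_zero, cmf_one]; simp
  · intro m n hm hn _
    rw [tw_apply ν s hm, tw_apply ν s hn, tw_apply ν s (mul_ne_zero hm hn), cmf_mul ν hm hn,
      Nat.cast_mul, Complex.natCast_mul_natCast_cpow]
    push_cast; ring

/-- product of primes below X -/
def pprod (X : ℕ) : ℕ := ∏ p ∈ Nat.primesBelow X, p

lemma pprod_ne_zero (X : ℕ) : pprod X ≠ 0 := prod_ne_zero_iff.2 fun p hp => (Nat.prime_of_mem_primesBelow hp).ne_zero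

lemma pprod_primeFactors (X : ℕ) : (pprod X).primeFactors = Nat.primesBelow X :=
  Nat.primeFactors_prod fun p hp => Nat.prime_of_mem_primesBelow hp

lemma pprod_sqf (X : ℕ) : Squarefree (pprod X) := by
  unfold pprod
  apply Finset.squarefree_prod_of_pairwise_isCoprime
  · intro p hp q hq hne
    refine Nat.coprime_iff_isRelPrime.1 ?_
    exact (Nat.coprime_primes (Nat.prime_of_mem_primesBelow hp) (Nat.prime_of_mem_primesBelow hq)).2 hne
  · intro p hp
    exact (Nat.prime_of_mem_primesBelow hp).prime.squarefree

lemma dvd_pprod {X d : ℕ} (hd : Squarefree d) (h : d < X) : d ∣ pprod X := by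
  rw [← Nat.prod_primeFactors_of_squarefree hd]
  apply prod_dvd_prod_of_subset
  intro p hp
  have hpp := Nat.prime_of_mem_primeFactors hp
  have := Nat.le_of_dvd (Nat.pos_of_ne_zero hd.ne_zero) (Nat.dvd_of_mem_primeFactors hp)
  rw [Nat.mem_primesBelow]
  exact ⟨by omega, hpp⟩

lemma ZX_eq (ν : ℕ → ℕ) (X : ℕ) (s : ℂ) :
    ZX ν X s = ∑ d ∈ (pprod X).divisors, (muf ν d : ℂ) * (d : ℂ) ^ (-s) := by
  have h := (tw_mult ν s).prodPrimeFactors_one_sub_of_squarefree (tw ν s) (pprod_sqf X)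
  rw [pprod_primeFactors] at h
  rw [ZX]
  trans ∏ p ∈ Nat.primesBelow X, (1 - tw ν s p)
  · apply prod_congr rfl
    intro p hp
    have hpp := Nat.prime_of_mem_primesBelow hp
    have hp0 : (p:ℂ) ≠ 0 := by exact_mod_cast hpp.ne_zero
    rw [tw_apply ν s hpp.ne_zero, cmf_prime ν hpp, fl, neg_add, Complex.cpow_add _ _ hp0, Complex.cpow_neg_one]
    push_cast; ring
  · rw [h]
    apply sum_congr rfl
    intro d hd
    rw [tw_apply ν s (Nat.pos_of_mem_divisors hd).ne', muf]
    push_cast; ring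

lemma SS_muf_eq (ν : ℕ → ℕ) {j : ℕ} (hj : 1 ≤ j) (u : ℝ) {X : ℕ} (hX : ⌊Real.exp u⌋₊ < X) :
    SS (muf ν) j u = ∑ d ∈ (pprod X).divisors, muf ν d * Fp j (u - Real.log d) := by
  rw [SS_eq (muf ν) j (le_max_right (pprod X) ⌊Real.exp u⌋₊)]
  symm
  apply sum_subset
  · intro d hd
    have h1 := Nat.pos_of_mem_divisors hd
    have h2 := Nat.divisor_le hd
    rw [mem_Ioc]; omega
  · intro d hd hdn
    rw [Nat.mem_divisors] at hdn
    rw [mem_Ioc] at hd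
    have hd0 := hd.1
    by_cases hs : Squarefree d
    · have : ¬ d < X := by
        intro hlt
        have := dvd_pprod hs hlt
        have h3 := pprod_ne_zero X
        tauto
      have h4 : u < Real.log d := by
        by_contra hc
        have := (mem_floor_exp (m := d) (v := u)).2 ⟨hd0, by linarith⟩
        simp at this; omega
      simp [Fp]; intro; linarith
    · simp [muf, ArithmeticFunction.moebius_eq_zero_of_not_squarefree hs]

lemma SS_muf_integral (ν : ℕ → ℕ) {j : ℕ} (hj : 1 ≤ j) (u : ℝ) {X : ℕ} (hX : ⌊Real.exp u⌋₊ < X)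
    {σ : ℝ} (hσ : 0 < σ) :
    ((SS (muf ν) j u : ℝ) : ℂ) = ∫ ξ : ℝ, Complex.exp (spt σ ξ * u) / (spt σ ξ) ^ (j+1) * ZX ν X (spt σ ξ) := by
  rw [SS_muf_eq ν hj u hX]
  push_cast
  have h1 : ∀ d ∈ (pprod X).divisors, (muf ν d : ℂ) * (Fp j (u - Real.log d) : ℂ) =
      ∫ ξ : ℝ, (muf ν d : ℂ) * (Complex.exp (spt σ ξ * (u - Real.log d : ℝ)) / (spt σ ξ) ^ (j+1)) := by
    intro d _
    rw [perron hσ hj, integral_const_mul]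
  rw [sum_congr rfl h1, ← integral_finsetSum]
  · congr 1; ext ξ
    rw [ZX_eq, mul_sum]
    apply sum_congr rfl
    intro d hd
    have hd0 : (d:ℂ) ≠ 0 := by exact_mod_cast (Nat.pos_of_mem_divisors hd).ne'
    rw [Complex.cpow_def_of_ne_zero hd0, Complex.ofReal_sub, mul_sub, sub_eq_add_neg, Complex.exp_add, Complex.natCast_log]
    have : -(spt σ ξ * Complex.log d) = Complex.log d * -(spt σ ξ) := by ring
    rw [this]; ring
  · intro d _
    apply Integrable.const_mul
    have := (spt_inv_integrable hσ (k := j+1) (by omega)).const_mul (Real.exp (σ * (u - Real.log d)))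
    refine this.mono' ?_ ?_
    · apply Continuous.aestronglyMeasurable
      have := spt_continuous σ
      exact Continuous.div (by fun_prop) (by fun_prop) (fun ξ => pow_ne_zero _ (spt_ne hσ ξ))
    · refine Eventually.of_forall fun ξ => ?_
      rw [norm_div, norm_pow, Complex.norm_exp, mul_one_div, Complex.re_mul_ofReal, spt_re]

lemma zeta_int_bound {k : ℕ} (hk : 4 ≤ k) : ∃ C : ℝ, 0 < C ∧ ∀ σ : ℝ, 0 < σ → σ ≤ 1 →
    ∫ ξ : ℝ, 1 / ‖spt σ ξ‖ ^ (k+1) * (1 / ‖riemannZeta (1 + spt σ ξ)‖) ^ k ≤ C * σ ^ (-(1/2) : ℝ) := by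
  obtain ⟨c, hc, hz⟩ := zeta_lower
  refine ⟨Real.pi / c ^ k, by positivity, fun σ hσ hσ1 => ?_⟩
  have hpos : ∀ ξ, 0 < ‖spt σ ξ‖ := fun ξ => norm_pos_iff.2 (spt_ne hσ ξ)
  set r := σ ^ (1/2 : ℝ) with hr
  have hr0 : 0 < r := by positivity
  have hr2 : r ^ 2 = σ := by rw [hr, ← Real.rpow_natCast, ← Real.rpow_mul hσ.le]; norm_num
  have hrinv : σ ^ (-(1/2) : ℝ) = 1 / r := by rw [hr, Real.rpow_neg hσ.le, one_div, one_div]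
  have hI1 := inv_sq_integrable hσ
  have hI2 := inv_sq_integrable one_pos
  have hle : ∀ ξ : ℝ, 1 / ‖spt σ ξ‖ ^ (k+1) * (1 / ‖riemannZeta (1 + spt σ ξ)‖) ^ k ≤
      (1 / c ^ k) * ((r / 2) * (1 / (σ ^ 2 + ξ ^ 2)) + (1 / (2 * r)) * (1 / (1 ^ 2 + ξ ^ 2))) := by
    intro ξ
    have h0 := hpos ξ
    have h1 := hz (spt σ ξ) (by rw [spt_re]; exact hσ) (by rw [spt_re]; exact hσ1)
    rw [spt_im, norm_mul] at h1
    set x := 1 + |2 * Real.pi * ξ| with hx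
    have hx1 : 1 ≤ x := by rw [hx]; linarith [abs_nonneg (2 * Real.pi * ξ)]
    set w := x ^ (1/2:ℝ) with hw
    have hw1 : 1 ≤ w := Real.one_le_rpow hx1 (by norm_num)
    have hw4 : 1 + ξ ^ 2 ≤ w ^ 4 := by
      have : w ^ 4 = x ^ 2 := by
        rw [hw, ← Real.rpow_natCast, ← Real.rpow_mul (by linarith), ← Real.rpow_natCast]; norm_num
      rw [this, hx]
      have h3 : |ξ| ≤ |2 * Real.pi * ξ| := by
        rw [abs_mul]; 
        have : 1 ≤ |2 * Real.pi| := by rw [abs_of_pos (by positivity)]; linarith [Real.pi_gt_three]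
        nlinarith [abs_nonneg ξ]
      nlinarith [abs_nonneg ξ, sq_abs ξ]
    have hwk : 1 + ξ ^ 2 ≤ w ^ k := hw4.trans (pow_le_pow_right₀ hw1 hk)
    have h4 : 1 / ‖spt σ ξ‖ ^ (k+1) * (1 / ‖riemannZeta (1 + spt σ ξ)‖) ^ k =
        (1 / ‖spt σ ξ‖) * (1 / (‖spt σ ξ‖ * ‖riemannZeta (1 + spt σ ξ)‖) ^ k) := by
      rw [mul_pow, pow_succ]; simp only [one_div, inv_pow, mul_inv]; ring
    rw [h4]
    have h5 : 1 / (‖spt σ ξ‖ * ‖riemannZeta (1 + spt σ ξ)‖) ^ k ≤ (1 / c ^ k) * (1 / (1 + ξ^2)) := by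
      rw [one_div_mul_one_div]
      apply one_div_le_one_div_of_le (by positivity)
      calc c ^ k * (1 + ξ^2) ≤ c ^ k * w ^ k := by gcongr
        _ = (c * w) ^ k := by rw [mul_pow]
        _ ≤ _ := by gcongr
    have h6 : 1 / ‖spt σ ξ‖ ≤ (r / 2) * (1 / ‖spt σ ξ‖ ^ 2) + 1 / (2 * r) := by
      have : (r / 2) * (1 / ‖spt σ ξ‖ ^ 2) + 1 / (2 * r) - 1 / ‖spt σ ξ‖ = (r - ‖spt σ ξ‖) ^ 2 / (2 * r * ‖spt σ ξ‖ ^ 2) := by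
        field_simp; ring
      have h7 : 0 ≤ (r - ‖spt σ ξ‖) ^ 2 / (2 * r * ‖spt σ ξ‖ ^ 2) := by positivity
      linarith
    have h8 := spt_sq_ge σ ξ
    have h9 : 1 / (1 + ξ ^ 2) ≤ 1 := by rw [div_le_one (by positivity)]; nlinarith [sq_nonneg ξ]
    calc 1 / ‖spt σ ξ‖ * (1 / (‖spt σ ξ‖ * ‖riemannZeta (1 + spt σ ξ)‖) ^ k)
        ≤ ((r / 2) * (1 / ‖spt σ ξ‖ ^ 2) + 1 / (2 * r)) * ((1 / c ^ k) * (1 / (1 + ξ^2))) := by gcongr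
      _ = (1 / c ^ k) * ((r / 2) * (1 / ‖spt σ ξ‖ ^ 2) * (1 / (1 + ξ^2)) + 1 / (2 * r) * (1 / (1 + ξ^2))) := by ring
      _ ≤ (1 / c ^ k) * ((r / 2) * (1 / (σ ^ 2 + ξ ^ 2)) * 1 + 1 / (2 * r) * (1 / (1 + ξ^2))) := by gcongr
      _ = _ := by rw [one_pow, mul_one]
  have hinteg := ((hI1.1.const_mul (r/2)).add (hI2.1.const_mul (1 / (2*r)))).const_mul (1 / c ^ k)
  calc _ ≤ ∫ ξ : ℝ, (1 / c ^ k) * ((r / 2) * (1 / (σ ^ 2 + ξ ^ 2)) + (1 / (2 * r)) * (1 / (1 ^ 2 + ξ ^ 2))) := by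
        apply integral_mono_of_nonneg
        · exact Eventually.of_forall fun ξ => by positivity
        · exact hinteg
        · exact Eventually.of_forall hle
    _ = Real.pi / c ^ k * σ ^ (-(1/2) : ℝ) := by
        rw [integral_const_mul, integral_add (hI1.1.const_mul (r/2)) (hI2.1.const_mul (1 / (2*r))),
          integral_const_mul, integral_const_mul, hI1.2, hI2.2, hrinv, ← hr2]
        field_simp
        ring

theorem Mk_bound {k : ℕ} (hk : 4 ≤ k) : ∃ C : ℝ, 0 < C ∧ ∀ (y : ℝ) (ν : ℕ → ℕ), 1 ≤ y → NuOK k y ν →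
    ∀ L u : ℝ, 1 ≤ L → u ≤ L → |SS (muf ν) k u| ≤ C * y ^ (1/8 : ℝ) * L ^ (1/2 : ℝ) := by
  obtain ⟨C1, hC1, h1⟩ := zeta_int_bound hk
  obtain ⟨C2, hC2, h2⟩ := ZX_bound (k := k)
  refine ⟨Real.exp 1 * C2 * C1, by positivity, fun y ν hy hν L u hL hu => ?_⟩
  have hL0 : 0 < L := by linarith
  have hy0 : 0 < y := by linarith
  set σ := 1 / L with hσd
  have hσ : 0 < σ := by positivity
  have hσ1 : σ ≤ 1 := by rw [hσd, div_le_one hL0]; exact hL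
  have hpos : ∀ ξ, 0 < ‖spt σ ξ‖ := fun ξ => norm_pos_iff.2 (spt_ne hσ ξ)
  set EX : ℕ → ℝ → ℝ := fun X ξ => ‖∏ p ∈ Nat.primesBelow X, (1 - (p : ℂ) ^ (-(1 + spt σ ξ)))‖ with hEX
  obtain ⟨D, hD, hDb⟩ := euler_partial_bound hσ
  have hEXc : ∀ X, Continuous (EX X) := by
    intro X
    rw [hEX]
    apply Continuous.norm
    apply continuous_finsetProd
    intro p hp
    have hpp := Nat.prime_of_mem_primesBelow hp
    have := spt_continuous σ
    refine continuous_const.sub ?_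
    apply Continuous.const_cpow (by fun_prop)
    left; exact_mod_cast hpp.ne_zero
  have hInt := (spt_inv_integrable hσ (k := k+1) (by omega)).mul_const (D ^ k)
  have hbd : ∀ X ξ, 1 / ‖spt σ ξ‖ ^ (k+1) * EX X ξ ^ k ≤ 1 / ‖spt σ ξ‖ ^ (k+1) * D ^ k := by
    intro X ξ
    have := hDb X (spt σ ξ) (spt_re σ ξ)
    have h0 : 0 ≤ EX X ξ := norm_nonneg _
    gcongr
  have hmeas : ∀ X, AEStronglyMeasurable (fun ξ => 1 / ‖spt σ ξ‖ ^ (k+1) * EX X ξ ^ k) volume := by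
    intro X
    apply Continuous.aestronglyMeasurable
    have := spt_continuous σ
    have h3 := hEXc X
    exact (continuous_const.div (by fun_prop) (fun ξ => (pow_pos (hpos ξ) _).ne')).mul (by fun_prop)
  have hlim : Tendsto (fun X => ∫ ξ, 1 / ‖spt σ ξ‖ ^ (k+1) * EX X ξ ^ k) atTop
      (𝓝 (∫ ξ, 1 / ‖spt σ ξ‖ ^ (k+1) * (1 / ‖riemannZeta (1 + spt σ ξ)‖) ^ k)) := by
    apply tendsto_integral_of_dominated_convergence _ hmeas hInt
    · intro X
      refine Eventually.of_forall fun ξ => ?_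
      rw [Real.norm_of_nonneg (by have := hpos ξ; positivity)]
      exact hbd X ξ
    · refine Eventually.of_forall fun ξ => ?_
      apply Tendsto.const_mul
      apply Tendsto.pow
      exact euler_partial_tendsto (by rw [spt_re]; exact hσ)
  have hXb : ∀ᶠ X in atTop, |SS (muf ν) k u| ≤ Real.exp 1 * (C2 * y ^ (1/8:ℝ)) * ∫ ξ, 1 / ‖spt σ ξ‖ ^ (k+1) * EX X ξ ^ k := by
    filter_upwards [eventually_gt_atTop ⌊Real.exp u⌋₊] with X hX
    have h3 := SS_muf_integral ν (by omega : 1 ≤ k) u hX hσ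
    rw [← Real.norm_eq_abs, ← Complex.norm_real, h3, ← integral_const_mul]
    apply norm_integral_le_of_norm_le
    · exact (Integrable.mono' hInt (hmeas X) (Eventually.of_forall fun ξ => by
        rw [Real.norm_of_nonneg (by have := hpos ξ; positivity)]; exact hbd X ξ)).const_mul _
    · refine Eventually.of_forall fun ξ => ?_
      rw [norm_mul, norm_div, norm_pow, Complex.norm_exp, Complex.re_mul_ofReal, spt_re]
      have h4 := h2 y ν hy hν X (spt σ ξ) (by rw [spt_re]; exact hσ)
      have h5 : σ * u ≤ 1 := by rw [hσd, one_div_mul_eq_div, div_le_one hL0]; exact hu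
      calc Real.exp (σ * u) / ‖spt σ ξ‖ ^ (k+1) * ‖ZX ν X (spt σ ξ)‖
          ≤ Real.exp 1 / ‖spt σ ξ‖ ^ (k+1) * (C2 * y ^ (1/8:ℝ) * EX X ξ ^ k) := by
            have := hpos ξ
            gcongr
        _ = _ := by ring
  have := ge_of_tendsto (hlim.const_mul (Real.exp 1 * (C2 * y ^ (1/8:ℝ)))) hXb
  refine this.trans ?_
  have h6 := h1 σ hσ hσ1
  have h7 : σ ^ (-(1/2) : ℝ) = L ^ (1/2 : ℝ) := by
    rw [hσd, one_div, Real.inv_rpow hL0.le, Real.rpow_neg hL0.le, inv_inv]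
  rw [h7] at h6
  calc _ ≤ Real.exp 1 * (C2 * y ^ (1/8:ℝ)) * (C1 * L ^ (1/2 : ℝ)) := by gcongr
    _ = _ := by ring

end PartP3

section PartN1

open Finset Filter Topology MeasureTheory

lemma moebius_log_conv (n : ℕ) :
    ∑ x ∈ n.divisorsAntidiagonal, (ArithmeticFunction.moebius x.1 : ℝ) * ArithmeticFunction.vonMangoldt x.2
      = - ((ArithmeticFunction.moebius n : ℝ) * Real.log n) := by
  have h1 : (((ArithmeticFunction.moebius : ArithmeticFunction ℤ) : ArithmeticFunction ℝ).pmul ArithmeticFunction.log) * ((ArithmeticFunction.zeta : ArithmeticFunction ℕ) : ArithmeticFunction ℝ)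
      = - ArithmeticFunction.vonMangoldt := by
    ext m
    rw [ArithmeticFunction.coe_mul_zeta_apply]
    have := ArithmeticFunction.sum_moebius_mul_log_eq (n := m)
    simp only [ArithmeticFunction.pmul_apply, ArithmeticFunction.intCoe_apply]
    rw [this]; rfl
  have h2 := congrArg (· * ((ArithmeticFunction.moebius : ArithmeticFunction ℤ) : ArithmeticFunction ℝ)) h1
  simp only [mul_assoc, ArithmeticFunction.coe_zeta_mul_coe_moebius, mul_one] at h2
  have h3 := congrArg (fun F : ArithmeticFunction ℝ => F n) h2
  simp only [ArithmeticFunction.pmul_apply, ArithmeticFunction.intCoe_apply, ArithmeticFunction.log_apply] at h3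
  rw [h3, neg_mul, mul_comm, ArithmeticFunction.neg_apply, neg_neg, ArithmeticFunction.mul_apply]
  simp only [ArithmeticFunction.intCoe_apply]

lemma muf_log (ν : ℕ → ℕ) (n : ℕ) :
    muf ν n * Real.log n = - dconv (muf ν) (fun n => ArithmeticFunction.vonMangoldt n * cmf ν n) n := by
  unfold dconv muf
  have h : ∀ x ∈ n.divisorsAntidiagonal, (ArithmeticFunction.moebius x.1 : ℝ) * cmf ν x.1 *
      (ArithmeticFunction.vonMangoldt x.2 * cmf ν x.2) = cmf ν n *
      ((ArithmeticFunction.moebius x.1 : ℝ) * ArithmeticFunction.vonMangoldt x.2) := by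
    intro x hx
    rw [Nat.mem_divisorsAntidiagonal] at hx
    obtain ⟨h1, h2⟩ := hx
    have h3 : x.1 ≠ 0 := by intro h; rw [h] at h1; simp at h1; exact h2 h1.symm
    have h4 : x.2 ≠ 0 := by intro h; rw [h] at h1; simp at h1; exact h2 h1.symm
    rw [← h1, cmf_mul ν h3 h4]; ring
  rw [sum_congr rfl h, ← mul_sum, moebius_log_conv]; ring

lemma muf_rec (ν : ℕ → ℕ) (j : ℕ) (u : ℝ) :
    u * SS (muf ν) j u = (j+1) * SS (muf ν) (j+1) u -
      SS (dconv (muf ν) (fun n => ArithmeticFunction.vonMangoldt n * cmf ν n)) j u := by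
  rw [SS_mul, SS_congr (fun n _ => muf_log ν n), SS_neg_fun]; ring

lemma SS_pow_bound (a : ℕ → ℝ) {j : ℕ} (hj : 1 ≤ j) {L B : ℝ}
    (h : ∀ w, 0 ≤ w → w ≤ L → |SS a j w| ≤ B) (i : ℕ) :
    ∀ w, 0 ≤ w → w ≤ L → |SS a (j+i) w| ≤ B * w ^ i := by
  induction i with
  | zero => intro w h0 h1; simpa using h w h0 h1
  | succ i ih =>
    intro w h0 h1
    have h2 := SS_integral a (j := j + i) (by omega) 0 w
    rw [SS_zero a (by omega), sub_zero] at h2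
    rw [← add_assoc, ← h2]
    have := intervalIntegral.norm_integral_le_of_norm_le_const (a := 0) (b := w) (f := SS a (j+i)) (C := B * w ^ i) (by
      intro x hx
      rw [Set.uIoc_of_le h0] at hx
      have hB : 0 ≤ B := (abs_nonneg _).trans (h x hx.1.le (hx.2.trans h1))
      refine (ih x hx.1.le (hx.2.trans h1)).trans ?_
      have h4 := hx.1
      have h5 := hx.2
      gcongr)
    rw [sub_zero, abs_of_nonneg h0] at this
    calc _ ≤ _ := this
      _ = _ := by ring

lemma muf_step {k : ℕ} {ν : ℕ → ℕ} {L E B : ℝ} (hk : 1 ≤ k) (hE : 0 ≤ E)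
    (hb : ∀ τ, 0 ≤ τ → |SS (fun n => ArithmeticFunction.vonMangoldt n * cmf ν n) 0 τ - k * τ| ≤ E)
    (hB : ∀ w, 0 ≤ w → w ≤ L → |SS (muf ν) k w| ≤ B) (i : ℕ) (hi : 1 ≤ i) (u : ℝ) (hu : 0 ≤ u) (huL : u ≤ L) :
    |u * SS (muf ν) (k+i) u - (i+1) * SS (muf ν) (k+(i+1)) u| ≤ E * B * u ^ i := by
  obtain ⟨i, rfl⟩ : ∃ m, i = m + 1 := ⟨i-1, by omega⟩
  have h1 := SS_dconv_bound (muf ν) (fun n => ArithmeticFunction.vonMangoldt n * cmf ν n) (j := k + i) (i := i)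
    (by omega) hu hE (fun τ h0 _ => hb τ h0) (fun w h0 h1 => SS_pow_bound (muf ν) hk hB i w h0 (h1.trans huL))
  rw [muf_rec]
  rw [← abs_neg] at h1
  convert h1 using 2
  push_cast
  rw [show k + (i + 1 + 1) = k + i + 2 by ring, show k + (i+1) = k + i + 1 by ring]
  ring

lemma muf_asymp {k : ℕ} {ν : ℕ → ℕ} {L η : ℝ} (hk : 1 ≤ k) (hη : 0 ≤ η)
    (hs : ∀ i, 1 ≤ i → ∀ u, 0 ≤ u → u ≤ L →
      |u * SS (muf ν) (k+i) u - (i+1) * SS (muf ν) (k+(i+1)) u| ≤ η * u ^ i) (i : ℕ) (hi : 1 ≤ i) (u : ℝ) (hu : 0 < u) (huL : u ≤ L) :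
    |SS (muf ν) (k+(i+1)) u - SS (muf ν) (k+(i+1)) L / L ^ (i+1) * u ^ (i+1)| ≤ η * u ^ i := by
  have hL : 0 < L := hu.trans_le huL
  set G : ℝ → ℝ := fun x => SS (muf ν) (k+(i+1)) x / x ^ (i+1) with hG
  have hder : ∀ x, 0 < x → HasDerivAt G ((x * SS (muf ν) (k+i) x - (i+1) * SS (muf ν) (k+(i+1)) x) / x ^ (i+2)) x := by
    intro x hx
    have h1 := (SS_hasDerivAt (muf ν) (j := k+i) (by omega) x).div (hasDerivAt_pow (i+1) x) (by positivity)
    refine h1.congr_deriv ?_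
    rw [Nat.add_sub_cancel, show k + i + 1 = k + (i+1) by ring]
    push_cast
    field_simp
    ring
  have hinv : ∀ x : ℝ, 0 < x → HasDerivAt (fun x : ℝ => η * x⁻¹) (-(η / x ^ 2)) x := by
    intro x hx
    refine ((hasDerivAt_inv hx.ne').const_mul η).congr_deriv ?_
    field_simp
  have hb : ∀ x, 0 < x → x ≤ L → |(x * SS (muf ν) (k+i) x - (i+1) * SS (muf ν) (k+(i+1)) x) / x ^ (i+2)| ≤ η / x ^ 2 := by
    intro x h0 h1
    rw [abs_div, abs_of_pos (pow_pos h0 (i+2)), div_le_div_iff₀ (by positivity) (by positivity)]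
    calc _ ≤ η * x ^ i * x ^ 2 := by gcongr; exact hs i hi x h0.le h1
      _ = _ := by ring
  have hmem : ∀ x ∈ interior (Set.Icc u L), 0 < x ∧ x ≤ L := by
    intro x hx; rw [interior_Icc] at hx; exact ⟨hu.trans hx.1, hx.2.le⟩
  have hIcc : ∀ x ∈ Set.Icc u L, 0 < x := fun x hx => hu.trans_le hx.1
  have h1 : MonotoneOn (fun x => G x - η * x⁻¹) (Set.Icc u L) := by
    apply monotoneOn_of_hasDerivWithinAt_nonneg (convex_Icc u L)
      (f' := fun x => (x * SS (muf ν) (k+i) x - (i+1) * SS (muf ν) (k+(i+1)) x) / x ^ (i+2) - -(η / x ^ 2))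
    · intro x hx
      exact ((hder x (hIcc x hx)).sub (hinv x (hIcc x hx))).continuousAt.continuousWithinAt
    · intro x hx
      exact ((hder x (hmem x hx).1).sub (hinv x (hmem x hx).1)).hasDerivWithinAt
    · intro x hx
      have := (abs_le.1 (hb x (hmem x hx).1 (hmem x hx).2)).1
      linarith
  have h2 : AntitoneOn (fun x => G x + η * x⁻¹) (Set.Icc u L) := by
    apply antitoneOn_of_hasDerivWithinAt_nonpos (convex_Icc u L)
      (f' := fun x => (x * SS (muf ν) (k+i) x - (i+1) * SS (muf ν) (k+(i+1)) x) / x ^ (i+2) + -(η / x ^ 2))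
    · intro x hx
      exact ((hder x (hIcc x hx)).add (hinv x (hIcc x hx))).continuousAt.continuousWithinAt
    · intro x hx
      exact ((hder x (hmem x hx).1).add (hinv x (hmem x hx).1)).hasDerivWithinAt
    · intro x hx
      have := (abs_le.1 (hb x (hmem x hx).1 (hmem x hx).2)).2
      linarith
  have h3 := h1 ⟨le_rfl, huL⟩ ⟨huL, le_rfl⟩ huL
  have h4 := h2 ⟨le_rfl, huL⟩ ⟨huL, le_rfl⟩ huL
  simp only at h3 h4
  have h5 : 0 ≤ η * L⁻¹ := by positivity
  have h6 : |G u - G L| ≤ η * u⁻¹ := by rw [abs_le]; constructor <;> linarith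
  have h7 : SS (muf ν) (k+(i+1)) u - SS (muf ν) (k+(i+1)) L / L ^ (i+1) * u ^ (i+1) = (G u - G L) * u ^ (i+1) := by
    rw [hG]; field_simp
  rw [h7, abs_mul, abs_of_pos (pow_pos hu (i+1))]
  calc _ ≤ η * u⁻¹ * u ^ (i+1) := by gcongr
    _ = _ := by rw [pow_succ]; field_simp

/-- the constants -/
noncomputable def cc (k : ℕ) (ν : ℕ → ℕ) (L : ℝ) (i : ℕ) : ℝ := SS (muf ν) (k+i) L / L ^ i

theorem main_asymp {k : ℕ} (hk : 4 ≤ k) : ∃ C : ℝ, 0 < C ∧ ∀ (y : ℝ) (ν : ℕ → ℕ) (L : ℝ), 1 ≤ y → NuOK k y ν → 1 ≤ L →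
    (∀ i, 1 ≤ i → ∀ u, 0 < u → u ≤ L → |SS (muf ν) (k+(i+1)) u - cc k ν L (i+1) * u ^ (i+1)| ≤
      (C * (1 + Real.log y) * y ^ (1/8:ℝ) * L ^ (1/2:ℝ)) * u ^ i) ∧
    (∀ i, 1 ≤ i → |cc k ν L i - (i+1) * cc k ν L (i+1)| ≤
      (C * (1 + Real.log y) * y ^ (1/8:ℝ) * L ^ (1/2:ℝ)) / L) := by
  obtain ⟨C1, hC1, h1⟩ := psi_f_bound k
  obtain ⟨C2, hC2, h2⟩ := Mk_bound hk
  refine ⟨(C1 + k) * C2, by positivity, fun y ν L hy hν hL => ?_⟩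
  have hl := Real.log_nonneg hy
  have hL0 : 0 < L := by linarith
  have hy0 : 0 < y := by linarith
  have hE := h1 y ν hy hν
  have hB := fun w (_ : (0:ℝ) ≤ w) (hw : w ≤ L) => h2 y ν hy hν L w hL hw
  have hst := muf_step (by omega : 1 ≤ k) (by positivity) hE hB
  set η := (C1 + k) * C2 * (1 + Real.log y) * y ^ (1/8:ℝ) * L ^ (1/2:ℝ) with hη
  have hη0 : 0 ≤ η := by positivity
  have hs : ∀ i, 1 ≤ i → ∀ u, 0 ≤ u → u ≤ L →
      |u * SS (muf ν) (k+i) u - (i+1) * SS (muf ν) (k+(i+1)) u| ≤ η * u ^ i := by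
    intro i hi u hu huL
    refine (hst i hi u hu huL).trans ?_
    gcongr
    calc (C1 + k * Real.log y) * (C2 * y ^ (1/8:ℝ) * L ^ (1/2:ℝ)) ≤ ((C1 + k) * (1 + Real.log y)) * (C2 * y ^ (1/8:ℝ) * L ^ (1/2:ℝ)) := by
          gcongr
          have : 0 ≤ C1 * Real.log y := by positivity
          have : (0:ℝ) ≤ k := by positivity
          nlinarith
      _ = η := by rw [hη]; ring
  refine ⟨fun i hi u hu huL => muf_asymp (by omega) hη0 hs i hi u hu huL, fun i hi => ?_⟩
  have h3 := hs i hi L hL0.le le_rfl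
  unfold cc
  have h4 : SS (muf ν) (k+i) L / L ^ i - (i+1) * (SS (muf ν) (k+(i+1)) L / L ^ (i+1)) =
    (L * SS (muf ν) (k+i) L - (i+1) * SS (muf ν) (k+(i+1)) L) / L ^ (i+1) := by
    field_simp
    ring
  rw [h4, abs_div, abs_of_pos (pow_pos hL0 (i+1)), div_le_div_iff₀ (by positivity) hL0]
  calc _ ≤ η * L ^ i * L := by gcongr
    _ = _ := by ring

end PartN1

section PartT1

open Finset Filter Topology MeasureTheory

/-- `μ f` restricted to integers free of the primes in `S` -/
noncomputable def AS (ν : ℕ → ℕ) (S : Finset ℕ) (n : ℕ) : ℝ :=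
  if ∀ p ∈ S, ¬ p ∣ n then muf ν n else 0

noncomputable def aS (ν : ℕ → ℕ) (S : Finset ℕ) : ℝ := ∏ p ∈ S, 1 / (1 - fl ν p)

lemma AS_empty (ν : ℕ → ℕ) : AS ν ∅ = muf ν := by ext n; simp [AS]

lemma aS_pos {k : ℕ} {y : ℝ} {ν : ℕ → ℕ} (hν : NuOK k y ν) {S : Finset ℕ} (hS : ∀ p ∈ S, p.Prime) : 0 < aS ν S :=
  prod_pos fun p hp => one_div_pos.2 (by linarith [hν.fl_lt_one (hS p hp)])

lemma muf_prime_mul (ν : ℕ → ℕ) {p m : ℕ} (hp : p.Prime) (hm : m ≠ 0) (hpm : ¬ p ∣ m) :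
    muf ν (p * m) = - fl ν p * muf ν m := by
  unfold muf
  rw [cmf_mul ν hp.ne_zero hm, cmf_prime ν hp,
    ArithmeticFunction.isMultiplicative_moebius.map_mul_of_coprime ((Nat.Prime.coprime_iff_not_dvd hp).2 hpm),
    ArithmeticFunction.moebius_apply_prime hp]
  push_cast; ring

lemma muf_prime_mul_dvd (ν : ℕ → ℕ) {p m : ℕ} (hp : p.Prime) (hpm : p ∣ m) : muf ν (p * m) = 0 := by
  unfold muf
  rw [ArithmeticFunction.moebius_eq_zero_of_not_squarefree]
  · simp
  · intro h
    obtain ⟨c, rfl⟩ := hpm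
    have := h p ⟨c, by ring⟩
    exact hp.one_lt.ne' (Nat.isUnit_iff.1 this)

lemma AS_insert_dconv (ν : ℕ → ℕ) {S : Finset ℕ} {p : ℕ} (hp : p.Prime) (hS : ∀ p ∈ S, p.Prime) (hpS : p ∉ S) (n : ℕ) (hn : 0 < n) :
    AS ν S n = dconv (AS ν (insert p S)) (fun m => (if m = 1 then 1 else 0) + (if m = p then - fl ν p else 0)) n := by
  unfold dconv
  rw [Nat.sum_divisorsAntidiagonal' (fun a b => AS ν (insert p S) a * ((if b = 1 then 1 else 0) + (if b = p then - fl ν p else 0)))]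
  simp only [mul_add, sum_add_distrib, mul_ite, mul_one, mul_zero, sum_ite_eq', Nat.mem_divisors]
  rw [if_pos ⟨one_dvd _, hn.ne'⟩, Nat.div_one]
  by_cases hpn : p ∣ n
  · rw [if_pos ⟨hpn, hn.ne'⟩]
    obtain ⟨m, rfl⟩ := hpn
    rw [Nat.mul_div_cancel_left _ hp.pos]
    have h1 : AS ν (insert p S) (p * m) = 0 := by
      unfold AS; rw [if_neg]; simp
    rw [h1, zero_add]
    have hm : m ≠ 0 := by rintro rfl; simp at hn
    unfold AS
    by_cases hpm : p ∣ m
    · rw [muf_prime_mul_dvd ν hp hpm, if_neg (c := ∀ r ∈ insert p S, ¬ r ∣ m) (by simp [hpm])]; simp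
    · rw [muf_prime_mul ν hp hm hpm]
      have : (∀ r ∈ S, ¬ r ∣ p * m) ↔ (∀ r ∈ insert p S, ¬ r ∣ m) := by
        constructor
        · intro h r hr
          rcases mem_insert.1 hr with rfl | hr
          · exact hpm
          · exact fun hd => h r hr (hd.mul_left p)
        · intro h r hr hd
          rcases (hS r hr).dvd_mul.1 hd with hd | hd
          · rw [Nat.prime_dvd_prime_iff_eq (hS r hr) hp] at hd
            subst hd; exact hpS hr
          · exact h r (mem_insert_of_mem hr) hd
      simp only [this]
      split_ifs <;> ring
  · rw [if_neg (by tauto), add_zero]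
    unfold AS
    have : (∀ r ∈ S, ¬ r ∣ n) ↔ (∀ r ∈ insert p S, ¬ r ∣ n) := by
      rw [forall_mem_insert]; tauto
    simp only [this]

lemma AS_rec (ν : ℕ → ℕ) {S : Finset ℕ} {p : ℕ} (hp : p.Prime) (hS : ∀ p ∈ S, p.Prime) (hpS : p ∉ S) (j : ℕ) (v : ℝ) :
    SS (AS ν (insert p S)) j v = SS (AS ν S) j v + fl ν p * SS (AS ν (insert p S)) j (v - Real.log p) := by
  rw [SS_congr (fun n hn => AS_insert_dconv ν hp hS hpS n hn) j v, SS_dconv]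
  simp only [add_mul, ite_mul, one_mul, zero_mul, sum_add_distrib, sum_ite_eq', mem_Ioc]
  have h1 : (if 0 < 1 ∧ 1 ≤ ⌊Real.exp v⌋₊ then SS (AS ν (insert p S)) j (v - Real.log (1:ℕ)) else 0) = SS (AS ν (insert p S)) j v := by
    split_ifs with h
    · simp
    · have := mt (mem_floor_exp (m := 1) (v := v)).2 (by rw [mem_Ioc]; exact h)
      simp at this
      rw [SS_neg _ _ this]
  have h2 : (if 0 < p ∧ p ≤ ⌊Real.exp v⌋₊ then -fl ν p * SS (AS ν (insert p S)) j (v - Real.log p) else 0) = -fl ν p * SS (AS ν (insert p S)) j (v - Real.log p) := by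
    split_ifs with h
    · rfl
    · have := mt (mem_floor_exp (m := p) (v := v)).2 (by rw [mem_Ioc]; exact h)
      simp [hp.pos] at this
      rw [SS_neg _ _ (by linarith)]; simp
  rw [h1, h2]; ring

lemma cmp_lemma {F0 F1 U : ℝ → ℝ} {f lg L : ℝ} (hf0 : 0 ≤ f) (hf1 : f < 1) (hlg : 0 < lg)
    (hU0 : ∀ v, 0 ≤ U v) (hUm : Monotone U) (h0 : ∀ v ≤ L, F0 v ≤ U v)
    (hrec : ∀ v, F1 v = F0 v + f * F1 (v - lg)) (hneg : ∀ v < 0, F1 v = 0) :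
    ∀ v ≤ L, F1 v ≤ 1 / (1 - f) * U v := by
  have h1f : 0 < 1 - f := by linarith
  have key : ∀ n : ℕ, ∀ v ≤ L, v < n * lg → F1 v ≤ 1 / (1 - f) * U v := by
    intro n
    induction n with
    | zero =>
      intro v _ hv
      rw [hneg v (by simpa using hv)]
      have := hU0 v
      positivity
    | succ n ih =>
      intro v hvL hv
      have h2 := ih (v - lg) (by linarith) (by push_cast at hv; linarith)
      have h3 : U (v - lg) ≤ U v := hUm (by linarith)
      rw [hrec v]
      calc F0 v + f * F1 (v - lg) ≤ U v + f * (1 / (1 - f) * U v) := by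
            have := h0 v hvL
            have h4 : F1 (v - lg) ≤ 1 / (1 - f) * U v := h2.trans (by gcongr)
            gcongr
        _ = _ := by field_simp; ring
  intro v hv
  obtain ⟨n, hn⟩ := exists_nat_gt (v / lg)
  exact key n v hv (by rwa [div_lt_iff₀ hlg] at hn)

lemma aS_insert (ν : ℕ → ℕ) {S : Finset ℕ} {p : ℕ} (hpS : p ∉ S) : aS ν (insert p S) = 1 / (1 - fl ν p) * aS ν S := by
  unfold aS; rw [prod_insert hpS]

lemma AS_upper {k : ℕ} {y : ℝ} {ν : ℕ → ℕ} (hν : NuOK k y ν) {j : ℕ} {L ε : ℝ} {U : ℝ → ℝ}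
    (hU0 : ∀ v, 0 ≤ U v) (hUm : Monotone U) (h0 : ∀ v ≤ L, ε * SS (muf ν) j v ≤ U v)
    (S : Finset ℕ) (hS : ∀ p ∈ S, p.Prime) : ∀ v ≤ L, ε * SS (AS ν S) j v ≤ aS ν S * U v := by
  induction S using Finset.induction_on with
  | empty => intro v hv; simpa [AS_empty, aS] using h0 v hv
  | insert p S hpS ih =>
    have hp := hS p (mem_insert_self _ _)
    have hS' : ∀ r ∈ S, r.Prime := fun r hr => hS r (mem_insert_of_mem hr)
    have ha := aS_pos hν hS'
    have := cmp_lemma (F0 := fun v => ε * SS (AS ν S) j v) (F1 := fun v => ε * SS (AS ν (insert p S)) j v)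
      (U := fun v => aS ν S * U v) (L := L) (hν.fl_pos hp).le (hν.fl_lt_one hp)
      (Real.log_pos (by exact_mod_cast hp.one_lt : (1:ℝ) < p)) (fun v => mul_nonneg ha.le (hU0 v))
      (fun a b hab => mul_le_mul_of_nonneg_left (hUm hab) ha.le) (ih hS')
      (fun v => by rw [AS_rec ν hp hS' hpS]; ring) (fun v hv => by rw [SS_neg _ _ hv, mul_zero])
    intro v hv
    refine (this v hv).trans (le_of_eq ?_)
    rw [aS_insert ν hpS]; ring

lemma AS_abs {k : ℕ} {y : ℝ} {ν : ℕ → ℕ} (hν : NuOK k y ν) {j : ℕ} {L : ℝ} {U : ℝ → ℝ}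
    (hU0 : ∀ v, 0 ≤ U v) (hUm : Monotone U) (h0 : ∀ v ≤ L, |SS (muf ν) j v| ≤ U v)
    (S : Finset ℕ) (hS : ∀ p ∈ S, p.Prime) : ∀ v ≤ L, |SS (AS ν S) j v| ≤ aS ν S * U v := by
  intro v hv
  have h1 := AS_upper hν (ε := 1) hU0 hUm (fun v hv => by rw [one_mul]; exact (abs_le.1 (h0 v hv)).2) S hS v hv
  have h2 := AS_upper hν (ε := -1) hU0 hUm (fun v hv => by have := (abs_le.1 (h0 v hv)).1; linarith) S hS v hv
  rw [abs_le]; constructor <;> linarith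

lemma pow_sub_ge {v lg : ℝ} (h0 : 0 ≤ lg) (h : lg ≤ v) (i : ℕ) :
    v ^ (i+1) - (i+1) * lg * v ^ i ≤ (v - lg) ^ (i+1) := by
  induction i with
  | zero => simp
  | succ i ih =>
    have h1 : 0 ≤ v - lg := by linarith
    have hv : 0 ≤ v := by linarith
    have h2 := mul_le_mul_of_nonneg_left ih h1
    have h3 : 0 ≤ (i+1) * lg * v ^ i * lg := by positivity
    rw [pow_succ (v - lg) (i+1)]
    push_cast
    have e : (v - lg) * (v ^ (i+1) - (i+1) * lg * v ^ i) = v ^ (i+1+1) - (i+1+1) * lg * v ^ (i+1) + (i+1) * lg * v ^ i * lg := by ring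
    rw [e] at h2
    linarith

lemma low_case1 {f g lg a c v ηS : ℝ} {i : ℕ} (h1f : 0 < 1 - f) (hf0 : 0 < f) (hg0 : 0 < g) (hgf : g * (1 - f) = f)
    (ha : 0 < a) (hc : 0 ≤ c) (hηS : 0 ≤ ηS) (hv : 0 ≤ v) (hlg : 0 < lg) (hlt : v < lg) :
    1 / (1 - f) * a * (c * v ^ (i+1) - (ηS + c * (i+1) * (g * lg)) * v ^ i) ≤ a * (c * v ^ (i+1) - ηS * v ^ i) := by
  have hvi : 0 ≤ v ^ i := by positivity
  have h2 : 1 / (1 - f) * a * (c * v ^ (i+1) - (ηS + c * (i+1) * (g * lg)) * v ^ i) = a * ((c * v - (ηS + c * (i+1) * (g * lg))) * v ^ i / (1 - f)) := by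
    field_simp; ring
  have h3 : a * (c * v ^ (i+1) - ηS * v ^ i) = a * ((c * v - ηS) * v ^ i) := by ring
  rw [h2, h3]
  refine mul_le_mul_of_nonneg_left ?_ ha.le
  rw [div_le_iff₀ h1f]
  have h4 : c * v - (ηS + c * (i+1) * (g * lg)) ≤ (c * v - ηS) * (1 - f) := by
    have h5 : f * (c * v) ≤ c * (i+1) * (g * lg) := by
      have : f ≤ g := by rw [← hgf]; nlinarith
      calc f * (c * v) ≤ g * (c * lg) := by
            apply mul_le_mul this (mul_le_mul_of_nonneg_left hlt.le hc) (by positivity) hg0.le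
        _ ≤ (i+1) * (g * (c * lg)) := by
            have : 0 ≤ g * (c * lg) := by positivity
            have : (0:ℝ) ≤ i := by positivity
            nlinarith
        _ = _ := by ring
    have h6 : 0 ≤ f * ηS := by positivity
    nlinarith
  calc (c * v - (ηS + c * (i+1) * (g * lg))) * v ^ i ≤ ((c * v - ηS) * (1 - f)) * v ^ i := mul_le_mul_of_nonneg_right h4 hvi
    _ = _ := by ring

lemma low_case2 {f g lg a c v ηS X Y : ℝ} {i : ℕ} (h1f : 0 < 1 - f) (hf0 : 0 < f) (hg0 : 0 < g) (hgf : g * (1 - f) = f)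
    (ha : 0 < a) (hc : 0 ≤ c) (hηS : 0 ≤ ηS) (hlg : 0 < lg) (hge : lg ≤ v)
    (h1 : a * (c * v ^ (i+1) - ηS * v ^ i) ≤ X)
    (h2 : 1 / (1 - f) * a * (c * (v - lg) ^ (i+1) - (ηS + c * (i+1) * (g * lg)) * (v - lg) ^ i) ≤ Y) :
    1 / (1 - f) * a * (c * v ^ (i+1) - (ηS + c * (i+1) * (g * lg)) * v ^ i) ≤ X + f * Y := by
  have h3 := pow_sub_ge hlg.le hge i
  have h4 : (v - lg) ^ i ≤ v ^ i := pow_le_pow_left₀ (by linarith) (by linarith) i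
  have hη : 0 ≤ ηS + c * (i+1) * (g * lg) := by positivity
  have h5 : 1 / (1 - f) * a * (c * (v ^ (i+1) - (i+1) * lg * v ^ i) - (ηS + c * (i+1) * (g * lg)) * v ^ i) ≤ Y := by
    refine le_trans (mul_le_mul_of_nonneg_left ?_ (by positivity)) h2
    have := mul_le_mul_of_nonneg_left h3 hc
    have := mul_le_mul_of_nonneg_left h4 hη
    linarith
  have h6 := mul_le_mul_of_nonneg_left h5 hf0.le
  have hg : g = f / (1 - f) := by rw [eq_div_iff h1f.ne']; exact hgf
  have e : 1 / (1 - f) * a * (c * v ^ (i+1) - (ηS + c * (i+1) * (g * lg)) * v ^ i)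
      = a * (c * v ^ (i+1) - ηS * v ^ i) + f * (1 / (1 - f) * a * (c * (v ^ (i+1) - (i+1) * lg * v ^ i) - (ηS + c * (i+1) * (g * lg)) * v ^ i)) := by
    rw [hg]; field_simp; ring
  linarith

lemma AS_lower {k : ℕ} {y : ℝ} {ν : ℕ → ℕ} (hν : NuOK k y ν) {j i : ℕ} (hj : 1 ≤ j) (hi : 1 ≤ i) {L c η : ℝ} (hc : 0 ≤ c) (hη : 0 ≤ η)
    (h0 : ∀ v, 0 < v → v ≤ L → c * v ^ (i+1) - η * v ^ i ≤ SS (muf ν) j v)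
    (S : Finset ℕ) (hS : ∀ p ∈ S, p.Prime) : ∀ v, 0 ≤ v → v ≤ L →
    aS ν S * (c * v ^ (i+1) - (η + c * (i+1) * ∑ p ∈ S, gl ν p * Real.log p) * v ^ i) ≤ SS (AS ν S) j v := by
  induction S using Finset.induction_on with
  | empty =>
    intro v hv hvL
    rcases hv.lt_or_eq with h | h
    · simpa [AS_empty, aS] using h0 v h hvL
    · rw [← h, SS_zero _ hj]
      have : i ≠ 0 := by omega
      simp [this]
  | insert p S hpS ih =>
    have hp := hS p (mem_insert_self _ _)
    have hS' : ∀ r ∈ S, r.Prime := fun r hr => hS r (mem_insert_of_mem hr)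
    have ha := aS_pos hν hS'
    have hf0 := hν.fl_pos hp
    have hf1 := hν.fl_lt_one hp
    have h1f : 0 < 1 - fl ν p := by linarith
    have hlg : 0 < Real.log p := Real.log_pos (by exact_mod_cast hp.one_lt)
    have ih' := ih hS'
    have hsum0 : 0 ≤ ∑ p ∈ S, gl ν p * Real.log p := sum_nonneg fun r hr =>
      mul_nonneg (hν.gl_pos (hS' r hr)).le (Real.log_natCast_nonneg r)
    rw [sum_insert hpS]
    have haS : aS ν (insert p S) = 1 / (1 - fl ν p) * aS ν S := aS_insert ν hpS
    rw [haS]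
    have hgf : gl ν p * (1 - fl ν p) = fl ν p := by unfold gl; field_simp
    have hg0 := hν.gl_pos hp
    have hηη : η + c * (i+1) * (gl ν p * Real.log p + ∑ p ∈ S, gl ν p * Real.log p)
      = (η + c * (i+1) * ∑ p ∈ S, gl ν p * Real.log p) + c * (i+1) * (gl ν p * Real.log p) := by ring
    have hηS0 : 0 ≤ η + c * (i+1) * ∑ p ∈ S, gl ν p * Real.log p := by positivity
    rw [hηη]
    generalize η + c * (i+1) * ∑ p ∈ S, gl ν p * Real.log p = ηS at *
    have key : ∀ n : ℕ, ∀ v, 0 ≤ v → v ≤ L → v < n * Real.log p →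
        1 / (1 - fl ν p) * aS ν S * (c * v ^ (i+1) - (ηS + c * (i+1) * (gl ν p * Real.log p)) * v ^ i) ≤ SS (AS ν (insert p S)) j v := by
      intro n
      induction n with
      | zero => intro v hv _ h; simp at h; linarith
      | succ n ihn =>
        intro v hv hvL hvn
        have h1 := ih' v hv hvL
        rw [AS_rec ν hp hS' hpS]
        rcases lt_or_ge v (Real.log p) with hlt | hge
        · rw [SS_neg (AS ν (insert p S)) j (by linarith : v - Real.log p < 0), mul_zero, add_zero]
          exact (low_case1 h1f hf0 hg0 hgf ha hc hηS0 hv hlg hlt).trans h1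
        · have h2 := ihn (v - Real.log p) (by linarith) (by linarith) (by push_cast at hvn; linarith)
          exact low_case2 h1f hf0 hg0 hgf ha hc hηS0 hlg hge h1 h2
    intro v hv hvL
    obtain ⟨n, hn⟩ := exists_nat_gt (v / Real.log p)
    exact key n v hv hvL (by rwa [div_lt_iff₀ hlg] at hn)

end PartT1

section PartT2

open Finset Filter Topology MeasureTheory

lemma growth_step {a b : ℕ → ℝ} (ha : ∀ n, 0 < n → 0 ≤ a n) (hlog : ∀ n, 0 < n → a n * Real.log n ≤ dconv a b n)
    {k C : ℝ} (hb : ∀ τ, 0 ≤ τ → SS b 0 τ ≤ k * τ + C) {j : ℕ} (hj : 2 ≤ j) {u : ℝ} (hu : 0 ≤ u) :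
    (u - C) * SS a j u ≤ (k + j + 1) * SS a (j+1) u := by
  obtain ⟨i, rfl⟩ : ∃ i, j = i + 1 := ⟨j - 1, by omega⟩
  have h1 := SS_mul a (i+1) u
  have h2 := SS_mono hlog (i+1) u
  have h3 := SS_dconv_upper a b (j := i) (by omega) hu ha (fun τ h0 _ => hb τ h0)
  push_cast at h1 ⊢
  nlinarith

lemma growth_bound (k : ℕ) {C : ℝ} (hC : 0 < C) (i : ℕ) (hi : 3 ≤ i) : ∃ D : ℝ, 0 < D ∧ ∀ a b : ℕ → ℝ,
    (∀ n, 0 < n → 0 ≤ a n) → (∀ n, 0 < n → a n ≤ n) → (∀ n, 0 < n → a n * Real.log n ≤ dconv a b n) →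
    (∀ τ, 0 ≤ τ → SS b 0 τ ≤ k * τ + C) → ∀ L : ℝ, C + 1 ≤ L → SS a i L ≤ D * L ^ (k + i) := by
  refine ⟨(∑ n ∈ Ioc 0 ⌊Real.exp (C+1)⌋₊, (n:ℝ) * ((C + 1 - Real.log n) ^ i / i.factorial)) + 1, ?_, ?_⟩
  · have : 0 ≤ ∑ n ∈ Ioc 0 ⌊Real.exp (C+1)⌋₊, (n:ℝ) * ((C + 1 - Real.log n) ^ i / i.factorial) :=
      sum_nonneg fun n hn => by
        have := (mem_floor_exp.1 hn).2
        have : 0 ≤ C + 1 - Real.log n := by linarith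
        positivity
    linarith
  intro a b ha han hlog hb L hL
  obtain ⟨j, rfl⟩ : ∃ j, i = j + 1 := ⟨i - 1, by omega⟩
  set G : ℝ → ℝ := fun u => SS a (j+1) u / (u - C) ^ (k + (j+1)) with hG
  have hder : ∀ u, C + 1 ≤ u → HasDerivAt G ((SS a j u * (u - C) ^ (k + (j+1)) - SS a (j+1) u * ((k + (j+1) : ℕ) * (u - C) ^ (k + (j+1) - 1) * 1)) / ((u - C) ^ (k + (j+1))) ^ 2) u := by
    intro u hu
    have h0 : 0 < u - C := by linarith
    exact (SS_hasDerivAt a (by omega) u).div ((((hasDerivAt_id u).sub_const C).pow (k + (j+1)))) (by positivity)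
  have hanti : AntitoneOn G (Set.Ici (C+1)) := by
    apply antitoneOn_of_deriv_nonpos (convex_Ici _)
    · intro u hu; exact (hder u hu).continuousAt.continuousWithinAt
    · intro u hu; rw [interior_Ici] at hu; exact (hder u (le_of_lt hu)).differentiableAt.differentiableWithinAt
    · intro u hu; rw [interior_Ici] at hu
      have hu' : C + 1 ≤ u := le_of_lt hu
      rw [(hder u hu').deriv]
      have h0 : 0 < u - C := by linarith
      apply div_nonpos_of_nonpos_of_nonneg _ (by positivity)
      have := growth_step ha hlog hb (j := j) (by omega) (u := u) (by linarith)
      have e : k + (j + 1) - 1 = k + j := by omega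
      rw [e]
      have e2 : (u - C) ^ (k + (j+1)) = (u - C) * (u - C) ^ (k + j) := by rw [← add_assoc, pow_succ]; ring
      rw [e2]
      push_cast
      have h1 : 0 < (u - C) ^ (k + j) := by positivity
      nlinarith
  have h := hanti (Set.mem_Ici.2 le_rfl) (Set.mem_Ici.2 hL) hL
  have h1 : G (C+1) = SS a (j+1) (C+1) := by simp [hG]
  have h2 : SS a (j+1) (C+1) ≤ ∑ n ∈ Ioc 0 ⌊Real.exp (C+1)⌋₊, (n:ℝ) * ((C + 1 - Real.log n) ^ (j+1) / (j+1).factorial) :=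
    SS_mono (b := fun n => (n:ℝ)) han (j+1) (C+1)
  have h0 : 0 < L - C := by linarith
  rw [h1] at h
  have h3 : SS a (j+1) L ≤ SS a (j+1) (C+1) * (L - C) ^ (k + (j+1)) := by
    rw [hG] at h; simp only at h
    rwa [div_le_iff₀ (by positivity)] at h
  have h4 : (L - C) ^ (k + (j+1)) ≤ L ^ (k + (j+1)) := pow_le_pow_left₀ h0.le (by linarith) _
  have h5 : 0 ≤ SS a (j+1) (C+1) := SS_nonneg ha _ _
  calc SS a (j+1) L ≤ _ := h3
    _ ≤ SS a (j+1) (C+1) * L ^ (k + (j+1)) := by gcongr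
    _ ≤ _ := by
      have : 0 ≤ L := by linarith
      gcongr; linarith

noncomputable def gm (ν : ℕ → ℕ) (q s : ℕ) : ℝ :=
  if Squarefree s ∧ ¬ q ∣ s then ∏ p ∈ s.primeFactors, gl ν p else 0

noncomputable def Gp (ν : ℕ → ℕ) (n : ℕ) : ℝ := if n.Prime then gl ν n * Real.log n else 0

section
variable {k : ℕ} {y : ℝ} {ν : ℕ → ℕ}

lemma gm_nonneg (h : NuOK k y ν) (q n : ℕ) : 0 ≤ gm ν q n := by
  unfold gm
  split_ifs
  · exact prod_nonneg fun p hp => (h.gl_pos (Nat.prime_of_mem_primeFactors hp)).le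
  · exact le_rfl

lemma gl_le_self (h : NuOK k y ν) {p : ℕ} (hp : p.Prime) : gl ν p ≤ p := by
  unfold gl
  have h1 := h.one_sub_ge hp
  have h2 := h.fl_lt_one hp
  have hp0 : (0:ℝ) < p := by exact_mod_cast hp.pos
  have h3 : 0 < 1 - fl ν p := by linarith
  rw [div_le_iff₀ h3]
  rw [div_le_iff₀ hp0] at h1
  linarith

lemma gm_le (h : NuOK k y ν) (q n : ℕ) : gm ν q n ≤ n := by
  unfold gm
  split_ifs with hs
  · calc ∏ p ∈ n.primeFactors, gl ν p ≤ ∏ p ∈ n.primeFactors, (p:ℝ) :=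
        Finset.prod_le_prod (fun p hp => (h.gl_pos (Nat.prime_of_mem_primeFactors hp)).le)
          fun p hp => gl_le_self h (Nat.prime_of_mem_primeFactors hp)
      _ = n := by rw [← Nat.cast_prod, Nat.prod_primeFactors_of_squarefree hs.1]
  · positivity

lemma Gp_nonneg (h : NuOK k y ν) (n : ℕ) : 0 ≤ Gp ν n := by
  unfold Gp
  split_ifs with hp
  · exact mul_nonneg (h.gl_pos hp).le (Real.log_natCast_nonneg n)
  · exact le_rfl

lemma log_sqf {n : ℕ} (hn : Squarefree n) : Real.log n = ∑ p ∈ n.primeFactors, Real.log p := by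
  conv_lhs => rw [← Nat.prod_primeFactors_of_squarefree hn]
  rw [Nat.cast_prod, Real.log_prod]
  intro p hp
  exact_mod_cast (Nat.prime_of_mem_primeFactors hp).ne_zero

lemma gm_log (h : NuOK k y ν) (q n : ℕ) (hn : 0 < n) : gm ν q n * Real.log n ≤ dconv (gm ν q) (Gp ν) n := by
  have hnn : ∀ x ∈ n.divisorsAntidiagonal, 0 ≤ gm ν q x.1 * Gp ν x.2 := fun x _ => mul_nonneg (gm_nonneg h q _) (Gp_nonneg h _)
  by_cases hs : Squarefree n ∧ ¬ q ∣ n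
  swap
  · unfold gm; rw [if_neg hs, zero_mul]; exact sum_nonneg hnn
  unfold dconv
  rw [Nat.sum_divisorsAntidiagonal' (fun a b => gm ν q a * Gp ν b)]
  have h1 : ∑ p ∈ n.primeFactors, gm ν q (n / p) * Gp ν p ≤ ∑ i ∈ n.divisors, gm ν q (n / i) * Gp ν i :=
    sum_le_sum_of_subset_of_nonneg (fun p hp => Nat.mem_divisors.2 ⟨Nat.dvd_of_mem_primeFactors hp, hn.ne'⟩)
      fun i _ _ => mul_nonneg (gm_nonneg h q _) (Gp_nonneg h _)
  refine le_trans (le_of_eq ?_) h1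
  rw [log_sqf hs.1, mul_sum]
  refine sum_congr rfl fun p hp => ?_
  have hpp := Nat.prime_of_mem_primeFactors hp
  obtain ⟨m, rfl⟩ := Nat.dvd_of_mem_primeFactors hp
  rw [Nat.mul_div_cancel_left _ hpp.pos]
  have hcop : p.Coprime m := (Nat.squarefree_mul_iff.1 hs.1).1
  have hms : Squarefree m := (Nat.squarefree_mul_iff.1 hs.1).2.2
  have hqm : ¬ q ∣ m := fun hd => hs.2 (hd.mul_left p)
  unfold gm Gp
  rw [if_pos hs, if_pos ⟨hms, hqm⟩, if_pos hpp, hcop.primeFactors_mul, prod_union hcop.disjoint_primeFactors, hpp.primeFactors]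
  simp; ring

end

lemma gm_step (k : ℕ) : ∃ C : ℝ, 0 < C ∧ ∀ (y : ℝ) (ν : ℕ → ℕ), NuOK k y ν → ∀ q j, 2 ≤ j → ∀ u : ℝ, 0 ≤ u →
    (u - C) * SS (gm ν q) j u ≤ (k + j + 1) * SS (gm ν q) (j+1) u := by
  obtain ⟨C, hC, h⟩ := sum_g_bound k
  exact ⟨C, hC, fun y ν hν q j hj u hu => growth_step (b := Gp ν) (fun n _ => gm_nonneg hν q n) (gm_log hν q) (h y ν hν) hj hu⟩

lemma gm_growth (k i : ℕ) (hi : 3 ≤ i) : ∃ C : ℝ, 0 < C ∧ ∀ (y : ℝ) (ν : ℕ → ℕ), NuOK k y ν → ∀ q, ∀ L : ℝ, C ≤ L →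
    SS (gm ν q) i L ≤ C * L ^ (k + i) := by
  obtain ⟨C, hC, h⟩ := sum_g_bound k
  obtain ⟨D, hD, h2⟩ := growth_bound k hC i hi
  refine ⟨max (C+1) D, by positivity, fun y ν hν q L hL => ?_⟩
  have h3 := h2 (gm ν q) (Gp ν) (fun n _ => gm_nonneg hν q n) (fun n _ => gm_le hν q n) (gm_log hν q) (h y ν hν) L ((le_max_left _ _).trans hL)
  have : 0 ≤ L := by linarith [le_max_left (C+1) D]
  exact h3.trans (by gcongr; exact le_max_right _ _)

lemma cmf_log (ν : ℕ → ℕ) (n : ℕ) (hn : 0 < n) :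
    cmf ν n * Real.log n = dconv (cmf ν) (fun m => ArithmeticFunction.vonMangoldt m * cmf ν m) n := by
  unfold dconv
  have : ∀ x ∈ n.divisorsAntidiagonal, cmf ν x.1 * (ArithmeticFunction.vonMangoldt x.2 * cmf ν x.2) = cmf ν n * ArithmeticFunction.vonMangoldt x.2 := by
    intro x hx
    obtain ⟨h1, h2⟩ := Nat.mem_divisorsAntidiagonal.1 hx
    rw [← h1, cmf_mul ν (by rintro h; simp [h] at h1; omega) (by rintro h; simp [h] at h1; omega)]; ring
  rw [sum_congr rfl this, ← mul_sum, Nat.sum_divisorsAntidiagonal' (fun _ b => ArithmeticFunction.vonMangoldt b), ArithmeticFunction.vonMangoldt_sum]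

lemma cmf_le_one {k : ℕ} {y : ℝ} {ν : ℕ → ℕ} (h : NuOK k y ν) (n : ℕ) : cmf ν n ≤ 1 := by
  unfold cmf
  apply Finset.prod_le_one
  · intro p hp; exact pow_nonneg (h.fl_pos (Nat.prime_of_mem_primeFactors (by simpa using hp))).le _
  · intro p hp
    have hp := Nat.prime_of_mem_primeFactors (n := n) (by simpa using hp)
    exact pow_le_one₀ (h.fl_pos hp).le (h.fl_lt_one hp).le

lemma cmf_psi_upper (k : ℕ) : ∃ C : ℝ, 0 < C ∧ ∀ (y : ℝ) (ν : ℕ → ℕ), NuOK k y ν → ∀ τ, 0 ≤ τ →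
    SS (fun m => ArithmeticFunction.vonMangoldt m * cmf ν m) 0 τ ≤ k * τ + C := by
  obtain ⟨C, hC, h⟩ := sum_g_bound k
  refine ⟨C, hC, fun y ν hν τ hτ => le_trans ?_ (h y ν hν τ hτ)⟩
  unfold SS
  simp only [pow_zero, Nat.factorial_zero, Nat.cast_one, div_one, mul_one]
  refine (sum_vonMangoldt_le _ (fun n => (hν.cmf_pos n).le) _).trans ?_
  rw [sum_filter]
  refine sum_le_sum fun p _ => ?_
  split_ifs with hp
  · rw [mul_comm (gl ν p)]
    refine mul_le_mul_of_nonneg_left ?_ (Real.log_natCast_nonneg p)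
    simp only [cmf_prime_pow ν hp]
    have h0 := hν.fl_pos hp
    have h1 := hν.fl_lt_one hp
    generalize ⌊Real.exp τ⌋₊ = X
    have : ∀ X : ℕ, ∑ i ∈ Icc 1 X, fl ν p ^ i = (fl ν p - fl ν p ^ (X+1)) / (1 - fl ν p) := by
      intro X
      have h2 : 0 < 1 - fl ν p := by linarith
      induction X with
      | zero => simp
      | succ X ih => rw [sum_Icc_succ_top (by omega), ih]; field_simp; ring
    rw [this]
    unfold gl
    have h2 : 0 < 1 - fl ν p := by linarith
    gcongr
    have : 0 < fl ν p ^ (X+1) := by positivity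
    linarith
  · exact le_rfl

lemma cmf_growth (k i : ℕ) (hi : 3 ≤ i) : ∃ C : ℝ, 0 < C ∧ ∀ (y : ℝ) (ν : ℕ → ℕ), NuOK k y ν → ∀ L : ℝ, C ≤ L →
    SS (cmf ν) i L ≤ C * L ^ (k + i) := by
  obtain ⟨C, hC, h⟩ := cmf_psi_upper k
  obtain ⟨D, hD, h2⟩ := growth_bound k hC i hi
  refine ⟨max (C+1) D, by positivity, fun y ν hν L hL => ?_⟩
  have h3 := h2 (cmf ν) _ (fun n _ => (hν.cmf_pos n).le) (fun n hn => (cmf_le_one hν n).trans (by exact_mod_cast hn)) (fun n hn => (cmf_log ν n hn).le) (h y ν hν) L ((le_max_left _ _).trans hL)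
  have : 0 ≤ L := by linarith [le_max_left (C+1) D]
  exact h3.trans (by gcongr; exact le_max_right _ _)

end PartT2

section PartT3

open Finset Filter Topology MeasureTheory

lemma eta_small (C B ε : ℝ) (hC : 0 < C) (hB : 1 ≤ B) (hε : 0 < ε) : ∃ L₀ : ℝ, 1 ≤ L₀ ∧ ∀ L, L₀ ≤ L →
    C * (1 + Real.log (B * L)) * (B * L) ^ (1/8:ℝ) * L ^ (1/2:ℝ) ≤ ε * L := by
  refine ⟨max 1 ((C * 9 * B ^ (1/4:ℝ) / ε) ^ (4:ℝ)), le_max_left _ _, fun L hL => ?_⟩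
  have hL1 : 1 ≤ L := (le_max_left _ _).trans hL
  have hL0 : 0 < L := by linarith
  have hB0 : 0 < B := by linarith
  have hBL : 1 ≤ B * L := by nlinarith
  have h1 : Real.log (B * L) ≤ (B * L) ^ (1/8:ℝ) / (1/8) := Real.log_le_rpow_div (by linarith) (by norm_num)
  have h2 : 1 ≤ (B * L) ^ (1/8:ℝ) := Real.one_le_rpow hBL (by norm_num)
  have h3 : (B * L) ^ (1/8:ℝ) * (B * L) ^ (1/8:ℝ) = (B * L) ^ (1/4:ℝ) := by
    rw [← Real.rpow_add (by linarith)]; norm_num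
  have h4 : (B * L) ^ (1/4:ℝ) = B ^ (1/4:ℝ) * L ^ (1/4:ℝ) := Real.mul_rpow hB0.le hL0.le
  have h5 : C * 9 * B ^ (1/4:ℝ) / ε ≤ L ^ (1/4:ℝ) := by
    have := Real.rpow_le_rpow (by positivity) ((le_max_right _ _).trans hL) (by norm_num : (0:ℝ) ≤ 1/4)
    rwa [← Real.rpow_mul (by positivity), show (4:ℝ) * (1/4) = 1 by norm_num, Real.rpow_one] at this
  rw [div_le_iff₀ hε] at h5
  have h6 : L ^ (1/4:ℝ) * (L ^ (1/4:ℝ) * L ^ (1/2:ℝ)) = L := by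
    rw [← Real.rpow_add hL0, ← Real.rpow_add hL0]; norm_num
  have h7 : 0 < L ^ (1/4:ℝ) * L ^ (1/2:ℝ) := by positivity
  calc C * (1 + Real.log (B * L)) * (B * L) ^ (1/8:ℝ) * L ^ (1/2:ℝ)
      ≤ C * (9 * (B * L) ^ (1/8:ℝ)) * (B * L) ^ (1/8:ℝ) * L ^ (1/2:ℝ) := by
        gcongr; linarith
    _ = (C * 9 * B ^ (1/4:ℝ)) * (L ^ (1/4:ℝ) * L ^ (1/2:ℝ)) := by
        rw [mul_assoc C, mul_assoc 9, h3, h4]; ring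
    _ ≤ (L ^ (1/4:ℝ) * ε) * (L ^ (1/4:ℝ) * L ^ (1/2:ℝ)) := by gcongr
    _ = ε * (L ^ (1/4:ℝ) * (L ^ (1/4:ℝ) * L ^ (1/2:ℝ))) := by ring
    _ = _ := by rw [h6]

lemma log_small (A ε : ℝ) (hε : 0 < ε) : ∃ L₀ : ℝ, 1 ≤ L₀ ∧ ∀ L, L₀ ≤ L → Real.log L + A ≤ ε * L := by
  have h1 : ∀ᶠ L : ℝ in atTop, Real.log L ≤ ε / 2 * L := by
    have := Real.isLittleO_log_id_atTop.bound (half_pos hε)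
    filter_upwards [this, eventually_ge_atTop 0] with L h h0
    simp only [id, Real.norm_eq_abs, abs_of_nonneg h0] at h
    exact (le_abs_self _).trans h
  have h2 : ∀ᶠ L : ℝ in atTop, A ≤ ε / 2 * L := by
    filter_upwards [eventually_ge_atTop (A / (ε/2))] with L h
    rw [div_le_iff₀ (by positivity)] at h; linarith
  obtain ⟨L₀, h⟩ := eventually_atTop.1 (h1.and h2)
  exact ⟨max 1 L₀, le_max_left _ _, fun L hL => by
    have := h L ((le_max_right _ _).trans hL); linarith [this.1, this.2]⟩

lemma muf_cmf (ν : ℕ → ℕ) (n : ℕ) (hn : 0 < n) : dconv (muf ν) (cmf ν) n = if n = 1 then 1 else 0 := by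
  unfold dconv
  have : ∀ x ∈ n.divisorsAntidiagonal, muf ν x.1 * cmf ν x.2 = cmf ν n * ((ArithmeticFunction.moebius x.1 : ℤ) : ℝ) := by
    intro x hx
    obtain ⟨h1, h2⟩ := Nat.mem_divisorsAntidiagonal.1 hx
    rw [← h1, cmf_mul ν (by rintro h; simp [h] at h1; omega) (by rintro h; simp [h] at h1; omega)]; unfold muf; ring
  rw [sum_congr rfl this, ← mul_sum, Nat.sum_divisorsAntidiagonal (fun a _ => ((ArithmeticFunction.moebius a : ℤ) : ℝ)), ← Int.cast_sum, ← ArithmeticFunction.coe_zeta_mul_apply, ArithmeticFunction.coe_zeta_mul_moebius, ArithmeticFunction.one_apply]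
  split_ifs with h
  · simp [h, cmf_one]
  · simp

lemma SS_pow_sum (a : ℕ → ℝ) (j : ℕ) (L : ℝ) :
    ∑ n ∈ Ioc 0 ⌊Real.exp L⌋₊, a n * (L - Real.log n) ^ j = j.factorial * SS a j L := by
  unfold SS
  rw [mul_sum]
  refine sum_congr rfl fun n _ => ?_
  have : (j.factorial : ℝ) ≠ 0 := by exact_mod_cast j.factorial_ne_zero
  field_simp

lemma cc_lower {k ℓ : ℕ} (hk : 4 ≤ k) (hℓ : 4 ≤ ℓ) {B : ℝ} (hB : 1 ≤ B) : ∃ c L₀ : ℝ, 0 < c ∧ 1 ≤ L₀ ∧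
    ∀ ν L, L₀ ≤ L → NuOK k (B * L) ν → c ≤ cc k ν L ℓ := by
  obtain ⟨C, hC, hmain⟩ := main_asymp hk
  obtain ⟨D, hD, hg⟩ := cmf_growth k ℓ (by omega)
  obtain ⟨D', hD', hg'⟩ := cmf_growth k (ℓ-1) (by omega)
  have hK : (0:ℝ) < (k+ℓ).factorial := by exact_mod_cast (k+ℓ).factorial_pos
  have hf : (0:ℝ) < ℓ.factorial := by exact_mod_cast ℓ.factorial_pos
  have hf' : (0:ℝ) < (ℓ-1).factorial := by exact_mod_cast (ℓ-1).factorial_pos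
  obtain ⟨L₁, hL₁, hη⟩ := eta_small C B (1 / (2 * (k+ℓ).factorial * ((ℓ-1).factorial * D'))) hC hB (by positivity)
  refine ⟨1 / (2 * (k+ℓ).factorial * (ℓ.factorial * D)), max L₁ (max D D'), by positivity, hL₁.trans (le_max_left _ _), fun ν L hL hν => ?_⟩
  have hLL₁ : L₁ ≤ L := (le_max_left _ _).trans hL
  have hLD : D ≤ L := ((le_max_left _ _).trans (le_max_right _ _)).trans hL
  have hLD' : D' ≤ L := ((le_max_right _ _).trans (le_max_right _ _)).trans hL
  have hL1 : 1 ≤ L := hL₁.trans hLL₁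
  have hL0 : 0 < L := by linarith
  have hη := hη L hLL₁
  obtain ⟨hm, -⟩ := hmain (B * L) ν L (by nlinarith) hν hL1
  have hη0 : 0 ≤ C * (1 + Real.log (B * L)) * (B * L) ^ (1/8:ℝ) * L ^ (1/2:ℝ) := by
    have : 0 ≤ Real.log (B * L) := Real.log_nonneg (by nlinarith)
    positivity
  generalize C * (1 + Real.log (B * L)) * (B * L) ^ (1/8:ℝ) * L ^ (1/2:ℝ) = η at *
  obtain ⟨i, rfl⟩ : ∃ i, ℓ = i + 1 := ⟨ℓ - 1, by omega⟩
  have hm := hm i (by omega)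
  simp only [Nat.add_sub_cancel] at *
  generalize cc k ν L (i+1) = c at *
  have h1 : SS (dconv (muf ν) (cmf ν)) (k+(i+1)) L = L ^ (k+(i+1)) / (k+(i+1)).factorial := by
    rw [SS_congr (muf_cmf ν)]
    unfold SS
    simp only [ite_mul, one_mul, zero_mul, sum_ite_eq']
    rw [if_pos (mem_floor_exp.2 ⟨one_pos, by simpa using hL0.le⟩)]
    simp
  have h2 : L ^ (k+(i+1)) / (k+(i+1)).factorial ≤ ∑ n ∈ Ioc 0 ⌊Real.exp L⌋₊, (max c 0 * (cmf ν n * (L - Real.log n) ^ (i+1)) + η * (cmf ν n * (L - Real.log n) ^ i)) := by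
    rw [← h1, SS_dconv]
    refine sum_le_sum fun n hn => ?_
    obtain ⟨hn0, hn⟩ := mem_floor_exp.1 hn
    have hv : 0 ≤ L - Real.log n := by linarith
    have hvL : L - Real.log n ≤ L := by linarith [Real.log_natCast_nonneg n]
    generalize L - Real.log n = v at *
    have : SS (muf ν) (k+(i+1)) v ≤ max c 0 * v ^ (i+1) + η * v ^ i := by
      rcases hv.lt_or_eq with h | h
      · have h3 := (abs_le.1 (hm v h hvL)).2
        have h4 : c * v ^ (i+1) ≤ max c 0 * v ^ (i+1) := by gcongr; exact le_max_left _ _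
        linarith
      · rw [← h, SS_zero _ (by omega)]
        positivity
    calc _ ≤ cmf ν n * (max c 0 * v ^ (i+1) + η * v ^ i) := mul_le_mul_of_nonneg_left this (hν.cmf_pos n).le
      _ = _ := by ring
  rw [sum_add_distrib, ← mul_sum, ← mul_sum, SS_pow_sum, SS_pow_sum] at h2
  have h3 := hg (B*L) ν hν L hLD
  have h4 := hg' (B*L) ν hν L hLD'
  have h5 : max c 0 * ((i+1).factorial * SS (cmf ν) (i+1) L) ≤ max c 0 * ((i+1).factorial * (D * L ^ (k+(i+1)))) := by gcongr
  have h6 : η * (i.factorial * SS (cmf ν) i L) ≤ 1 / (2 * (k+(i+1)).factorial * (i.factorial * D')) * L * (i.factorial * (D' * L ^ (k+i))) := by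
    gcongr
    exact mul_nonneg (by positivity) (SS_nonneg (fun n _ => (hν.cmf_pos n).le) _ _)
  have e : 1 / (2 * (k+(i+1)).factorial * (i.factorial * D')) * L * (i.factorial * (D' * L ^ (k+i))) = L ^ (k+(i+1)) / (k+(i+1)).factorial / 2 := by
    rw [← add_assoc, pow_succ]; field_simp
  rw [e] at h6
  have h7 : L ^ (k+(i+1)) / (k+(i+1)).factorial / 2 ≤ max c 0 * ((i+1).factorial * D) * L ^ (k+(i+1)) := by linarith
  have hP : 0 < L ^ (k+(i+1)) := by positivity
  have h8 : 1 / (2 * (k+(i+1)).factorial) ≤ max c 0 * ((i+1).factorial * D) := by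
    rw [← mul_le_mul_iff_left₀ hP]
    refine le_trans (le_of_eq ?_) h7
    field_simp
  have h9 : 1 / (2 * ((k+(i+1)).factorial:ℝ) * ((i+1).factorial * D)) ≤ max c 0 := by
    rw [← div_div, div_le_iff₀ (by positivity)]; exact h8
  have h10 : (0:ℝ) < 1 / (2 * (k+(i+1)).factorial * ((i+1).factorial * D)) := by positivity
  rcases le_total c 0 with h | h
  · rw [max_eq_right h] at h9; linarith
  · rwa [max_eq_left h] at h9

end PartT3

section PartT4

open Finset Filter Topology MeasureTheory

noncomputable def wS (ν : ℕ → ℕ) (q s : ℕ) : ℝ :=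
  if Squarefree s ∧ ¬ q ∣ s then ∏ p ∈ s.primeFactors, fl ν p * (1 - fl ν p) else 0

noncomputable def Qd (ν : ℕ → ℕ) (q K : ℕ) (L : ℝ) : ℝ :=
  ∑ s ∈ Ioc 0 ⌊Real.exp L⌋₊, wS ν q s * (SS (AS ν (insert q s.primeFactors)) K (L - Real.log s)) ^ 2

noncomputable def Qd' (ν : ℕ → ℕ) (q K : ℕ) (L : ℝ) : ℝ :=
  ∑ s ∈ Ioc 0 ⌊Real.exp L⌋₊, wS ν q s * (SS (AS ν (insert q s.primeFactors)) K (L - Real.log s)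
    - SS (AS ν (insert q s.primeFactors)) K (L - Real.log s - Real.log q)) ^ 2

lemma wS_nonneg {k : ℕ} {y : ℝ} {ν : ℕ → ℕ} (hν : NuOK k y ν) (q s : ℕ) : 0 ≤ wS ν q s := by
  unfold wS
  split_ifs
  · refine prod_nonneg fun p hp => ?_
    have hp := Nat.prime_of_mem_primeFactors hp
    exact mul_nonneg (hν.fl_pos hp).le (by linarith [hν.fl_lt_one hp])
  · exact le_rfl

lemma wS_aS {k : ℕ} {y : ℝ} {ν : ℕ → ℕ} (hν : NuOK k y ν) {q s : ℕ} (hq : q.Prime) :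
    wS ν q s * (aS ν (insert q s.primeFactors)) ^ 2 = (1 / (1 - fl ν q)) ^ 2 * gm ν q s := by
  unfold wS gm
  split_ifs with h
  · rw [aS_insert ν (fun hm => h.2 (Nat.dvd_of_mem_primeFactors hm)), mul_pow]
    unfold aS
    rw [← prod_pow, mul_left_comm, ← prod_mul_distrib]
    congr 1
    refine prod_congr rfl fun p hp => ?_
    have hp := Nat.prime_of_mem_primeFactors hp
    have : 0 < 1 - fl ν p := by linarith [hν.fl_lt_one hp]
    unfold gl
    field_simp
  · simp

lemma sq_lower {a c η v A : ℝ} {r : ℕ} (ha : 0 < a) (hc : 0 ≤ c) (hη : 0 ≤ η) (hv : 0 ≤ v)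
    (h : a * (c * v ^ (r+2) - η * v ^ (r+1)) ≤ A) :
    a ^ 2 * (c ^ 2 * v ^ (2*r+4) - 2 * c * η * v ^ (2*r+3)) ≤ A ^ 2 := by
  have e : c ^ 2 * v ^ (2*r+4) - 2 * c * η * v ^ (2*r+3) = (c * v ^ (r+2)) * (c * v ^ (r+2)) - 2 * (c * v ^ (r+2)) * (η * v ^ (r+1)) := by ring
  rw [e]
  have h1 : 0 ≤ c * v ^ (r+2) := by positivity
  have h2 : 0 ≤ η * v ^ (r+1) := by positivity
  generalize c * v ^ (r+2) = x at *
  generalize η * v ^ (r+1) = z at *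
  rcases le_total z x with hzx | hzx
  · have h3 : 0 ≤ a * (x - z) := mul_nonneg ha.le (by linarith)
    have h4 := pow_le_pow_left₀ h3 h 2
    refine le_trans ?_ h4
    rw [mul_pow]
    refine mul_le_mul_of_nonneg_left ?_ (by positivity)
    nlinarith [sq_nonneg z]
  · have : x * x - 2 * x * z ≤ 0 := by nlinarith
    nlinarith [sq_nonneg a, sq_nonneg A]

lemma sq_upper {a lg M η v D : ℝ} {r : ℕ}
    (h : |D| ≤ lg * (a * (M * v ^ (r+1) + η * v ^ r))) :
    D ^ 2 ≤ lg ^ 2 * (a ^ 2 * (1.01 * M ^ 2 * v ^ (2*r+2) + 101 * η ^ 2 * v ^ (2*r))) := by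
  have h1 : D ^ 2 ≤ (lg * (a * (M * v ^ (r+1) + η * v ^ r))) ^ 2 := by
    rw [← sq_abs D]; exact pow_le_pow_left₀ (abs_nonneg _) h 2
  refine h1.trans ?_
  have e : 1.01 * M ^ 2 * v ^ (2*r+2) + 101 * η ^ 2 * v ^ (2*r) = 1.01 * (M * v ^ (r+1)) ^ 2 + 101 * (η * v ^ r) ^ 2 := by ring
  rw [e, mul_pow, mul_pow]
  refine mul_le_mul_of_nonneg_left (mul_le_mul_of_nonneg_left ?_ (by positivity)) (by positivity)
  nlinarith [sq_nonneg (M * v ^ (r+1) - 100 * (η * v ^ r))]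

lemma Qd_lower {k r : ℕ} {y : ℝ} {ν : ℕ → ℕ} (hν : NuOK k y ν) {q : ℕ} (hq : q.Prime) {L c η : ℝ} (hL : 1 ≤ L) (hqL : Real.log q ≤ L)
    (hc : 0 ≤ c) (hη : 0 ≤ η) (h0 : ∀ v, 0 < v → v ≤ L → c * v ^ (r+2) - η * v ^ (r+1) ≤ SS (muf ν) (k+(r+2)) v) :
    (1 / (1 - fl ν q)) ^ 2 * (c ^ 2 * ((2*r+4).factorial * SS (gm ν q) (2*r+4) L)
      - 2 * c * (η + c * (r+2) * (2 * k ^ 2 * (Real.log L + 10))) * ((2*r+3).factorial * SS (gm ν q) (2*r+3) L)) ≤ Qd ν q (k+(r+2)) L := by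
  rw [← SS_pow_sum, ← SS_pow_sum, mul_sum, mul_sum, ← sum_sub_distrib, mul_sum]
  unfold Qd
  refine sum_le_sum fun s hs => ?_
  obtain ⟨hs0, hs⟩ := mem_floor_exp.1 hs
  have hv : 0 ≤ L - Real.log s := by linarith
  have hvL : L - Real.log s ≤ L := by linarith [Real.log_natCast_nonneg s]
  have hS : ∀ p ∈ insert q s.primeFactors, p.Prime := by
    intro p hp
    rcases mem_insert.1 hp with rfl | hp
    · exact hq
    · exact Nat.prime_of_mem_primeFactors hp
  have h1 := AS_lower hν (by omega) (by omega) hc hη h0 _ hS _ hv hvL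
  have hT : ∑ p ∈ insert q s.primeFactors, gl ν p * Real.log p ≤ 2 * k ^ 2 * (Real.log L + 10) := by
    have e : insert q s.primeFactors = (q * s).primeFactors := by
      rw [Nat.primeFactors_mul hq.ne_zero hs0.ne', hq.primeFactors]; rfl
    rw [e]
    refine (sum_g_dvd_bound hν (mul_ne_zero hq.ne_zero hs0.ne') hL).trans ?_
    refine mul_le_mul_of_nonneg_left ?_ (by positivity)
    have : Real.log ((q * s : ℕ) : ℝ) / L ≤ 2 := by
      rw [div_le_iff₀ (by linarith), Nat.cast_mul, Real.log_mul (by exact_mod_cast hq.ne_zero) (by exact_mod_cast hs0.ne')]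
      linarith
    linarith
  have ha := aS_pos hν hS
  have h2 : aS ν (insert q s.primeFactors) * (c * (L - Real.log s) ^ (r+2) - (η + c * (r+2) * (2 * k ^ 2 * (Real.log L + 10))) * (L - Real.log s) ^ (r+1))
      ≤ SS (AS ν (insert q s.primeFactors)) (k+(r+2)) (L - Real.log s) := by
    refine le_trans (mul_le_mul_of_nonneg_left ?_ ha.le) h1
    have : (η + c * (((r+1:ℕ):ℝ)+1) * ∑ p ∈ insert q s.primeFactors, gl ν p * Real.log p) ≤ η + c * (r+2) * (2 * k ^ 2 * (Real.log L + 10)) := by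
      have e : ((r+1:ℕ):ℝ)+1 = r+2 := by push_cast; ring
      rw [e]
      gcongr
    have := mul_le_mul_of_nonneg_right this (pow_nonneg hv (r+1))
    linarith
  have hlL := Real.log_nonneg hL
  have h3 := sq_lower ha hc (by positivity) hv h2
  calc _ = (1 / (1 - fl ν q)) ^ 2 * gm ν q s * (c ^ 2 * (L - Real.log s) ^ (2*r+4) - 2 * c * (η + c * (r+2) * (2 * k ^ 2 * (Real.log L + 10))) * (L - Real.log s) ^ (2*r+3)) := by ring
    _ = wS ν q s * (aS ν (insert q s.primeFactors) ^ 2 * (c ^ 2 * (L - Real.log s) ^ (2*r+4) - 2 * c * (η + c * (r+2) * (2 * k ^ 2 * (Real.log L + 10))) * (L - Real.log s) ^ (2*r+3))) := by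
      rw [← wS_aS hν hq]; ring
    _ ≤ _ := mul_le_mul_of_nonneg_left h3 (wS_nonneg hν q s)

lemma Qd_upper {k r : ℕ} {y : ℝ} {ν : ℕ → ℕ} (hν : NuOK k y ν) {q : ℕ} (hq : q.Prime) {L M η : ℝ}
    (hM : 0 ≤ M) (hη : 0 ≤ η) (hk : 1 ≤ k) (h0 : ∀ v, 0 < v → v ≤ L → |SS (muf ν) (k+(r+1)) v| ≤ M * v ^ (r+1) + η * v ^ r) :
    Qd' ν q (k+(r+2)) L ≤ (1 / (1 - fl ν q)) ^ 2 * (Real.log q) ^ 2 * (1.01 * M ^ 2 * ((2*r+2).factorial * SS (gm ν q) (2*r+2) L)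
      + 101 * η ^ 2 * ((2*r).factorial * SS (gm ν q) (2*r) L)) := by
  rw [← SS_pow_sum, ← SS_pow_sum, mul_sum, mul_sum, ← sum_add_distrib, mul_sum]
  unfold Qd'
  refine sum_le_sum fun s hs => ?_
  obtain ⟨hs0, hs⟩ := mem_floor_exp.1 hs
  have hv : 0 ≤ L - Real.log s := by linarith
  have hvL : L - Real.log s ≤ L := by linarith [Real.log_natCast_nonneg s]
  have hS : ∀ p ∈ insert q s.primeFactors, p.Prime := by
    intro p hp
    rcases mem_insert.1 hp with rfl | hp
    · exact hq
    · exact Nat.prime_of_mem_primeFactors hp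
  set U : ℝ → ℝ := fun v => M * (max v 0) ^ (r+1) + η * (max v 0) ^ r with hU
  have hU0 : ∀ v, 0 ≤ U v := fun v => by have := le_max_right v 0; simp only [hU]; positivity
  have hUm : Monotone U := fun a b hab => by
    simp only [hU]
    have := max_le_max_right 0 hab
    have := le_max_right a 0
    gcongr
  have h1 : ∀ v ≤ L, |SS (muf ν) (k+(r+1)) v| ≤ U v := by
    intro v hv
    rcases le_or_gt v 0 with h | h
    · rw [SS_nonpos _ (by omega) h, abs_zero]; exact hU0 v
    · simp only [hU, max_eq_left h.le]; exact h0 v h hv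
  have h2 := AS_abs hν hU0 hUm h1 _ hS
  have ha := aS_pos hν hS
  have hlq : 0 ≤ Real.log q := Real.log_natCast_nonneg q
  have h3 : |SS (AS ν (insert q s.primeFactors)) (k+(r+2)) (L - Real.log s)
    - SS (AS ν (insert q s.primeFactors)) (k+(r+2)) (L - Real.log s - Real.log q)| ≤
     Real.log q * (aS ν (insert q s.primeFactors) * (M * (L - Real.log s) ^ (r+1) + η * (L - Real.log s) ^ r)) := by
    have := SS_integral (AS ν (insert q s.primeFactors)) (j := k+(r+1)) (by omega) (L - Real.log s - Real.log q) (L - Real.log s)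
    rw [show k + (r+2) = k+(r+1)+1 by ring, ← this, ← Real.norm_eq_abs]
    have h4 := intervalIntegral.norm_integral_le_of_norm_le_const (a := L - Real.log s - Real.log q) (b := L - Real.log s) (f := fun w => SS (AS ν (insert q s.primeFactors)) (k+(r+1)) w)
      (C := aS ν (insert q s.primeFactors) * U (L - Real.log s)) (by
        intro x hx
        rw [Set.uIoc_of_le (by linarith)] at hx
        rw [Real.norm_eq_abs]
        refine (h2 x (hx.2.trans hvL)).trans ?_
        exact mul_le_mul_of_nonneg_left (hUm hx.2) ha.le)
    refine h4.trans (le_of_eq ?_)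
    simp only [hU, max_eq_left hv]
    rw [show L - Real.log s - (L - Real.log s - Real.log q) = Real.log q by ring, abs_of_nonneg hlq]
    ring
  have h5 := sq_upper h3
  refine (mul_le_mul_of_nonneg_left h5 (wS_nonneg hν q s)).trans (le_of_eq ?_)
  rw [show ∀ x : ℝ, wS ν q s * (Real.log q ^ 2 * (aS ν (insert q s.primeFactors) ^ 2 * x)) = wS ν q s * aS ν (insert q s.primeFactors) ^ 2 * (Real.log q ^ 2 * x) from fun x => by ring, wS_aS hν hq]
  ring

end PartT4

section PartT5

open Finset Filter Topology MeasureTheory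

set_option maxHeartbeats 1000000 in
lemma ratio_alg {k r L C lg a c M η η' P0 P1 P2 P3 P4 Q Q' : ℝ} (hk : 1 ≤ k) (hr : 11 ≤ r) (hL : 1 ≤ L)
    (hkr : k + 2 * r + 4 ≤ 1.005 * k) (hCL : C ≤ L / 1000) (hc : 0 < c)
    (hM0 : 0 ≤ M) (hM : M ≤ (r + 2) * c + η / L) (hη0 : 0 ≤ η) (hη : η ≤ c * L / (1000 * k)) (hη' : η' ≤ c * L / (1000 * k))
    (p0 : 0 ≤ P0) (p1 : 0 ≤ P1) (p2 : 0 ≤ P2) (p3 : 0 ≤ P3)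
    (s3 : (L - C) * ((2*r+4) * P3) ≤ (k + 2 * r + 4) * P4)
    (s2 : (L - C) * ((2*r+3) * P2) ≤ (k + 2 * r + 3) * P3)
    (s1 : (L - C) * ((2*r+2) * P1) ≤ (k + 2 * r + 2) * P2)
    (s0 : (L - C) * ((2*r+1) * P0) ≤ (k + 2 * r + 1) * P1)
    (hQ : a ^ 2 * (c ^ 2 * P4 - 2 * c * η' * P3) ≤ Q)
    (hQ' : Q' ≤ a ^ 2 * lg ^ 2 * (1.01 * M ^ 2 * P2 + 101 * η ^ 2 * P0)) :
    Q' ≤ 0.3 * k ^ 2 * (lg / L) ^ 2 * Q ∧ a ^ 2 * (0.99 * c ^ 2 * P4) ≤ Q := by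
  have hL0 : 0 < L := by linarith
  have hk0 : 0 < k := by linarith
  have hLC : 0.999 * L ≤ L - C := by linarith
  have gen : ∀ {x z b P P' : ℝ}, 0 ≤ P → 0 ≤ b → 0 ≤ P' → x ≤ 1.005 * k → (L - C) * (b * P) ≤ x * P' → L * (b * P) ≤ 1.0061 * k * P' := by
    intro x z b P P' hP hb hP' hx h
    have h1 : 0.999 * L * (b * P) ≤ (L - C) * (b * P) := mul_le_mul_of_nonneg_right hLC (by positivity)
    have h2 : x * P' ≤ 1.005 * k * P' := mul_le_mul_of_nonneg_right hx hP'
    have h3 : 0 ≤ k * P' := by positivity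
    linarith
  have p4 : 0 ≤ P4 := by
    have h1 : 0 ≤ (L - C) * ((2*r+4) * P3) := mul_nonneg (by linarith) (by positivity)
    have : 0 < k + 2 * r + 4 := by linarith
    by_contra h
    push Not at h
    have h2 := mul_neg_of_pos_of_neg this h
    linarith
  have t3 := gen (z := 0) p3 (by linarith) p4 hkr s3
  have t2 := gen (z := 0) p2 (by linarith) p3 (by linarith) s2
  have t1 := gen (z := 0) p1 (by linarith) p2 (by linarith) s1
  have t0 := gen (z := 0) p0 (by linarith) p1 (by linarith) s0
  clear gen s3 s2 s1 s0
  have drop : ∀ b P : ℝ, 1 ≤ b → 0 ≤ P → L * P ≤ L * (b * P) := fun b P hb hP =>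
    mul_le_mul_of_nonneg_left (le_mul_of_one_le_left hP hb) hL0.le
  have hlow : 0.997 * c ^ 2 * P4 ≤ c ^ 2 * P4 - 2 * c * η' * P3 := by
    have h1 : η' * P3 ≤ c * L / (1000 * k) * P3 := mul_le_mul_of_nonneg_right hη' p3
    have h2 : L * P3 ≤ 1.0061 * k * P4 := by
      exact (drop _ _ (by linarith) p3).trans t3
    have h3 : c * L / (1000 * k) * P3 = c / (1000 * k) * (L * P3) := by ring
    have h4 : c / (1000 * k) * (L * P3) ≤ c / (1000 * k) * (1.0061 * k * P4) := mul_le_mul_of_nonneg_left h2 (by positivity)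
    have h5 : c / (1000 * k) * (1.0061 * k * P4) = c * 0.0010061 * P4 := by field_simp; ring
    have h6 : η' * P3 ≤ c * 0.0010061 * P4 := by linarith
    have h7 := mul_le_mul_of_nonneg_left h6 (by positivity : 0 ≤ 2 * c)
    have h8 : 0 ≤ c ^ 2 * P4 := by positivity
    linarith
  have hQl : a ^ 2 * (0.997 * c ^ 2 * P4) ≤ Q := (mul_le_mul_of_nonneg_left hlow (sq_nonneg a)).trans hQ
  have u1 : L * P1 ≤ 1.0061 * k * P2 := by
    exact (drop _ _ (by linarith) p1).trans t1
  have u0 : L * P0 ≤ 1.0061 * k * P1 := by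
    exact (drop _ _ (by linarith) p0).trans t0
  have hη2 : η ^ 2 * P0 ≤ 0.0000011 * c ^ 2 * P2 := by
    have h1 : η ^ 2 ≤ (c * L / (1000 * k)) ^ 2 := pow_le_pow_left₀ hη0 hη 2
    calc η ^ 2 * P0 ≤ (c * L / (1000 * k)) ^ 2 * P0 := mul_le_mul_of_nonneg_right h1 p0
      _ = (c / (1000 * k)) ^ 2 * L * (L * P0) := by ring
      _ ≤ (c / (1000 * k)) ^ 2 * L * (1.0061 * k * P1) := mul_le_mul_of_nonneg_left u0 (by positivity)
      _ = (c / (1000 * k)) ^ 2 * (1.0061 * k) * (L * P1) := by ring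
      _ ≤ (c / (1000 * k)) ^ 2 * (1.0061 * k) * (1.0061 * k * P2) := mul_le_mul_of_nonneg_left u1 (by positivity)
      _ = (1.0061 ^ 2 / 1000000) * (c ^ 2 * P2) := by field_simp; ring
      _ ≤ _ := by
        have : 0 ≤ c ^ 2 * P2 := by positivity
        norm_num; linarith
  have hηL : η / L ≤ 0.001 * c := by
    rw [div_le_iff₀ hL0]
    refine hη.trans ?_
    rw [div_le_iff₀ (by positivity)]
    have : 0 ≤ c * L := by positivity
    nlinarith only [this, hk]
  have hM2 : M ^ 2 ≤ ((r + 2.001) * c) ^ 2 := pow_le_pow_left₀ hM0 (by linarith) 2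
  have hup : 1.01 * M ^ 2 * P2 + 101 * η ^ 2 * P0 ≤ c ^ 2 * P2 * (1.01 * (r+2.001)^2 + 0.0002) := by
    have := mul_le_mul_of_nonneg_right hM2 p2
    have h0 : 0 ≤ c ^ 2 * P2 := by positivity
    linarith
  have hP24 : L ^ 2 * P2 * ((2*r+3) * (2*r+4)) ≤ 1.0125 * k ^ 2 * P4 := by
    calc L ^ 2 * P2 * ((2*r+3) * (2*r+4)) = (L * (2*r+4)) * (L * ((2*r+3) * P2)) := by ring
      _ ≤ (L * (2*r+4)) * (1.0061 * k * P3) := mul_le_mul_of_nonneg_left t2 (by positivity)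
      _ = 1.0061 * k * (L * ((2*r+4) * P3)) := by ring
      _ ≤ 1.0061 * k * (1.0061 * k * P4) := mul_le_mul_of_nonneg_left t3 (by positivity)
      _ ≤ _ := by
        have : 0 ≤ k ^ 2 * P4 := by positivity
        linarith
  have hX : 1.01 * (r+2.001)^2 + 0.0002 ≤ 0.2954 * ((2*r+3) * (2*r+4)) := by nlinarith only [hr]
  have hfin : L ^ 2 * P2 * (1.01 * (r+2.001)^2 + 0.0002) ≤ 0.3 * k ^ 2 * (0.997 * P4) := by
    have h1 := mul_le_mul_of_nonneg_left hX (by positivity : 0 ≤ L ^ 2 * P2)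
    have : 0 ≤ k ^ 2 * P4 := by positivity
    linarith
  constructor
  · calc Q' ≤ _ := hQ'
      _ ≤ a ^ 2 * lg ^ 2 * (c ^ 2 * P2 * (1.01 * (r+2.001)^2 + 0.0002)) := mul_le_mul_of_nonneg_left hup (by positivity)
      _ = a ^ 2 * (lg / L) ^ 2 * c ^ 2 * (L ^ 2 * P2 * (1.01 * (r+2.001)^2 + 0.0002)) := by field_simp
      _ ≤ a ^ 2 * (lg / L) ^ 2 * c ^ 2 * (0.3 * k ^ 2 * (0.997 * P4)) := mul_le_mul_of_nonneg_left hfin (by positivity)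
      _ = 0.3 * k ^ 2 * (lg / L) ^ 2 * (a ^ 2 * (0.997 * c ^ 2 * P4)) := by ring
      _ ≤ _ := mul_le_mul_of_nonneg_left hQl (by positivity)
  · refine le_trans (mul_le_mul_of_nonneg_left ?_ (sq_nonneg a)) hQl
    have : 0 ≤ c ^ 2 * P4 := by positivity
    linarith

theorem ratio_main {k ℓ : ℕ} (hk : 4 ≤ k) (hℓ : 13 ≤ ℓ) (hkl : (k:ℝ) + 2 * ℓ ≤ 1.005 * k) {B : ℝ} (hB : 1 ≤ B) :
    ∃ c L₀ : ℝ, 0 < c ∧ 1 ≤ L₀ ∧ ∀ ν L, L₀ ≤ L → NuOK k (B * L) ν → ∀ q : ℕ, q.Prime → Real.log q ≤ L →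
      Qd' ν q (k+ℓ) L ≤ 0.3 * (k:ℝ) ^ 2 * (Real.log q / L) ^ 2 * Qd ν q (k+ℓ) L ∧ c ≤ Qd ν q (k+ℓ) L := by
  obtain ⟨r, rfl⟩ : ∃ r, ℓ = r + 2 := ⟨ℓ - 2, by omega⟩
  obtain ⟨c₀, L₁, hc₀, hL₁, hcc⟩ := cc_lower hk (by omega : 4 ≤ r + 2) hB
  obtain ⟨C, hC, hmain⟩ := main_asymp hk
  obtain ⟨Cg, hCg, hstep⟩ := gm_step k
  have hk0 : (0:ℝ) < k := by exact_mod_cast (by omega : 0 < k)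
  obtain ⟨L₂, hL₂, hη⟩ := eta_small C B (c₀ / (2000 * k)) hC hB (by positivity)
  obtain ⟨L₃, hL₃, hlog⟩ := log_small 10 (1 / (2000 * k * ((r + 2) * (2 * k ^ 2)))) (by positivity)
  refine ⟨0.99 * c₀ ^ 2, max (max L₁ L₂) (max L₃ (1000 * Cg)), by positivity, hL₁.trans ((le_max_left _ _).trans (le_max_left _ _)), ?_⟩
  intro ν L hL hν q hq hqL
  have hLL1 : L₁ ≤ L := ((le_max_left _ _).trans (le_max_left _ _)).trans hL
  have hLL2 : L₂ ≤ L := ((le_max_right _ _).trans (le_max_left _ _)).trans hL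
  have hLL3 : L₃ ≤ L := ((le_max_left _ _).trans (le_max_right _ _)).trans hL
  have hLL4 : 1000 * Cg ≤ L := ((le_max_right _ _).trans (le_max_right _ _)).trans hL
  have hL1 : 1 ≤ L := hL₁.trans hLL1
  have hL0 : 0 < L := by linarith
  have hη := hη L hLL2
  have hlog := hlog L hLL3
  have hc := hcc ν L hLL1 hν
  obtain ⟨hm, hm2⟩ := hmain (B * L) ν L (by nlinarith) hν hL1
  have hη0 : 0 ≤ C * (1 + Real.log (B * L)) * (B * L) ^ (1/8:ℝ) * L ^ (1/2:ℝ) := by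
    have : 0 ≤ Real.log (B * L) := Real.log_nonneg (by nlinarith)
    positivity
  generalize C * (1 + Real.log (B * L)) * (B * L) ^ (1/8:ℝ) * L ^ (1/2:ℝ) = η at *
  have hma := hm (r+1) (by omega)
  have hmb := hm r (by omega)
  have hmc := hm2 (r+1) (by omega)
  have hcpos : 0 < cc k ν L (r+2) := by linarith
  have hlow := Qd_lower (r := r) hν hq hL1 hqL hcpos.le hη0 (fun v hv hvL => by
    have := (abs_le.1 (hma v hv hvL)).1
    linarith)
  have hup := Qd_upper (r := r) (M := |cc k ν L (r+1)|) hν hq (abs_nonneg _) hη0 (by omega) (fun v hv hvL => by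
    have h1 := hmb v hv hvL
    have h2 := abs_sub_abs_le_abs_sub (SS (muf ν) (k+(r+1)) v) (cc k ν L (r+1) * v ^ (r+1))
    rw [abs_mul, abs_of_nonneg (by positivity : 0 ≤ v ^ (r+1))] at h2
    linarith)
  have hstep' := hstep (B*L) ν hν q
  have nn : ∀ j, 0 ≤ SS (gm ν q) j L := fun j => SS_nonneg (fun n _ => gm_nonneg hν q n) _ _
  have hPs : ∀ j, 2 ≤ j → (L - Cg) * ((j+1) * (j.factorial * SS (gm ν q) j L)) ≤ (k + j + 1) * ((j+1).factorial * SS (gm ν q) (j+1) L) := by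
    intro j hj
    have := mul_le_mul_of_nonneg_left (hstep' j hj L hL0.le) (by positivity : (0:ℝ) ≤ (j+1) * j.factorial)
    rw [Nat.factorial_succ]; push_cast
    calc _ = (j + 1) * j.factorial * ((L - Cg) * SS (gm ν q) j L) := by ring
      _ ≤ _ := this
      _ = _ := by ring
  have s3 := hPs (2*r+3) (by omega)
  have s2 := hPs (2*r+2) (by omega)
  have s1 := hPs (2*r+1) (by omega)
  have s0 := hPs (2*r) (by omega)
  have hMle : |cc k ν L (r+1)| ≤ (r + 2) * cc k ν L (r+2) + η / L := by
    have h2 := abs_sub_abs_le_abs_sub (cc k ν L (r+1)) (((r+1:ℕ)+1) * cc k ν L (r+1+1))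
    have h3 : |((r+1:ℕ)+1:ℝ) * cc k ν L (r+1+1)| = (r+2) * cc k ν L (r+2) := by
      rw [show r + 1 + 1 = r + 2 by ring, abs_of_pos (by positivity)]; push_cast; ring
    rw [h3] at h2
    linarith
  have hηc : η ≤ cc k ν L (r+2) * L / (2000 * k) := by
    refine hη.trans ?_
    rw [div_mul_eq_mul_div]
    gcongr
  have hη2 : η ≤ cc k ν L (r+2) * L / (1000 * k) := by
    refine hηc.trans ?_
    gcongr
    norm_num
  have hη3 : η + cc k ν L (r+2) * (r+2) * (2 * k ^ 2 * (Real.log L + 10)) ≤ cc k ν L (r+2) * L / (1000 * k) := by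
    have h1 : cc k ν L (r+2) * (r+2) * (2 * k ^ 2 * (Real.log L + 10)) ≤ cc k ν L (r+2) * (r+2) * (2 * k ^ 2 * (1 / (2000 * k * ((r + 2) * (2 * k ^ 2))) * L)) := by
      gcongr
    have h2 : cc k ν L (r+2) * (r+2) * (2 * k ^ 2 * (1 / (2000 * k * ((r + 2) * (2 * k ^ 2))) * L)) = cc k ν L (r+2) * L / (2000 * k) := by
      field_simp
    have h3 : cc k ν L (r+2) * L / (1000 * k) = cc k ν L (r+2) * L / (2000 * k) + cc k ν L (r+2) * L / (2000 * k) := by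
      field_simp; norm_num
    linarith
  push_cast at hkl s3 s2 s1 s0
  have hr : (11:ℝ) ≤ r := by exact_mod_cast (by omega : 11 ≤ r)
  obtain ⟨h1, h2⟩ := ratio_alg (k := k) (r := r) (L := L) (C := Cg) (lg := Real.log q) (a := 1 / (1 - fl ν q)) (c := cc k ν L (r+2))
    (M := |cc k ν L (r+1)|) (η := η) (η' := η + cc k ν L (r+2) * (r+2) * (2 * k ^ 2 * (Real.log L + 10)))
    (P0 := (2*r).factorial * SS (gm ν q) (2*r) L) (P1 := (2*r+1).factorial * SS (gm ν q) (2*r+1) L)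
    (P2 := (2*r+2).factorial * SS (gm ν q) (2*r+2) L) (P3 := (2*r+3).factorial * SS (gm ν q) (2*r+3) L)
    (P4 := (2*r+4).factorial * SS (gm ν q) (2*r+4) L) (by linarith) hr hL1 (by linarith) (by linarith) hcpos (abs_nonneg _) hMle hη0 hη2 hη3
    (mul_nonneg (by positivity) (nn _)) (mul_nonneg (by positivity) (nn _)) (mul_nonneg (by positivity) (nn _)) (mul_nonneg (by positivity) (nn _))
    (by convert s3 using 2 <;> ring) (by convert s2 using 2 <;> ring) (by convert s1 using 2 <;> ring) (by convert s0 using 2) hlow hup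
  refine ⟨h1, le_trans ?_ h2⟩
  have hfq : 1 ≤ 1 / (1 - fl ν q) := by
    rw [one_le_div (by linarith [hν.fl_lt_one hq])]
    linarith [hν.fl_pos hq]
  have hP4 : 1 ≤ (2*r+4).factorial * SS (gm ν q) (2*r+4) L := by
    rw [← SS_pow_sum]
    have hmem : 1 ∈ Ioc 0 ⌊Real.exp L⌋₊ := mem_floor_exp.2 ⟨one_pos, by simpa using hL0.le⟩
    refine le_trans ?_ (single_le_sum (f := fun n => gm ν q n * (L - Real.log n) ^ (2*r+4)) (fun n hn => ?_) hmem)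
    · have : gm ν q 1 = 1 := by
        unfold gm
        rw [if_pos ⟨squarefree_one, hq.one_lt.ne' ∘ Nat.dvd_one.1⟩]; simp
      simp only [this, Nat.cast_one, Real.log_one, sub_zero, one_mul]
      exact one_le_pow₀ hL1
    · have := (mem_floor_exp.1 hn).2
      exact mul_nonneg (gm_nonneg hν q n) (pow_nonneg (by linarith) _)
  calc 0.99 * c₀ ^ 2 ≤ 1 ^ 2 * (0.99 * cc k ν L (r+2) ^ 2 * 1) := by
        rw [one_pow, one_mul, mul_one]; gcongr
    _ ≤ _ := by gcongr

end PartT5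

section PartU1

open Finset Filter Topology MeasureTheory

noncomputable def Wf (ν : ℕ → ℕ) (q s : ℕ) : ℝ :=
  if Squarefree s ∧ ¬ q ∣ s then ∏ p ∈ s.primeFactors, (1 / fl ν p - 1) else 0

lemma inv_cmf_eq {k : ℕ} {y : ℝ} {ν : ℕ → ℕ} (hν : NuOK k y ν) {q g X : ℕ} (hg : Squarefree g) (hgX : g ≤ X) (hq : ¬ q ∣ g) :
    1 / cmf ν g = ∑ s ∈ Ioc 0 X, if s ∣ g then Wf ν q s else 0 := by
  have h1 := (ArithmeticFunction.IsMultiplicative.prodPrimeFactors (fun p => 1 / fl ν p - 1)).prodPrimeFactors_one_add_of_squarefree hg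
  have h2 : 1 / cmf ν g = ∏ p ∈ g.primeFactors, (1 + (ArithmeticFunction.prodPrimeFactors (fun p => 1 / fl ν p - 1)) p) := by
    rw [cmf_sqf ν hg, one_div, ← prod_inv_distrib]
    refine prod_congr rfl fun p hp => ?_
    have hp := Nat.prime_of_mem_primeFactors hp
    rw [ArithmeticFunction.prodPrimeFactors_apply hp.ne_zero, hp.primeFactors]; simp
  rw [h2, h1, ← sum_filter]
  have h3 : g.divisors = (Ioc 0 X).filter (· ∣ g) := by
    ext s
    rw [Nat.mem_divisors, mem_filter, mem_Ioc]
    constructor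
    · rintro ⟨h, h0⟩
      have := Nat.le_of_dvd (Nat.pos_of_ne_zero h0) h
      exact ⟨⟨Nat.pos_of_dvd_of_pos h (Nat.pos_of_ne_zero h0), this.trans hgX⟩, h⟩
    · rintro ⟨_, h⟩; exact ⟨h, hg.ne_zero⟩
  rw [h3]
  refine sum_congr rfl fun s hs => ?_
  obtain ⟨hs1, hs2⟩ := mem_filter.1 hs
  rw [ArithmeticFunction.prodPrimeFactors_apply (mem_Ioc.1 hs1).1.ne', Wf, if_pos ⟨hg.squarefree_of_dvd hs2, fun h => hq (h.trans hs2)⟩]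

lemma cmf_lcm {k : ℕ} {y : ℝ} {ν : ℕ → ℕ} (hν : NuOK k y ν) {q d e X : ℕ} (hd0 : 0 < d) (he0 : 0 < e) (hdX : d ≤ X) (hq : ¬ q ∣ d) :
    (ArithmeticFunction.moebius d : ℝ) * (ArithmeticFunction.moebius e : ℝ) * cmf ν (Nat.lcm d e)
      = muf ν d * muf ν e * ∑ s ∈ Ioc 0 X, if s ∣ d ∧ s ∣ e then Wf ν q s else 0 := by
  by_cases hd : Squarefree d
  · have hg : Squarefree (Nat.gcd d e) := hd.squarefree_of_dvd (Nat.gcd_dvd_left d e)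
    have h1 := inv_cmf_eq hν hg ((Nat.gcd_le_left e hd0).trans hdX) (fun h => hq (h.trans (Nat.gcd_dvd_left d e)))
    simp only [Nat.dvd_gcd_iff] at h1
    rw [← h1]
    have h2 := cmf_mul ν (Nat.gcd_pos_of_pos_left e hd0).ne' (Nat.lcm_pos hd0 he0).ne'
    rw [Nat.gcd_mul_lcm, cmf_mul ν hd0.ne' he0.ne'] at h2
    have h3 := hν.cmf_pos (Nat.gcd d e)
    unfold muf
    calc _ = (ArithmeticFunction.moebius d : ℝ) * (ArithmeticFunction.moebius e : ℝ) * (cmf ν (Nat.gcd d e) * cmf ν (Nat.lcm d e)) * (1 / cmf ν (Nat.gcd d e)) := by field_simp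
      _ = _ := by rw [← h2]; ring
  · simp [muf, ArithmeticFunction.moebius_eq_zero_of_not_squarefree hd]

lemma quad_form {k : ℕ} {y : ℝ} {ν : ℕ → ℕ} (hν : NuOK k y ν) (q X : ℕ) (G : ℕ → ℝ) :
    ∑ d ∈ (Ioc 0 X).filter (fun d => ¬ q ∣ d), ∑ e ∈ (Ioc 0 X).filter (fun d => ¬ q ∣ d),
      (ArithmeticFunction.moebius d : ℝ) * (ArithmeticFunction.moebius e : ℝ) * cmf ν (Nat.lcm d e) * (G d * G e)
    = ∑ s ∈ Ioc 0 X, Wf ν q s * (∑ d ∈ (Ioc 0 X).filter (fun d => ¬ q ∣ d), if s ∣ d then muf ν d * G d else 0) ^ 2 := by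
  have h1 : ∀ d ∈ (Ioc 0 X).filter (fun d => ¬ q ∣ d), ∀ e ∈ (Ioc 0 X).filter (fun d => ¬ q ∣ d),
      (ArithmeticFunction.moebius d : ℝ) * (ArithmeticFunction.moebius e : ℝ) * cmf ν (Nat.lcm d e) * (G d * G e)
      = ∑ s ∈ Ioc 0 X, Wf ν q s * ((if s ∣ d then muf ν d * G d else 0) * (if s ∣ e then muf ν e * G e else 0)) := by
    intro d hd e he
    rw [mem_filter, mem_Ioc] at hd he
    rw [cmf_lcm hν hd.1.1 he.1.1 hd.1.2 hd.2, mul_sum, sum_mul]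
    refine sum_congr rfl fun s _ => ?_
    by_cases h1 : s ∣ d <;> by_cases h2 : s ∣ e <;> simp [h1, h2]
    ring
  rw [sum_congr rfl fun d hd => sum_congr rfl fun e he => h1 d hd e he]
  have : ∀ d ∈ (Ioc 0 X).filter (fun d => ¬ q ∣ d), ∑ e ∈ (Ioc 0 X).filter (fun d => ¬ q ∣ d), ∑ s ∈ Ioc 0 X, Wf ν q s * ((if s ∣ d then muf ν d * G d else 0) * (if s ∣ e then muf ν e * G e else 0))
     = ∑ s ∈ Ioc 0 X, ∑ e ∈ (Ioc 0 X).filter (fun d => ¬ q ∣ d), Wf ν q s * ((if s ∣ d then muf ν d * G d else 0) * (if s ∣ e then muf ν e * G e else 0)) := fun d _ => sum_comm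
  rw [sum_congr rfl this, sum_comm]
  refine sum_congr rfl fun s _ => ?_
  rw [sq, sum_mul_sum, mul_sum]
  refine sum_congr rfl fun d _ => ?_
  rw [mul_sum]

lemma inner_dsum {k : ℕ} {y : ℝ} {ν : ℕ → ℕ} (hν : NuOK k y ν) {q s X K : ℕ} {L L' : ℝ} (hq : q.Prime) (hX : X = ⌊Real.exp L⌋₊) (hL : L' ≤ L)
    (hs : Squarefree s) (hqs : ¬ q ∣ s) :
    ∑ d ∈ (Ioc 0 X).filter (fun d => ¬ q ∣ d), (if s ∣ d then muf ν d * Fp K (L' - Real.log d) else 0)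
      = muf ν s * SS (AS ν (insert q s.primeFactors)) K (L' - Real.log s) := by
  have hs0 : 0 < s := Nat.pos_of_ne_zero hs.ne_zero
  have hls := Real.log_natCast_nonneg s
  rw [SS_eq _ _ (X := X) (by rw [hX]; exact Nat.floor_mono (Real.exp_le_exp.2 (by linarith))), mul_sum]
  rw [sum_filter]
  have h0 : ∀ m, m ∉ Ioc 0 X → 0 < m → ∀ n, 0 < n → Fp K (L' - Real.log (n * m : ℕ)) = 0 := by
    intro m hm hm0 n hn
    rw [hX, mem_floor_exp] at hm
    push Not at hm
    have := hm hm0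
    unfold Fp
    rw [if_neg]
    rw [Nat.cast_mul, Real.log_mul (by exact_mod_cast hn.ne') (by exact_mod_cast hm0.ne')]
    have := Real.log_natCast_nonneg n
    linarith
  symm
  -- reindex by multiplication by s
  have h1 : ∑ m ∈ Ioc 0 X, muf ν s * (AS ν (insert q s.primeFactors) m * Fp K (L' - Real.log s - Real.log m))
     = ∑ d ∈ (Ioc 0 X).image (s * ·), (if ¬ q ∣ d then (if s ∣ d then muf ν d * Fp K (L' - Real.log d) else 0) else 0) := by
    rw [sum_image (fun a _ b _ h => Nat.eq_of_mul_eq_mul_left hs0 h)]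
    refine sum_congr rfl fun m hm => ?_
    have hm0 : 0 < m := (mem_Ioc.1 hm).1
    rw [if_pos (dvd_mul_right s m)]
    have hlog : L' - Real.log (s * m : ℕ) = L' - Real.log s - Real.log m := by
      rw [Nat.cast_mul, Real.log_mul (by exact_mod_cast hs0.ne') (by exact_mod_cast hm0.ne')]; ring
    rw [hlog]
    by_cases hqm : q ∣ m
    · rw [if_neg (by simp [hqm.mul_left s])]
      unfold AS
      rw [if_neg (by simp [hqm])]; simp
    · rw [if_pos (by rw [hq.dvd_mul]; tauto)]
      by_cases hcop : s.Coprime m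
      · have h3 : AS ν (insert q s.primeFactors) m = muf ν m := by
          unfold AS
          rw [if_pos]
          intro p hp
          rcases mem_insert.1 hp with rfl | hp
          · exact hqm
          · intro hd
            exact Nat.Prime.not_coprime_iff_dvd.2 ⟨p, Nat.prime_of_mem_primeFactors hp, Nat.dvd_of_mem_primeFactors hp, hd⟩ hcop
        rw [h3]
        unfold muf
        rw [cmf_mul ν hs0.ne' hm0.ne', ArithmeticFunction.isMultiplicative_moebius.map_mul_of_coprime hcop]
        push_cast; ring
      · obtain ⟨p, hp, hps, hpm⟩ := Nat.Prime.not_coprime_iff_dvd.1 hcop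
        have h3 : AS ν (insert q s.primeFactors) m = 0 := by
          unfold AS
          rw [if_neg]
          push Not
          exact ⟨p, mem_insert_of_mem (Nat.mem_primeFactors.2 ⟨hp, hps, hs0.ne'⟩), hpm⟩
        have h4 : muf ν (s * m) = 0 := by
          unfold muf
          rw [ArithmeticFunction.moebius_eq_zero_of_not_squarefree]
          · simp
          · intro h
            have := h p (mul_dvd_mul hps hpm)
            exact hp.one_lt.ne' (Nat.isUnit_iff.1 this)
        rw [h3, h4]; simp
  rw [h1]
  -- compare index sets
  rw [← sum_subset (s₁ := ((Ioc 0 X).image (s * ·)).filter (· ∈ Ioc 0 X)) (filter_subset _ _)]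
  · refine sum_subset (fun d hd => (mem_filter.1 hd).2) fun d hd hd' => ?_
    by_cases hsd : s ∣ d
    · exfalso
      apply hd'
      obtain ⟨m, rfl⟩ := hsd
      refine mem_filter.2 ⟨mem_image.2 ⟨m, ?_, rfl⟩, hd⟩
      rw [mem_Ioc] at hd ⊢
      have : m ≤ s * m := Nat.le_mul_of_pos_left m hs0
      exact ⟨Nat.pos_of_mul_pos_left hd.1, by omega⟩
    · simp [hsd]
  · intro d hd hd'
    have hdX : d ∉ Ioc 0 X := fun h => hd' (mem_filter.2 ⟨hd, h⟩)
    obtain ⟨m, hm, rfl⟩ := mem_image.1 hd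
    have hm0 : 0 < m := (mem_Ioc.1 hm).1
    have := h0 (s * m) hdX (Nat.mul_pos hs0 hm0) 1 one_pos
    rw [one_mul] at this
    simp only [this]; simp

lemma Wf_muf {k : ℕ} {y : ℝ} {ν : ℕ → ℕ} (hν : NuOK k y ν) (q s : ℕ) : Wf ν q s * muf ν s ^ 2 = wS ν q s := by
  unfold Wf wS
  split_ifs with h
  · unfold muf
    have h1 : ((ArithmeticFunction.moebius s : ℤ) : ℝ) ^ 2 = 1 := by
      have := ArithmeticFunction.moebius_sq_eq_one_of_squarefree h.1
      exact_mod_cast this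
    rw [mul_pow, h1, one_mul, cmf_sqf ν h.1, ← prod_pow, ← prod_mul_distrib]
    refine prod_congr rfl fun p hp => ?_
    have := hν.fl_pos (Nat.prime_of_mem_primeFactors hp)
    field_simp
  · simp

/-- the two quadratic forms -/
noncomputable def QG (ν : ℕ → ℕ) (q X : ℕ) (G : ℕ → ℝ) : ℝ :=
  ∑ d ∈ (Ioc 0 X).filter (fun d => ¬ q ∣ d), ∑ e ∈ (Ioc 0 X).filter (fun d => ¬ q ∣ d),
      (ArithmeticFunction.moebius d : ℝ) * (ArithmeticFunction.moebius e : ℝ) * cmf ν (Nat.lcm d e) * (G d * G e)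

lemma QG_eq {k : ℕ} {y : ℝ} {ν : ℕ → ℕ} (hν : NuOK k y ν) {q K : ℕ} (hq : q.Prime) (L : ℝ) :
    QG ν q ⌊Real.exp L⌋₊ (fun d => Fp K (L - Real.log d)) = Qd ν q K L := by
  unfold QG Qd
  rw [quad_form hν]
  refine sum_congr rfl fun s hs => ?_
  by_cases h : Squarefree s ∧ ¬ q ∣ s
  · rw [inner_dsum hν hq rfl le_rfl h.1 h.2, mul_pow, ← mul_assoc, Wf_muf hν]
  · rw [Wf, wS, if_neg h, if_neg h]; simp

lemma QG_eq' {k : ℕ} {y : ℝ} {ν : ℕ → ℕ} (hν : NuOK k y ν) {q K : ℕ} (hq : q.Prime) (L : ℝ) :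
    QG ν q ⌊Real.exp L⌋₊ (fun d => Fp K (L - Real.log d) - Fp K (L - Real.log q - Real.log d)) = Qd' ν q K L := by
  unfold QG Qd'
  rw [quad_form hν]
  refine sum_congr rfl fun s hs => ?_
  by_cases h : Squarefree s ∧ ¬ q ∣ s
  · have h1 := inner_dsum hν (K := K) hq rfl (le_refl L) h.1 h.2
    have h2 := inner_dsum hν (K := K) (L := L) (L' := L - Real.log q) hq rfl (by linarith [Real.log_natCast_nonneg q]) h.1 h.2
    have h3 : ∀ d : ℕ, (if s ∣ d then muf ν d * (Fp K (L - Real.log d) - Fp K (L - Real.log q - Real.log d)) else 0)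
      = (if s ∣ d then muf ν d * Fp K (L - Real.log d) else 0) - (if s ∣ d then muf ν d * Fp K (L - Real.log q - Real.log d) else 0) := by
      intro d; split_ifs <;> ring
    simp only [h3]
    rw [sum_sub_distrib, h1, h2, ← mul_sub, mul_pow, ← mul_assoc, Wf_muf hν, sub_right_comm L]
  · rw [Wf, wS, if_neg h, if_neg h]; simp

end PartU1

section PartV1

open Finset Filter Topology MeasureTheory

lemma tuplePoly_modEq (H : Finset ℕ) {D m n : ℕ} (h : m ≡ n [MOD D]) : tuplePoly H m ≡ tuplePoly H n [MOD D] := by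
  unfold tuplePoly
  induction H using Finset.induction_on with
  | empty => simp; rfl
  | insert a s ha ih => rw [prod_insert ha, prod_insert ha]; exact (h.add_right a).mul ih

lemma dvd_tuple_congr (H : Finset ℕ) {D m n : ℕ} (h : m ≡ n [MOD D]) : D ∣ tuplePoly H m ↔ D ∣ tuplePoly H n :=
  (tuplePoly_modEq H h).dvd_iff dvd_rfl

lemma tuplePoly_pos (H : Finset ℕ) {n : ℕ} (hn : 0 < n) : 0 < tuplePoly H n :=
  Finset.prod_pos fun h _ => by omega

/-- number of solutions of `P(n) ≡ 0 (mod D)` -/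
def rho (H : Finset ℕ) (D : ℕ) : ℕ := ((range D).filter (fun n => D ∣ tuplePoly H n)).card

lemma rho_one (H : Finset ℕ) : rho H 1 = 1 := by simp [rho]

lemma rho_mul (H : Finset ℕ) {a b : ℕ} (hab : a.Coprime b) (ha : 0 < a) (hb : 0 < b) : rho H (a * b) = rho H a * rho H b := by
  unfold rho
  rw [← card_product]
  refine card_nbij' (fun n => (n % a, n % b)) (fun x => (Nat.chineseRemainder hab x.1 x.2 : ℕ)) ?_ ?_ ?_ ?_
  · intro n hn
    simp only [coe_filter, mem_range, Set.mem_setOf_eq] at hn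
    simp only [coe_product, Set.mem_prod, coe_filter, mem_range, Set.mem_setOf_eq]
    exact ⟨⟨Nat.mod_lt _ ha, (dvd_tuple_congr H (Nat.mod_modEq n a)).2 ((dvd_mul_right a b).trans hn.2)⟩,
      ⟨Nat.mod_lt _ hb, (dvd_tuple_congr H (Nat.mod_modEq n b)).2 ((dvd_mul_left b a).trans hn.2)⟩⟩
  · rintro ⟨x, z⟩ hx
    simp only [coe_product, Set.mem_prod, coe_filter, mem_range, Set.mem_setOf_eq] at hx ⊢
    have h1 := (Nat.chineseRemainder hab x z).2
    refine ⟨Nat.chineseRemainder_lt_mul hab x z ha.ne' hb.ne', ?_⟩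
    exact hab.mul_dvd_of_dvd_of_dvd ((dvd_tuple_congr H h1.1).2 hx.1.2) ((dvd_tuple_congr H h1.2).2 hx.2.2)
  · intro n hn
    simp only [coe_filter, mem_range, Set.mem_setOf_eq] at hn
    have h1 := (Nat.chineseRemainder hab (n % a) (n % b)).2
    have h2 : (Nat.chineseRemainder hab (n % a) (n % b) : ℕ) ≡ n [MOD a * b] :=
      (Nat.modEq_and_modEq_iff_modEq_mul hab).1 ⟨h1.1.trans (Nat.mod_modEq n a), h1.2.trans (Nat.mod_modEq n b)⟩
    exact Nat.ModEq.eq_of_lt_of_lt h2 (Nat.chineseRemainder_lt_mul hab _ _ ha.ne' hb.ne') hn.1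
  · rintro ⟨x, z⟩ hx
    simp only [coe_product, Set.mem_prod, coe_filter, mem_range, Set.mem_setOf_eq] at hx
    have h1 := (Nat.chineseRemainder hab x z).2
    ext
    · exact (Nat.mod_eq_of_modEq h1.1 hx.1.1)
    · exact (Nat.mod_eq_of_modEq h1.2 hx.2.1)

lemma rho_prime (H : Finset ℕ) {p : ℕ} (hp : p.Prime) : rho H p = nuP p H := by
  unfold rho nuP
  refine card_nbij' (fun n => (p - n) % p) (fun n => (p - n) % p) ?_ ?_ ?_ ?_
  · intro n hn
    simp only [coe_filter, mem_range, Set.mem_setOf_eq] at hn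
    obtain ⟨hn, hd⟩ := hn
    unfold tuplePoly at hd
    rw [Prime.dvd_finset_prod_iff hp.prime] at hd
    obtain ⟨h, hh, hd⟩ := hd
    simp only [coe_image, Set.mem_image, mem_coe]
    refine ⟨h, hh, ?_⟩
    have : h ≡ p - n [MOD p] := by
      apply Nat.ModEq.add_left_cancel' n
      rw [Nat.add_sub_cancel' hn.le]
      exact (Nat.modEq_zero_iff_dvd.2 hd).trans (Nat.modEq_zero_iff_dvd.2 dvd_rfl).symm
    exact this
  · intro m hm
    simp only [coe_image, Set.mem_image, mem_coe] at hm
    obtain ⟨h, hh, rfl⟩ := hm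
    simp only [coe_filter, mem_range, Set.mem_setOf_eq]
    refine ⟨Nat.mod_lt _ hp.pos, ?_⟩
    unfold tuplePoly
    rw [Prime.dvd_finset_prod_iff hp.prime]
    refine ⟨h, hh, ?_⟩
    rw [← Nat.modEq_zero_iff_dvd]
    have h1 : (p - h % p) % p + h ≡ (p - h % p) + h % p [MOD p] := (Nat.mod_modEq _ _).add (Nat.mod_modEq _ _).symm
    rw [Nat.sub_add_cancel (Nat.mod_lt _ hp.pos).le] at h1
    exact h1.trans (Nat.modEq_zero_iff_dvd.2 dvd_rfl)
  · intro n hn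
    simp only [coe_filter, mem_range, Set.mem_setOf_eq] at hn
    rcases Nat.eq_zero_or_pos n with rfl | h0
    · simp
    · simp only [Nat.mod_eq_of_lt (by omega : p - n < p)]
      rw [show p - (p - n) = n by omega, Nat.mod_eq_of_lt hn.1]
  · intro m hm
    simp only [coe_image, Set.mem_image, mem_coe] at hm
    obtain ⟨h, hh, rfl⟩ := hm
    have hlt := Nat.mod_lt h hp.pos
    generalize h % p = n at *
    rcases Nat.eq_zero_or_pos n with rfl | h0
    · simp
    · simp only [Nat.mod_eq_of_lt (by omega : p - n < p)]
      rw [show p - (p - n) = n by omega, Nat.mod_eq_of_lt hlt]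

lemma rho_sqf (H : Finset ℕ) {D : ℕ} (hD : Squarefree D) : (rho H D : ℝ) = D * cmf (fun p => nuP p H) D := by
  induction D using Nat.recOnPosPrimePosCoprime with
  | zero => simp at hD
  | one => simp [rho_one, cmf_one]
  | prime_pow p n hp hn =>
    have : n = 1 := by
      by_contra h
      have h2 : 2 ≤ n := by omega
      have := hD p (by rw [← sq]; exact pow_dvd_pow p h2)
      exact hp.one_lt.ne' (Nat.isUnit_iff.1 this)
    subst this
    rw [pow_one, rho_prime H hp, cmf_prime _ hp, fl]
    have : (p:ℝ) ≠ 0 := by exact_mod_cast hp.ne_zero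
    field_simp
  | coprime a b ha hb hab iha ihb =>
    obtain ⟨_, h1, h2⟩ := Nat.squarefree_mul_iff.1 hD
    rw [rho_mul H hab (by omega) (by omega), cmf_mul _ (by omega) (by omega)]
    push_cast
    rw [iha h1, ihb h2]; ring

lemma count_periodic (H : Finset ℕ) {D : ℕ} (hD : 0 < D) (a : ℕ) :
    ((Ico a (a + D)).filter (fun n => D ∣ tuplePoly H n)).card = rho H D := by
  rw [Nat.filter_Ico_card_eq_of_periodic a D _ (by
    intro n; exact propext (dvd_tuple_congr H (by simp [Nat.ModEq]))), Nat.count_eq_card_filter_range]; rfl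

lemma count_bound (H : Finset ℕ) {D : ℕ} (hD : 0 < D) (M : ℕ) : ∀ a : ℕ,
    |(((Ico a (a + M)).filter (fun n => D ∣ tuplePoly H n)).card : ℝ) - M * (rho H D / D)| ≤ rho H D := by
  have hD0 : (0:ℝ) < D := by exact_mod_cast hD
  induction M using Nat.strong_induction_on with
  | _ M ih =>
    intro a
    rcases lt_or_ge M D with h | h
    · have h1 : ((Ico a (a + M)).filter (fun n => D ∣ tuplePoly H n)).card ≤ rho H D := by
        rw [← count_periodic H hD a]
        exact card_le_card (filter_subset_filter _ (Ico_subset_Ico_right (by omega)))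
      have h1' : (((Ico a (a + M)).filter (fun n => D ∣ tuplePoly H n)).card : ℝ) ≤ rho H D := by exact_mod_cast h1
      have h2 : (M:ℝ) * (rho H D / D) ≤ rho H D := by
        rw [← mul_div_assoc, div_le_iff₀ hD0, mul_comm]
        gcongr
      have h3 : 0 ≤ (M:ℝ) * (rho H D / D) := by positivity
      have h4 : (0:ℝ) ≤ (((Ico a (a + M)).filter (fun n => D ∣ tuplePoly H n)).card : ℝ) := by positivity
      rw [abs_le]; constructor <;> linarith
    · have h1 := ih (M - D) (by omega) (a + D)
      rw [show a + D + (M - D) = a + M by omega] at h1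
      have h2 : ((Ico a (a + M)).filter (fun n => D ∣ tuplePoly H n)).card = rho H D + ((Ico (a+D) (a + M)).filter (fun n => D ∣ tuplePoly H n)).card := by
        rw [← count_periodic H hD a, ← card_union_of_disjoint, ← filter_union, Ico_union_Ico_eq_Ico (by omega) (by omega)]
        exact disjoint_filter_filter (Ico_disjoint_Ico_consecutive _ _ _)
      rw [h2]
      rw [Nat.cast_sub h] at h1
      push_cast
      convert h1 using 2
      field_simp
      ring

lemma count_main (H : Finset ℕ) {D : ℕ} (hD : Squarefree D) (N : ℕ) :
    |(((Ioc N (2*N)).filter (fun n => D ∣ tuplePoly H n)).card : ℝ) - N * cmf (fun p => nuP p H) D| ≤ D * cmf (fun p => nuP p H) D := by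
  have h0 : 0 < D := Nat.pos_of_ne_zero hD.ne_zero
  have h := count_bound H h0 N (N+1)
  rw [rho_sqf H hD, mul_div_cancel_left₀ _ (by exact_mod_cast h0.ne' : (D:ℝ) ≠ 0)] at h
  have e : Ioc N (2*N) = Ico (N+1) (N+1+N) := by ext; simp; omega
  rwa [e]

lemma nuOK_of (H : Finset ℕ) {k : ℕ} {y h : ℝ} (hk : 1 ≤ k) (hH : H ⊆ Icc 1 ⌊h⌋₊) (hc : H.card = k) (ha : Admissible H) (hy : h ≤ y) :
    NuOK k y (fun p => nuP p H) where
  one_le p hp := by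
    have : H.Nonempty := card_pos.1 (by omega)
    exact card_pos.2 (this.image _)
  le_k p hp := by rw [← hc]; exact card_image_le
  lt p hp := ha p hp
  eq_k p hp hyp := by
    rw [← hc]
    refine card_image_of_injOn fun x hx z hz hxz => ?_
    have hlt : ∀ x ∈ H, x < p := by
      intro x hx
      obtain ⟨h1, h2⟩ := mem_Icc.1 (hH hx)
      have h3 : (x:ℝ) ≤ h := (Nat.le_floor_iff' (by omega)).1 h2
      exact_mod_cast (by linarith : (x:ℝ) < p)
    simp only [Nat.mod_eq_of_lt (hlt x hx), Nat.mod_eq_of_lt (hlt z hz)] at hxz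
    exact hxz

end PartV1

section PartV2

open Finset Filter Topology MeasureTheory

lemma lam_one (H : Finset ℕ) (ℓ : ℕ) (L : ℝ) {n : ℕ} (hn : 0 < n) :
    LambdaR (Real.exp L) n H ℓ = ∑ d ∈ (Ioc 0 ⌊Real.exp L⌋₊).filter (· ∣ tuplePoly H n),
      (ArithmeticFunction.moebius d : ℝ) * Fp (H.card + ℓ) (L - Real.log d) := by
  unfold LambdaR
  have hP := tuplePoly_pos H hn
  have e : (tuplePoly H n).divisors.filter (fun d : ℕ => (d : ℝ) ≤ Real.exp L)
      = (Ioc 0 ⌊Real.exp L⌋₊).filter (· ∣ tuplePoly H n) := by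
    ext d
    simp only [mem_filter, Nat.mem_divisors, mem_Ioc, Nat.le_floor_iff (Real.exp_nonneg L)]
    constructor
    · rintro ⟨⟨h1, h2⟩, h3⟩; exact ⟨⟨Nat.pos_of_dvd_of_pos h1 hP, h3⟩, h1⟩
    · rintro ⟨⟨h1, h2⟩, h3⟩; exact ⟨⟨h3, hP.ne'⟩, h2⟩
  rw [e, mul_sum]
  refine sum_congr rfl fun d hd => ?_
  obtain ⟨h1, h2⟩ := mem_floor_exp.1 (mem_filter.1 hd).1
  have h0 : (0:ℝ) < d := by exact_mod_cast h1
  rw [Real.log_div (Real.exp_pos L).ne' h0.ne', Real.log_exp, Fp, if_pos (by linarith)]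
  ring

lemma lam_ndvd (H : Finset ℕ) (ℓ : ℕ) (L : ℝ) {n q : ℕ} (hn : 0 < n) (hq : ¬ q ∣ tuplePoly H n) :
    LambdaR (Real.exp L) n H ℓ = ∑ d ∈ (Ioc 0 ⌊Real.exp L⌋₊).filter (fun d => ¬ q ∣ d),
      if d ∣ tuplePoly H n then (ArithmeticFunction.moebius d : ℝ) * Fp (H.card + ℓ) (L - Real.log d) else 0 := by
  rw [lam_one H ℓ L hn, ← sum_filter, filter_filter]
  refine sum_congr ?_ fun _ _ => rfl
  ext d
  simp only [mem_filter]
  constructor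
  · rintro ⟨h1, h2⟩; exact ⟨h1, fun h => hq (h.trans h2), h2⟩
  · rintro ⟨h1, h2, h3⟩; exact ⟨h1, h3⟩

lemma lam_dvd (H : Finset ℕ) (ℓ : ℕ) (L : ℝ) {n q : ℕ} (hn : 0 < n) (hqp : q.Prime) (hq : q ∣ tuplePoly H n) :
    LambdaR (Real.exp L) n H ℓ = ∑ d ∈ (Ioc 0 ⌊Real.exp L⌋₊).filter (fun d => ¬ q ∣ d),
      if d ∣ tuplePoly H n then (ArithmeticFunction.moebius d : ℝ) *
        (Fp (H.card + ℓ) (L - Real.log d) - Fp (H.card + ℓ) (L - Real.log q - Real.log d)) else 0 := by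
  rw [lam_one H ℓ L hn, ← sum_filter, filter_filter]
  simp only [mul_sub]
  rw [sum_sub_distrib, ← sum_filter_not_add_sum_filter _ (fun d => q ∣ d), filter_filter, filter_filter, sub_eq_add_neg]
  congr 1
  · refine sum_congr ?_ fun _ _ => rfl
    ext d; simp only [mem_filter]; tauto
  rw [← sum_neg_distrib]
  have hq0 : (0:ℝ) < q := by exact_mod_cast hqp.pos
  have e1 : ∑ d ∈ (Ioc 0 ⌊Real.exp L⌋₊).filter (fun d => d ∣ tuplePoly H n ∧ q ∣ d), (ArithmeticFunction.moebius d : ℝ) * Fp (H.card + ℓ) (L - Real.log d)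
      = ∑ d ∈ (Ioc 0 ⌊Real.exp L⌋₊).filter (fun d => d ∣ tuplePoly H n ∧ q ∣ d ∧ ¬ q * q ∣ d), (ArithmeticFunction.moebius d : ℝ) * Fp (H.card + ℓ) (L - Real.log d) := by
    symm
    refine sum_subset (fun d => by simp only [mem_filter]; tauto) fun d hd hd' => ?_
    simp only [mem_filter] at hd hd'
    have : q * q ∣ d := by tauto
    rw [ArithmeticFunction.moebius_eq_zero_of_not_squarefree]
    · simp
    · intro h; exact hqp.one_lt.ne' (Nat.isUnit_iff.1 (h q this))
  have e2 : ∑ d ∈ (Ioc 0 ⌊Real.exp L⌋₊).filter (fun d => ¬ q ∣ d ∧ d ∣ tuplePoly H n), -((ArithmeticFunction.moebius d : ℝ) * Fp (H.card + ℓ) (L - Real.log q - Real.log d))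
      = ∑ d ∈ (Ioc 0 ⌊Real.exp L⌋₊).filter (fun d => ¬ q ∣ d ∧ d ∣ tuplePoly H n ∧ q * d ≤ ⌊Real.exp L⌋₊), -((ArithmeticFunction.moebius d : ℝ) * Fp (H.card + ℓ) (L - Real.log q - Real.log d)) := by
    symm
    refine sum_subset (fun d => by simp only [mem_filter]; tauto) fun d hd hd' => ?_
    simp only [mem_filter, mem_Ioc] at hd hd'
    have h1 : ¬ q * d ≤ ⌊Real.exp L⌋₊ := by tauto
    have hd0 : (0:ℝ) < d := by exact_mod_cast hd.1.1
    have h2 : ¬ (q * d ∈ Ioc 0 ⌊Real.exp L⌋₊) := fun h => h1 (mem_Ioc.1 h).2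
    rw [mem_floor_exp] at h2
    have h3 : ¬ (0 ≤ L - Real.log q - Real.log d) := by
      intro h
      apply h2
      refine ⟨Nat.mul_pos hqp.pos hd.1.1, ?_⟩
      push_cast
      rw [Real.log_mul hq0.ne' hd0.ne']; linarith
    rw [Fp, if_neg h3]; simp
  rw [e1, e2]
  symm
  refine sum_nbij' (fun d => q * d) (fun d => d / q) ?_ ?_ ?_ ?_ ?_
  · intro d hd
    simp only [mem_filter, mem_Ioc] at hd ⊢
    obtain ⟨⟨h1, h2⟩, h3, h4, h5⟩ := hd
    refine ⟨⟨Nat.mul_pos hqp.pos h1, h5⟩, ?_, dvd_mul_right _ _, fun h => h3 (Nat.dvd_of_mul_dvd_mul_left hqp.pos h)⟩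
    exact ((hqp.coprime_iff_not_dvd).2 h3).mul_dvd_of_dvd_of_dvd hq h4
  · intro d hd
    simp only [mem_filter, mem_Ioc] at hd ⊢
    obtain ⟨⟨h1, h2⟩, h3, ⟨e, rfl⟩, h5⟩ := hd
    rw [Nat.mul_div_cancel_left _ hqp.pos]
    refine ⟨⟨Nat.pos_of_mul_pos_left h1, (Nat.le_mul_of_pos_left e hqp.pos).trans h2⟩, fun h => h5 (Nat.mul_dvd_mul_left q h), (dvd_mul_left _ _).trans h3, h2⟩
  · intro d hd; exact Nat.mul_div_cancel_left _ hqp.pos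
  · intro d hd
    simp only [mem_filter, mem_Ioc] at hd
    exact Nat.mul_div_cancel' hd.2.2.1
  · intro d hd
    simp only [mem_filter, mem_Ioc] at hd
    have hd0 : (0:ℝ) < d := by exact_mod_cast hd.1.1
    rw [ArithmeticFunction.isMultiplicative_moebius.map_mul_of_coprime ((hqp.coprime_iff_not_dvd).2 hd.2.1), ArithmeticFunction.moebius_apply_prime hqp]
    push_cast
    rw [Real.log_mul hq0.ne' hd0.ne', ← sub_sub]; ring

end PartV2

section PartV3

open Finset Filter Topology MeasureTheory

lemma one_le_mul_cmf {k : ℕ} {y : ℝ} {ν : ℕ → ℕ} (hν : NuOK k y ν) (n : ℕ) : n ≠ 0 → 1 ≤ (n:ℝ) * cmf ν n := by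
  induction n using induction_on_primes with
  | zero => intro h; exact absurd rfl h
  | one => intro _; simp [cmf_one]
  | prime_mul p a hp ih =>
    intro h
    have ha : a ≠ 0 := fun h0 => h (by simp [h0])
    have h1 := ih ha
    have hp0 : (0:ℝ) < p := by exact_mod_cast hp.pos
    have h2 : (1:ℝ) ≤ ν p := by exact_mod_cast hν.one_le p hp
    rw [cmf_mul ν hp.ne_zero ha, cmf_prime ν hp, fl]
    push_cast
    have : (p:ℝ) * a * (ν p / p * cmf ν a) = ν p * (a * cmf ν a) := by field_simp
    rw [this]; nlinarith

lemma lcm_cmf_le {k : ℕ} {y : ℝ} {ν : ℕ → ℕ} (hν : NuOK k y ν) {d e : ℕ} (hd : 0 < d) (he : 0 < e) :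
    (Nat.lcm d e : ℝ) * cmf ν (Nat.lcm d e) ≤ (d * cmf ν d) * (e * cmf ν e) := by
  have hg : Nat.gcd d e ≠ 0 := (Nat.gcd_pos_of_pos_left e hd).ne'
  have hl : Nat.lcm d e ≠ 0 := (Nat.lcm_pos hd he).ne'
  have h2 := cmf_mul ν hg hl
  rw [Nat.gcd_mul_lcm, cmf_mul ν hd.ne' he.ne'] at h2
  have h3 : ((Nat.gcd d e : ℕ) : ℝ) * (Nat.lcm d e : ℕ) = d * e := by exact_mod_cast Nat.gcd_mul_lcm d e
  have h4 := one_le_mul_cmf hν _ hg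
  have h5 : (d * cmf ν d) * (e * cmf ν e) = (Nat.gcd d e * cmf ν (Nat.gcd d e)) * (Nat.lcm d e * cmf ν (Nat.lcm d e)) := by
    calc (d * cmf ν d) * (e * cmf ν e) = (d * e) * (cmf ν d * cmf ν e) := by ring
      _ = _ := by rw [h2, ← h3]; ring
  rw [h5]
  exact le_mul_of_one_le_left (mul_nonneg (Nat.cast_nonneg _) (hν.cmf_pos _).le) h4

lemma sq_expand (S F : Finset ℕ) (a : ℕ → ℝ) (P : ℕ → ℕ) :
    ∑ n ∈ S, (∑ d ∈ F, if d ∣ P n then a d else 0) ^ 2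
      = ∑ d ∈ F, ∑ e ∈ F, a d * a e * ((S.filter (fun n => Nat.lcm d e ∣ P n)).card : ℝ) := by
  simp only [sq, sum_mul_sum]
  rw [sum_comm]
  refine sum_congr rfl fun d _ => ?_
  rw [sum_comm]
  refine sum_congr rfl fun e _ => ?_
  rw [card_filter]
  push_cast
  rw [mul_sum]
  refine sum_congr rfl fun n _ => ?_
  simp only [Nat.lcm_dvd_iff]
  by_cases h1 : d ∣ P n <;> by_cases h2 : e ∣ P n <;> simp [h1, h2]

lemma abs_moebius_le (d : ℕ) : |(ArithmeticFunction.moebius d : ℝ)| ≤ 1 := by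
  exact_mod_cast ArithmeticFunction.abs_moebius_le_one (n := d)

lemma bilin_err {k : ℕ} {y : ℝ} {ν : ℕ → ℕ} (hν : NuOK k y ν) (q X : ℕ) (G : ℕ → ℝ) (c : ℕ → ℕ → ℝ) (M E : ℝ) (hE : 0 ≤ E)
    (hc : ∀ d e : ℕ, Squarefree d → Squarefree e → ¬ q ∣ d → ¬ q ∣ e →
      |c d e - M * cmf ν (Nat.lcm d e)| ≤ E * (Nat.lcm d e * cmf ν (Nat.lcm d e))) :
    |∑ d ∈ (Ioc 0 X).filter (fun d => ¬ q ∣ d), ∑ e ∈ (Ioc 0 X).filter (fun d => ¬ q ∣ d),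
      ((ArithmeticFunction.moebius d : ℝ) * G d) * ((ArithmeticFunction.moebius e : ℝ) * G e) * c d e - M * QG ν q X G|
     ≤ E * (∑ d ∈ Ioc 0 X, |G d| * (d * cmf ν d)) ^ 2 := by
  have hsub : ∑ d ∈ (Ioc 0 X).filter (fun d => ¬ q ∣ d), |G d| * (d * cmf ν d) ≤ ∑ d ∈ Ioc 0 X, |G d| * (d * cmf ν d) :=
    sum_le_sum_of_subset_of_nonneg (filter_subset _ _) fun d _ _ =>
      mul_nonneg (abs_nonneg _) (mul_nonneg (Nat.cast_nonneg _) (hν.cmf_pos _).le)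
  have hnn : 0 ≤ ∑ d ∈ (Ioc 0 X).filter (fun d => ¬ q ∣ d), |G d| * (d * cmf ν d) :=
    sum_nonneg fun d _ => mul_nonneg (abs_nonneg _) (mul_nonneg (Nat.cast_nonneg _) (hν.cmf_pos _).le)
  refine le_trans ?_ (mul_le_mul_of_nonneg_left (pow_le_pow_left₀ hnn hsub 2) hE)
  rw [QG, mul_sum, ← sum_sub_distrib, sq, sum_mul_sum, mul_sum]
  refine (abs_sum_le_sum_abs _ _).trans (sum_le_sum fun d hd => ?_)
  rw [mul_sum, ← sum_sub_distrib, mul_sum]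
  refine (abs_sum_le_sum_abs _ _).trans (sum_le_sum fun e he => ?_)
  obtain ⟨hd1, hd2⟩ := mem_filter.1 hd
  obtain ⟨he1, he2⟩ := mem_filter.1 he
  have hd0 := (mem_Ioc.1 hd1).1
  have he0 := (mem_Ioc.1 he1).1
  have p1 := hν.cmf_pos d
  have p2 := hν.cmf_pos e
  have hR : 0 ≤ E * (|G d| * (d * cmf ν d) * (|G e| * (e * cmf ν e))) := by positivity
  by_cases hds : Squarefree d
  swap
  · rw [ArithmeticFunction.moebius_eq_zero_of_not_squarefree hds]; simpa using hR
  by_cases hes : Squarefree e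
  swap
  · rw [ArithmeticFunction.moebius_eq_zero_of_not_squarefree hes]; simpa using hR
  have h1 := hc d e hds hes hd2 he2
  have h2 := lcm_cmf_le hν hd0 he0
  have h3 : |c d e - M * cmf ν (Nat.lcm d e)| ≤ E * ((d * cmf ν d) * (e * cmf ν e)) := h1.trans (mul_le_mul_of_nonneg_left h2 hE)
  have e1 : ((ArithmeticFunction.moebius d : ℝ) * G d) * ((ArithmeticFunction.moebius e : ℝ) * G e) * c d e
      - M * ((ArithmeticFunction.moebius d : ℝ) * (ArithmeticFunction.moebius e : ℝ) * cmf ν (Nat.lcm d e) * (G d * G e))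
      = ((ArithmeticFunction.moebius d : ℝ) * (ArithmeticFunction.moebius e : ℝ)) * ((G d * G e) * (c d e - M * cmf ν (Nat.lcm d e))) := by ring
  rw [e1, abs_mul, abs_mul, abs_mul (G d * G e), abs_mul (G d)]
  have m1 := abs_moebius_le d
  have m2 := abs_moebius_le e
  have m3 : |(ArithmeticFunction.moebius d : ℝ)| * |(ArithmeticFunction.moebius e : ℝ)| ≤ 1 := mul_le_one₀ m1 (abs_nonneg _) m2
  calc _ ≤ 1 * (|G d| * |G e| * (E * ((d * cmf ν d) * (e * cmf ν e)))) := by gcongr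
    _ = _ := by ring

lemma lcm_sqf {d e : ℕ} (hd : Squarefree d) (he : Squarefree e) : Squarefree (Nat.lcm d e) := by
  rw [Nat.squarefree_iff_factorization_le_one (Nat.lcm_pos (Nat.pos_of_ne_zero hd.ne_zero) (Nat.pos_of_ne_zero he.ne_zero)).ne']
  intro p
  rw [Nat.factorization_lcm hd.ne_zero he.ne_zero]
  have h1 := (Nat.squarefree_iff_factorization_le_one hd.ne_zero).1 hd p
  have h2 := (Nat.squarefree_iff_factorization_le_one he.ne_zero).1 he p
  simp [h1, h2]

lemma q_lcm {q d e : ℕ} (hq : q.Prime) (h1 : ¬ q ∣ d) (h2 : ¬ q ∣ e) : q.Coprime (Nat.lcm d e) := by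
  rw [hq.coprime_iff_not_dvd]
  intro h
  have := h.trans (Nat.lcm_dvd_mul d e)
  rcases (hq.dvd_mul).1 this with h | h
  · exact h1 h
  · exact h2 h

lemma S_bound (H : Finset ℕ) {k : ℕ} {y : ℝ} (hν : NuOK k y (fun p => nuP p H)) (ℓ N : ℕ) (L : ℝ) {q : ℕ} (hq : q.Prime) (hk : H.card = k) :
    |∑ n ∈ (Ioc N (2*N)).filter (fun n => q ∣ tuplePoly H n), LambdaR (Real.exp L) n H ℓ ^ 2
      - N * fl (fun p => nuP p H) q * Qd' (fun p => nuP p H) q (k+ℓ) L|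
     ≤ k * (∑ d ∈ Ioc 0 ⌊Real.exp L⌋₊, |Fp (k+ℓ) (L - Real.log d) - Fp (k+ℓ) (L - Real.log q - Real.log d)| * (d * cmf (fun p => nuP p H) d)) ^ 2 := by
  have e1 : ∑ n ∈ (Ioc N (2*N)).filter (fun n => q ∣ tuplePoly H n), LambdaR (Real.exp L) n H ℓ ^ 2
    = ∑ n ∈ (Ioc N (2*N)).filter (fun n => q ∣ tuplePoly H n), (∑ d ∈ (Ioc 0 ⌊Real.exp L⌋₊).filter (fun d => ¬ q ∣ d),
      if d ∣ tuplePoly H n then (ArithmeticFunction.moebius d : ℝ) *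
        (Fp (k + ℓ) (L - Real.log d) - Fp (k + ℓ) (L - Real.log q - Real.log d)) else 0)^2 := by
    refine sum_congr rfl fun n hn => ?_
    obtain ⟨h1, h2⟩ := mem_filter.1 hn
    rw [lam_dvd H ℓ L (by have := (mem_Ioc.1 h1).1; omega) hq h2, hk]
  rw [e1, sq_expand, ← QG_eq' hν hq]
  refine bilin_err hν q _ _ _ _ _ (Nat.cast_nonneg k) ?_
  intro d e hd he hqd hqe
  have hcop := q_lcm hq hqd hqe
  have hs := lcm_sqf hd he
  have hqs : Squarefree (q * Nat.lcm d e) := (Nat.squarefree_mul hcop).2 ⟨hq.prime.squarefree, hs⟩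
  have h := count_main H hqs N
  have e2 : ((Ioc N (2*N)).filter (fun n => q ∣ tuplePoly H n)).filter (fun n => Nat.lcm d e ∣ tuplePoly H n)
      = (Ioc N (2*N)).filter (fun n => q * Nat.lcm d e ∣ tuplePoly H n) := by
    rw [filter_filter]
    refine filter_congr fun n _ => ?_
    constructor
    · rintro ⟨a, b⟩; exact hcop.mul_dvd_of_dvd_of_dvd a b
    · intro a; exact ⟨(dvd_mul_right _ _).trans a, (dvd_mul_left _ _).trans a⟩
  rw [e2]
  rw [cmf_mul _ hq.ne_zero hs.ne_zero, cmf_prime _ hq] at h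
  rw [mul_assoc]
  refine h.trans ?_
  have hp0 : (0:ℝ) < q := by exact_mod_cast hq.pos
  have h5 : (q:ℝ) * fl (fun p => nuP p H) q ≤ k := by
    have := hν.fl_le hq
    rw [le_div_iff₀ hp0] at this; linarith
  have := hν.cmf_pos (Nat.lcm d e)
  push_cast
  calc _ = ((q:ℝ) * fl (fun p => nuP p H) q) * (Nat.lcm d e * cmf (fun p => nuP p H) (Nat.lcm d e)) := by ring
    _ ≤ _ := by gcongr

lemma T_bound (H : Finset ℕ) {k : ℕ} {y : ℝ} (hν : NuOK k y (fun p => nuP p H)) (ℓ N : ℕ) (L : ℝ) {q : ℕ} (hq : q.Prime) (hk : H.card = k) :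
    |∑ n ∈ (Ioc N (2*N)).filter (fun n => ¬ q ∣ tuplePoly H n), LambdaR (Real.exp L) n H ℓ ^ 2
      - N * (1 - fl (fun p => nuP p H) q) * Qd (fun p => nuP p H) q (k+ℓ) L|
     ≤ (1 + k) * (∑ d ∈ Ioc 0 ⌊Real.exp L⌋₊, |Fp (k+ℓ) (L - Real.log d)| * (d * cmf (fun p => nuP p H) d)) ^ 2 := by
  have e1 : ∑ n ∈ (Ioc N (2*N)).filter (fun n => ¬ q ∣ tuplePoly H n), LambdaR (Real.exp L) n H ℓ ^ 2
    = ∑ n ∈ (Ioc N (2*N)).filter (fun n => ¬ q ∣ tuplePoly H n), (∑ d ∈ (Ioc 0 ⌊Real.exp L⌋₊).filter (fun d => ¬ q ∣ d),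
      if d ∣ tuplePoly H n then (ArithmeticFunction.moebius d : ℝ) *
        (Fp (k + ℓ) (L - Real.log d)) else 0)^2 := by
    refine sum_congr rfl fun n hn => ?_
    obtain ⟨h1, h2⟩ := mem_filter.1 hn
    rw [lam_ndvd H ℓ L (by have := (mem_Ioc.1 h1).1; omega) h2, hk]
  rw [e1, sq_expand, ← QG_eq hν hq]
  refine bilin_err hν q _ _ _ _ _ (by positivity) ?_
  intro d e hd he hqd hqe
  have hcop := q_lcm hq hqd hqe
  have hs := lcm_sqf hd he
  have hqs : Squarefree (q * Nat.lcm d e) := (Nat.squarefree_mul hcop).2 ⟨hq.prime.squarefree, hs⟩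
  have h := count_main H hqs N
  have h' := count_main H hs N
  have e2 : (((Ioc N (2*N)).filter (fun n => ¬ q ∣ tuplePoly H n)).filter (fun n => Nat.lcm d e ∣ tuplePoly H n)).card
      + ((Ioc N (2*N)).filter (fun n => q * Nat.lcm d e ∣ tuplePoly H n)).card = ((Ioc N (2*N)).filter (fun n => Nat.lcm d e ∣ tuplePoly H n)).card := by
    have h0 := card_filter_add_card_filter_not (s := (Ioc N (2*N)).filter (fun n => Nat.lcm d e ∣ tuplePoly H n)) (fun n => q ∣ tuplePoly H n)
    rw [← h0, add_comm, filter_comm, filter_filter, filter_filter]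
    congr 2
    refine filter_congr fun n _ => ?_
    constructor
    · intro a; exact ⟨(dvd_mul_left _ _).trans a, (dvd_mul_right _ _).trans a⟩
    · rintro ⟨b, a⟩; exact hcop.mul_dvd_of_dvd_of_dvd a b
  have e3 : ((((Ioc N (2*N)).filter (fun n => ¬ q ∣ tuplePoly H n)).filter (fun n => Nat.lcm d e ∣ tuplePoly H n)).card : ℝ)
      = ((Ioc N (2*N)).filter (fun n => Nat.lcm d e ∣ tuplePoly H n)).card - ((Ioc N (2*N)).filter (fun n => q * Nat.lcm d e ∣ tuplePoly H n)).card := by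
    rw [← e2]; push_cast; ring
  rw [e3]
  rw [cmf_mul _ hq.ne_zero hs.ne_zero, cmf_prime _ hq] at h
  have hp0 : (0:ℝ) < q := by exact_mod_cast hq.pos
  have h5 : (q:ℝ) * fl (fun p => nuP p H) q ≤ k := by
    have := hν.fl_le hq
    rw [le_div_iff₀ hp0] at this; linarith
  have hc := hν.cmf_pos (Nat.lcm d e)
  have h6 : ((q * Nat.lcm d e : ℕ) : ℝ) * (fl (fun p => nuP p H) q * cmf (fun p => nuP p H) (Nat.lcm d e)) ≤ k * (Nat.lcm d e * cmf (fun p => nuP p H) (Nat.lcm d e)) := by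
    push_cast
    calc _ = ((q:ℝ) * fl (fun p => nuP p H) q) * (Nat.lcm d e * cmf (fun p => nuP p H) (Nat.lcm d e)) := by ring
      _ ≤ _ := by gcongr
  have h7 := h.trans h6
  rw [abs_le] at h7 h' ⊢
  constructor
  · linarith [h7.1, h7.2, h'.1, h'.2]
  · linarith [h7.1, h7.2, h'.1, h'.2]

end PartV3

section PartV4

open Finset Filter Topology MeasureTheory

lemma Fp_bd (K : ℕ) {v L : ℝ} (hv : v ≤ L) (hL : 0 ≤ L) : 0 ≤ Fp K v ∧ Fp K v ≤ L ^ K := by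
  unfold Fp
  split_ifs with h
  · have h1 : (1:ℝ) ≤ K.factorial := by exact_mod_cast K.factorial_pos
    refine ⟨by positivity, ?_⟩
    calc v ^ K / K.factorial ≤ v ^ K := div_le_self (by positivity) h1
      _ ≤ _ := by gcongr
  · exact ⟨le_rfl, by positivity⟩

lemma cmf_sum_bd (k : ℕ) : ∃ C : ℝ, 1 ≤ C ∧ ∀ (y : ℝ) (ν : ℕ → ℕ), NuOK k y ν → ∀ L, C ≤ L →
    ∑ d ∈ Ioc 0 ⌊Real.exp L⌋₊, cmf ν d ≤ C * L ^ (k+3) := by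
  obtain ⟨C, hC, h⟩ := cmf_growth k 3 le_rfl
  have hb : 6 * C ≤ 6 * C * 2 ^ (k+3) := le_mul_of_one_le_right (by positivity) (one_le_pow₀ (by norm_num))
  refine ⟨6 * C * 2 ^ (k+3) + 1, by linarith [show (0:ℝ) ≤ 6 * C * 2^(k+3) by positivity], fun y ν hν L hL => ?_⟩
  have hL1 : 1 ≤ L := by linarith
  have h1 := h y ν hν (L+1) (by linarith)
  have h2 : ∑ d ∈ Ioc 0 ⌊Real.exp L⌋₊, cmf ν d ≤ 6 * SS (cmf ν) 3 (L+1) := by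
    unfold SS
    rw [mul_sum]
    have hsub : Ioc 0 ⌊Real.exp L⌋₊ ⊆ Ioc 0 ⌊Real.exp (L+1)⌋₊ := by
      apply Ioc_subset_Ioc_right
      apply Nat.floor_le_floor
      exact Real.exp_le_exp.2 (by linarith)
    calc _ ≤ ∑ d ∈ Ioc 0 ⌊Real.exp L⌋₊, 6 * (cmf ν d * ((L + 1 - Real.log d) ^ 3 / (Nat.factorial 3))) := by
          refine sum_le_sum fun d hd => ?_
          have h3 := (mem_floor_exp.1 hd).2
          have h4 := hν.cmf_pos d
          have h5 : (1:ℝ) ≤ (L + 1 - Real.log d) ^ 3 := one_le_pow₀ (by linarith)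
          have : ((Nat.factorial 3 : ℕ) : ℝ) = 6 := by norm_num [Nat.factorial]
          rw [this]
          nlinarith
      _ ≤ _ := by
          refine sum_le_sum_of_subset_of_nonneg hsub fun d hd _ => ?_
          have h3 := (mem_floor_exp.1 hd).2
          have h4 := hν.cmf_pos d
          have : 0 ≤ L + 1 - Real.log d := by linarith
          positivity
  have h3 : (L+1)^(k+3) ≤ 2^(k+3) * L^(k+3) := by
    rw [← mul_pow]; gcongr; linarith
  calc _ ≤ 6 * (C * (L+1)^(k+3)) := by linarith
    _ ≤ 6 * (C * (2^(k+3) * L^(k+3))) := by gcongr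
    _ ≤ _ := by nlinarith [show (0:ℝ) ≤ L^(k+3) by positivity]

lemma err_bd {k : ℕ} {y : ℝ} {ν : ℕ → ℕ} (hν : NuOK k y ν) {C L : ℝ} (K : ℕ) (hL : 0 ≤ L)
    (h : ∑ d ∈ Ioc 0 ⌊Real.exp L⌋₊, cmf ν d ≤ C * L ^ (k+3)) (G : ℕ → ℝ) (hG : ∀ d ∈ Ioc 0 ⌊Real.exp L⌋₊, |G d| ≤ L ^ K) :
    (∑ d ∈ Ioc 0 ⌊Real.exp L⌋₊, |G d| * (d * cmf ν d)) ^ 2 ≤ C ^ 2 * L ^ (2 * K + 2 * k + 6) * Real.exp (2 * L) := by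
  have hnn : 0 ≤ ∑ d ∈ Ioc 0 ⌊Real.exp L⌋₊, |G d| * (d * cmf ν d) :=
    sum_nonneg fun d _ => mul_nonneg (abs_nonneg _) (mul_nonneg (Nat.cast_nonneg _) (hν.cmf_pos _).le)
  have h1 : ∑ d ∈ Ioc 0 ⌊Real.exp L⌋₊, |G d| * (d * cmf ν d) ≤ L ^ K * Real.exp L * (C * L ^ (k+3)) := by
    calc _ ≤ ∑ d ∈ Ioc 0 ⌊Real.exp L⌋₊, L ^ K * (Real.exp L * cmf ν d) := by
          refine sum_le_sum fun d hd => ?_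
          have h2 := hG d hd
          have h3 := (Nat.le_floor_iff (Real.exp_nonneg L)).1 (mem_Ioc.1 hd).2
          have h4 := hν.cmf_pos d
          gcongr
      _ = L ^ K * Real.exp L * ∑ d ∈ Ioc 0 ⌊Real.exp L⌋₊, cmf ν d := by
          rw [mul_sum]; refine sum_congr rfl fun d _ => ?_; ring
      _ ≤ _ := by gcongr
  calc _ ≤ (L ^ K * Real.exp L * (C * L ^ (k+3))) ^ 2 := by gcongr
    _ = _ := by rw [two_mul L, Real.exp_add]; ring

lemma final_ineq {k f N Q Q' S T Tot κ Er : ℝ} (hk : 1 ≤ k) (hf0 : 0 < f) (hf1 : f < 1) (hf2 : 1 / (1 - f) ≤ 2 * k)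
    (hN : 0 ≤ N) (hEr : 0 ≤ Er) (hκ0 : 0 ≤ κ) (hκ : κ ≤ k ^ 2)
    (hS : S ≤ N * f * Q' + k * Er) (hT : N * (1 - f) * Q - (1 + k) * Er ≤ T) (hTot : T ≤ Tot)
    (hQ : Q' ≤ 0.3 * κ * Q) (hmain : 90 * k ^ 4 * Er ≤ f * κ * N * Q) :
    S ≤ f / (1 - f) * (κ / 3) * Tot := by
  have hs : 0 < 1 - f := by linarith
  have h1 : f / (1 - f) * (κ / 3) * (N * (1 - f) * Q - (1 + k) * Er) ≤ f / (1 - f) * (κ / 3) * Tot := by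
    apply mul_le_mul_of_nonneg_left (hT.trans hTot); positivity
  have h2 : f / (1 - f) * (κ / 3) * (N * (1 - f) * Q - (1 + k) * Er) = f * κ * N * Q / 3 - (f / (1 - f)) * (κ / 3 * ((1 + k) * Er)) := by
    field_simp
  have h3 : f / (1 - f) ≤ 2 * k := by
    refine le_trans ?_ hf2
    gcongr
  have h4 : (f / (1 - f)) * (κ / 3 * ((1 + k) * Er)) ≤ (2 * k) * (k ^ 2 / 3 * ((2 * k) * Er)) := by
    gcongr; linarith
  have h5 : N * f * Q' ≤ N * f * (0.3 * κ * Q) := by gcongr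
  have h6 : k * Er ≤ k ^ 4 * Er := by
    apply mul_le_mul_of_nonneg_right _ hEr
    exact le_self_pow₀ hk (by norm_num)
  have h7 : 0 ≤ k ^ 4 * Er := by positivity
  nlinarith

end PartV4

section PartV5

open Finset Filter Topology MeasureTheory

lemma size_lemma {N : ℕ} {R δ D : ℝ} {E : ℕ} (hδ : 0 < δ) (hD : D ≤ Real.log N) (hlog : 1 ≤ Real.log N) (hN : 1 ≤ N)
    (hR1 : 1 ≤ R) (hR : R ≤ (N:ℝ) ^ (1/(2+δ)) * (Real.log N) ^ (-(((E:ℝ)+1)/2))) (hD0 : 0 ≤ D) :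
    D * Real.log R ^ E * R ^ (2+δ) ≤ N := by
  have hN1 : (1:ℝ) ≤ N := by exact_mod_cast hN
  have hl0 : 0 < Real.log N := by linarith
  have hb : (Real.log N) ^ (-(((E:ℝ)+1)/2)) ≤ 1 := Real.rpow_le_one_of_one_le_of_nonpos hlog (by have : (0:ℝ) ≤ E := Nat.cast_nonneg _; linarith)
  have hRN : R ≤ N := by
    calc R ≤ (N:ℝ) ^ (1/(2+δ)) * 1 := hR.trans (by gcongr)
      _ ≤ N := by
        rw [mul_one]
        refine Real.rpow_le_self_of_one_le hN1 ?_
        rw [div_le_one (by linarith)]; linarith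
  have hLL : Real.log R ≤ Real.log N := Real.log_le_log (by linarith) hRN
  have hL0 : 0 ≤ Real.log R := Real.log_nonneg hR1
  have h1 : R ^ (2+δ) ≤ N * (Real.log N) ^ (-((E:ℝ)+1)) := by
    calc R ^ (2+δ) ≤ ((N:ℝ) ^ (1/(2+δ)) * (Real.log N) ^ (-(((E:ℝ)+1)/2))) ^ (2+δ) := Real.rpow_le_rpow (by linarith) hR (by linarith)
      _ = N * (Real.log N) ^ (-(((E:ℝ)+1)/2) * (2+δ)) := by
        rw [Real.mul_rpow (by positivity) (by positivity), ← Real.rpow_mul (by positivity), ← Real.rpow_mul (by positivity),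
          one_div_mul_cancel (by linarith), Real.rpow_one]
      _ ≤ _ := by
        gcongr
        have : (0:ℝ) ≤ E := Nat.cast_nonneg _
        nlinarith
  calc D * Real.log R ^ E * R ^ (2+δ) ≤ Real.log N * Real.log N ^ E * (N * (Real.log N) ^ (-((E:ℝ)+1))) := by gcongr
    _ = N * ((Real.log N) ^ ((E:ℝ)+1) * (Real.log N) ^ (-((E:ℝ)+1))) := by
      rw [Real.rpow_add hl0, Real.rpow_natCast, Real.rpow_one]; ring
    _ = N := by rw [← Real.rpow_add hl0]; simp

set_option maxHeartbeats 1600000 in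
theorem main_thm (A₁ A₂ Ch : ℝ) (hA₁ : 0 < A₁) (hA₂ : 0 < A₂) (hCh : 0 < Ch) :
    ∃ c₀ : ℝ, 0 < c₀ ∧ ∃ k₀ : ℕ, ∀ k ℓ : ℕ, k₀ ≤ k →
      A₁ * Real.sqrt k ≤ (ℓ : ℝ) → (ℓ : ℝ) ≤ A₂ * Real.sqrt k →
    ∀ δ : ℝ, 0 < δ → δ ≤ c₀ * (k : ℝ) ^ (-(3:ℝ)/2) →
    ∃ c₂ : ℝ, ∃ N₀ : ℕ, ∀ N : ℕ, N₀ ≤ N → ∀ R : ℝ,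
      (N : ℝ) ^ ((1:ℝ)/5) ≤ R → R ≤ (N : ℝ) ^ (1/(2+δ)) * (Real.log N) ^ (-c₂) →
    ∀ h : ℝ, 0 < h → h ≤ Ch * Real.log R →
    ∀ H : Finset ℕ, H ⊆ Finset.Icc 1 ⌊h⌋₊ → H.card = k → Admissible H →
    ∀ q : ℕ, q.Prime → ∀ β : ℝ, 0 < β → β ≤ δ → (q : ℝ) = R ^ β →
      ∑ n ∈ (Finset.Ioc N (2*N)).filter (fun n => q ∣ tuplePoly H n),
          (LambdaR R n H ℓ) ^ 2
        ≤ (nuP q H : ℝ) / ((q : ℝ) - nuP q H) * ((k : ℝ)^2 * β^2 / 3) *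
            ∑ n ∈ Finset.Ioc N (2*N), (LambdaR R n H ℓ) ^ 2 := by
  refine ⟨1, one_pos, ⌈(400 * A₂ + 13 / A₁ + 2) ^ 2⌉₊, fun k ℓ hk hℓ1 hℓ2 δ hδ0 hδ => ?_⟩
  have hk' : (400 * A₂ + 13 / A₁ + 2) ^ 2 ≤ (k:ℝ) := (Nat.le_ceil _).trans (by exact_mod_cast hk)
  have h13 : 0 < 13 / A₁ := by positivity
  have hsq : 400 * A₂ + 13 / A₁ + 2 ≤ Real.sqrt k := Real.le_sqrt_of_sq_le hk'
  have hkk : Real.sqrt k * Real.sqrt k = k := Real.mul_self_sqrt (Nat.cast_nonneg _)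
  have hk4 : 4 ≤ k := by
    have : (4:ℝ) ≤ k := by nlinarith
    exact_mod_cast this
  have hk1 : (1:ℝ) ≤ k := by
    have : (4:ℝ) ≤ k := by exact_mod_cast hk4
    linarith
  have hℓ13 : 13 ≤ ℓ := by
    have h1 : 13 / A₁ ≤ Real.sqrt k := by linarith
    rw [div_le_iff₀ hA₁] at h1
    have : (13:ℝ) ≤ ℓ := by linarith
    exact_mod_cast this
  have hkl : (k:ℝ) + 2 * ℓ ≤ 1.005 * k := by
    have h1 : 400 * A₂ * Real.sqrt k ≤ Real.sqrt k * Real.sqrt k := by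
      apply mul_le_mul_of_nonneg_right _ (Real.sqrt_nonneg _); linarith
    rw [hkk] at h1
    linarith
  have hδ1 : δ ≤ 1 := by
    rw [one_mul] at hδ
    exact hδ.trans (Real.rpow_le_one_of_one_le_of_nonpos hk1 (by norm_num))
  have hB : (1:ℝ) ≤ 1 + Ch := by linarith
  obtain ⟨c, L₀, hc, hL₀, hratio⟩ := ratio_main hk4 hℓ13 hkl hB
  obtain ⟨C, hC, hCb⟩ := cmf_sum_bd k
  set E : ℕ := 2 * (k + ℓ) + 2 * k + 8 with hE
  set D : ℝ := 360 * (k:ℝ) ^ 4 * C ^ 2 / c with hD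
  have hD0 : 0 ≤ D := by positivity
  refine ⟨((E:ℝ)+1)/2, ⌈Real.exp (5 * L₀ + 5 * C + D)⌉₊, fun N hN R hR1 hR2 h hh0 hh H hH hcard hadm q hq β hβ0 hβ hqR => ?_⟩
  have hNe : Real.exp (5 * L₀ + 5 * C + D) ≤ N := (Nat.le_ceil _).trans (by exact_mod_cast hN)
  have hNpos : (0:ℝ) < N := (Real.exp_pos _).trans_le hNe
  have hlogN : 5 * L₀ + 5 * C + D ≤ Real.log N := (Real.le_log_iff_exp_le hNpos).2 hNe
  have hRpos : 0 < R := (Real.rpow_pos_of_pos hNpos _).trans_le hR1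
  have hLN : 1 / 5 * Real.log N ≤ Real.log R := by
    rw [← Real.log_rpow hNpos]
    exact Real.log_le_log (Real.rpow_pos_of_pos hNpos _) hR1
  set L := Real.log R with hL
  have hRL : R = Real.exp L := (Real.exp_log hRpos).symm
  have hLL0 : L₀ ≤ L := by linarith
  have hLC : C ≤ L := by linarith
  have hL1 : 1 ≤ L := by linarith
  have hRone : 1 ≤ R := by rw [hRL]; exact Real.one_le_exp (by linarith)
  have hν : NuOK k ((1 + Ch) * L) (fun p => nuP p H) := nuOK_of H (by omega) hH hcard hadm (by linarith)
  have hlogq : Real.log q = β * L := by rw [hqR, Real.log_rpow hRpos]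
  have hqL : Real.log q ≤ L := by rw [hlogq]; nlinarith
  obtain ⟨hQ, hQc⟩ := hratio _ L hLL0 hν q hq hqL
  have hβe : Real.log q / L = β := by rw [hlogq]; field_simp
  rw [hβe] at hQ
  have hq0 : (0:ℝ) < q := by exact_mod_cast hq.pos
  have hsize := size_lemma (E := E) hδ0 (show D ≤ Real.log N by linarith) (by linarith) (by exact_mod_cast hNpos) hRone hR2 hD0
  have hsum := hCb _ _ hν L hLC
  have hlogq0 : 0 ≤ Real.log q := Real.log_natCast_nonneg q
  have hS := S_bound H hν ℓ N L hq hcard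
  have hT := T_bound H hν ℓ N L hq hcard
  set Er := C ^ 2 * L ^ (2 * (k + ℓ) + 2 * k + 6) * Real.exp (2 * L) with hEr
  have e1 := err_bd hν (k + ℓ) (by linarith) hsum (fun d => Fp (k+ℓ) (L - Real.log d)) (by
    intro d _
    have h0 := Real.log_natCast_nonneg d
    obtain ⟨a, b⟩ := Fp_bd (k+ℓ) (show L - Real.log d ≤ L by linarith) (by linarith)
    rwa [abs_of_nonneg a])
  have e2 := err_bd hν (k + ℓ) (by linarith) hsum (fun d => Fp (k+ℓ) (L - Real.log d) - Fp (k+ℓ) (L - Real.log q - Real.log d)) (by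
    intro d _
    have h0 := Real.log_natCast_nonneg d
    obtain ⟨a, b⟩ := Fp_bd (k+ℓ) (show L - Real.log d ≤ L by linarith) (by linarith)
    obtain ⟨a', b'⟩ := Fp_bd (k+ℓ) (show L - Real.log q - Real.log d ≤ L by linarith) (by linarith)
    rw [abs_le]; constructor <;> linarith)
  have hf : (nuP q H : ℝ) / ((q : ℝ) - nuP q H) = fl (fun p => nuP p H) q / (1 - fl (fun p => nuP p H) q) := by
    have h1 := hν.fl_lt_one hq
    have h2 : (nuP q H : ℝ) < q := by exact_mod_cast hadm q hq
    have h3 : (q:ℝ) - nuP q H ≠ 0 := by linarith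
    unfold fl
    field_simp
  have hTotT : ∑ n ∈ (Ioc N (2*N)).filter (fun n => ¬ q ∣ tuplePoly H n), LambdaR R n H ℓ ^ 2 ≤ ∑ n ∈ Ioc N (2*N), LambdaR R n H ℓ ^ 2 :=
    sum_le_sum_of_subset_of_nonneg (filter_subset _ _) fun _ _ _ => sq_nonneg _
  rw [hf]
  rw [← hRL] at hS hT e1 e2
  have hS' := (abs_le.1 (hS.trans (mul_le_mul_of_nonneg_left e2 (Nat.cast_nonneg k)))).2
  have hT' := (abs_le.1 (hT.trans (mul_le_mul_of_nonneg_left e1 (by positivity)))).1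
  rw [← hEr] at hS' hT'
  have hEr0 : 0 ≤ Er := by positivity
  have hmain : 90 * (k:ℝ) ^ 4 * Er ≤ fl (fun p => nuP p H) q * ((k:ℝ)^2 * β^2) * N * Qd (fun p => nuP p H) q (k+ℓ) L := by
    have g1 : Real.exp (-(δ * L)) ≤ fl (fun p => nuP p H) q := by
      have a1 : 1 / (q:ℝ) ≤ fl (fun p => nuP p H) q := by
        unfold fl
        have : (1:ℝ) ≤ nuP q H := by exact_mod_cast hν.one_le q hq
        gcongr
      refine le_trans ?_ a1
      rw [Real.exp_neg, one_div]
      apply inv_anti₀ hq0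
      rw [← Real.exp_log hq0, hlogq]
      exact Real.exp_le_exp.2 (by gcongr)
    have g2 : 1 / (4 * L ^ 2) ≤ (k:ℝ)^2 * β^2 := by
      have a1 : Real.log 2 ≤ Real.log q := Real.log_le_log (by norm_num) (by exact_mod_cast hq.two_le)
      have a2 := Real.log_two_gt_d9
      have a3 : 1 / 2 ≤ β * L := by rw [← hlogq]; linarith
      have a4 : (1/2)^2 ≤ (β * L)^2 := by gcongr
      have a5 : β ^ 2 ≤ (k:ℝ)^2 * β^2 := le_mul_of_one_le_left (by positivity) (one_le_pow₀ hk1)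
      refine le_trans ?_ a5
      rw [div_le_iff₀ (by positivity)]
      nlinarith
    have g3 : R ^ (2 + δ) = Real.exp (2 * L) * Real.exp (δ * L) := by
      rw [hRL, ← Real.exp_mul, ← Real.exp_add]; congr 1; ring
    rw [g3] at hsize
    have g4 : Real.exp (-(δ * L)) * (1 / (4 * L^2)) * (D * L ^ E * (Real.exp (2 * L) * Real.exp (δ * L))) * c = 90 * (k:ℝ)^4 * Er := by
      rw [Real.exp_neg, hEr, hD, hE]
      have x1 := Real.exp_pos (δ * L)
      have x2 : 2 * (k + ℓ) + 2 * k + 8 = 2 * (k + ℓ) + 2 * k + 6 + 2 := by ring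
      rw [x2, pow_add _ _ 2]
      field_simp
      ring
    rw [← g4]
    have y1 := (Real.exp_pos (-(δ * L))).le
    have y2 := hν.fl_pos hq
    gcongr
  clear_value Er D E L
  exact final_ineq hk1 (hν.fl_pos hq) (hν.fl_lt_one hq) (hν.inv_one_sub_le hq) hNpos.le hEr0 (by positivity)
    (by
      have : β ^ 2 ≤ 1 := pow_le_one₀ hβ0.le (hβ.trans hδ1)
      exact mul_le_of_le_one_right (by positivity) this)
    (Q' := Qd' (fun p => nuP p H) q (k+ℓ) L) (sub_le_iff_le_add'.1 hS') (by linarith only [hT']) hTotT (by rw [← mul_assoc]; exact hQ) hmain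

end PartV5

/-- **Sharpened Pintz Lemma 3 (GPY IV, (2.7)).** For `k` sufficiently large, `ℓ ≍ √k`,
`δ > 0` small compared to `k^{-3/2}`, `N` sufficiently large, `N^{1/5} ≤ R ≤
N^{1/(2+δ)}(log N)^{-c₂}`, an admissible `k`-tuple `H ⊆ [1,h]` with `h ≪ log R`, and a prime
`q = R^β` with `0 < β ≤ δ`:
`∑_{N<n≤2N, q ∣ P_H(n)} Λ_R(n;H,ℓ)² ≤ (ν_q(H)/(q-ν_q(H))) (k²β²/3) ∑_{N<n≤2N} Λ_R(n;H,ℓ)²`. -/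
theorem pintz_lemma3_sharp :
    ∀ A₁ A₂ Ch : ℝ, 0 < A₁ → 0 < A₂ → 0 < Ch →
    ∃ c₀ : ℝ, 0 < c₀ ∧ ∃ k₀ : ℕ, ∀ k ℓ : ℕ, k₀ ≤ k →
      A₁ * Real.sqrt k ≤ (ℓ : ℝ) → (ℓ : ℝ) ≤ A₂ * Real.sqrt k →
    ∀ δ : ℝ, 0 < δ → δ ≤ c₀ * (k : ℝ) ^ (-(3:ℝ)/2) →
    ∃ c₂ : ℝ, ∃ N₀ : ℕ, ∀ N : ℕ, N₀ ≤ N → ∀ R : ℝ,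
      (N : ℝ) ^ ((1:ℝ)/5) ≤ R → R ≤ (N : ℝ) ^ (1/(2+δ)) * (Real.log N) ^ (-c₂) →
    ∀ h : ℝ, 0 < h → h ≤ Ch * Real.log R →
    ∀ H : Finset ℕ, H ⊆ Finset.Icc 1 ⌊h⌋₊ → H.card = k → Admissible H →
    ∀ q : ℕ, q.Prime → ∀ β : ℝ, 0 < β → β ≤ δ → (q : ℝ) = R ^ β →
      ∑ n ∈ (Finset.Ioc N (2*N)).filter (fun n => q ∣ tuplePoly H n),
          (LambdaR R n H ℓ) ^ 2
        ≤ (nuP q H : ℝ) / ((q : ℝ) - nuP q H) * ((k : ℝ)^2 * β^2 / 3) *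
            ∑ n ∈ Finset.Ioc N (2*N), (LambdaR R n H ℓ) ^ 2 := by
  exact main_thm
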